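/- Let X be an irreducible shift of finite type with positive entropy h(X) = log λ. Let W_n ⊆ Ω_n be the event that X_ω has a unique irreducible component C of positive entropy and that C has the same period as X. Then there exists c > 0 such that for every α with 1 − c < α ≤ 1, lim_{n→∞} ℙ(W_n) = 1, and the convergence is exponential in n: there exist K > 0 and ρ > 0 such that 1 − ℙ(W_n) ≤ K e^{−ρn} for all large n. -/

import Mathlib

open Filter Topology
open scoped Classical

noncomputable section

variable {A : Type*}

/-- The left shift map on bi-infinite sequences over the alphabet `A`. -/
def shiftMap (x : ℤ → A) : ℤ → A := fun i => x (i + 1)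

/-- The word `w` of length `n` occurs in the bi-infinite sequence `x`. -/
def OccursIn {n : ℕ} (w : Fin n → A) (x : ℤ → A) : Prop :=
  ∃ i : ℤ, ∀ j : Fin n, x (i + ((j : ℕ) : ℤ)) = w j

/-- `X` is a shift of finite type: the set of bi-infinite sequences avoiding a
finite set `F` of forbidden words. -/
def IsSFT (X : Set (ℤ → A)) : Prop :=
  ∃ F : Set ((n : ℕ) × (Fin n → A)), F.Finite ∧
    X = {x | ∀ w ∈ F, ¬ OccursIn w.2 x}

/-- `B_n(X)`: the set of words of length `n` appearing in points of `X`. -/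
def wordsOf (X : Set (ℤ → A)) (n : ℕ) : Set (Fin n → A) :=
  {w | ∃ x ∈ X, OccursIn w x}

/-- The length-`n` subword of `x` starting at position `i`. -/
def subword (x : ℤ → A) (i : ℤ) (n : ℕ) : Fin n → A :=
  fun j => x (i + ((j : ℕ) : ℤ))

/-- The random SFT `X_ω`: points of `X` all of whose length-`n` subwords are
allowed by `ω` (a word `w` is allowed iff `ω w = true`). -/
def XRes (X : Set (ℤ → A)) {n : ℕ} (ω : (Fin n → A) → Bool) : Set (ℤ → A) :=
  {x | x ∈ X ∧ ∀ i : ℤ, ω (subword x i n) = true}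

/-- The probability of the event `Ev` when each coordinate in `E` is chosen to be
`true` independently with probability `α` (i.i.d. Bernoulli(α) coins). -/
def bprob {E : Type*} [Fintype E] [DecidableEq E] (α : ℝ) (Ev : Set (E → Bool)) : ℝ :=
  ∑ ω : E → Bool,
    if ω ∈ Ev then
      α ^ (Finset.univ.filter fun e => ω e = true).card *
        (1 - α) ^ (Finset.univ.filter fun e => ω e = false).card
    else 0

/-- `N_p`: the number of points of `X` fixed by the `p`-th power of the shift. -/
def periodicCount (X : Set (ℤ → A)) (p : ℕ) : ℕ :=
  Nat.card {x : ℤ → A // x ∈ X ∧ shiftMap^[p] x = x}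

/-- The Artin–Mazur zeta function `ζ_X(t) = exp (∑_{p ≥ 1} N_p t^p / p)`. -/
def zetaX (X : Set (ℤ → A)) (t : ℝ) : ℝ :=
  Real.exp (∑' p : ℕ, (periodicCount X (p + 1) : ℝ) / (p + 1) * t ^ (p + 1))

end

noncomputable section

variable {A : Type*}

/-- A subshift: a closed, shift-invariant subset of the full shift
(`A` carries the discrete topology, `ℤ → A` the product topology). -/
def IsSubshift [TopologicalSpace A] (X : Set (ℤ → A)) : Prop :=
  IsClosed X ∧ shiftMap '' X = X

/-- Irreducibility: for every two open sets `U`, `V` meeting `X` and every `N`,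
there exists `n ≥ N` with `σ^n(U ∩ X) ∩ (V ∩ X) ≠ ∅`. -/
def IsIrredSubshift [TopologicalSpace A] (X : Set (ℤ → A)) : Prop :=
  IsSubshift X ∧
    ∀ U V : Set (ℤ → A), IsOpen U → IsOpen V →
      (X ∩ U).Nonempty → (X ∩ V).Nonempty →
        ∀ N : ℕ, ∃ m ≥ N, ((shiftMap^[m]) '' (X ∩ U) ∩ (X ∩ V)).Nonempty

/-- `C` is an irreducible component of `Y`: a nonempty maximal irreducible SFT
contained in `Y`. -/
def IsIrredComponent [TopologicalSpace A] (Y C : Set (ℤ → A)) : Prop :=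
  C.Nonempty ∧ IsSFT C ∧ C ⊆ Y ∧ IsIrredSubshift C ∧
    ∀ C' : Set (ℤ → A), IsSFT C' → C' ⊆ Y → IsIrredSubshift C' → C ⊆ C' → C' = C

/-- The topological entropy of a subshift, via `h(Y) = inf_n (1/n) log |B_n(Y)|`. -/
def subEntropy (Y : Set (ℤ → A)) : ℝ :=
  ⨅ n : ℕ, Real.log ((wordsOf Y (n + 1)).ncard) / (n + 1)

/-- `p` is the greatest common divisor of the set `s` of natural numbers. -/
def IsGCDOf (s : Set ℕ) (p : ℕ) : Prop :=
  (∀ k ∈ s, p ∣ k) ∧ ∀ q : ℕ, (∀ k ∈ s, q ∣ k) → q ∣ p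

/-- The set of (not necessarily least) periods of periodic points of `Y`;
the period of `Y` is the gcd of this set. -/
def periodSet (Y : Set (ℤ → A)) : Set ℕ :=
  {q : ℕ | 1 ≤ q ∧ ∃ x ∈ Y, shiftMap^[q] x = x}

end

section Bernoulli

variable {E ι : Type*} [Fintype E] [DecidableEq E]

/-- The product Bernoulli weight of a configuration. -/
noncomputable def bernWeight (α : ℝ) (ω : E → Bool) : ℝ :=
  ∏ e, if ω e = true then α else 1 - α

theorem bprob_eq_sum_bernWeight (α : ℝ) (Ev : Set (E → Bool)) :
    bprob α Ev = ∑ ω, if ω ∈ Ev then bernWeight α ω else 0 := by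
  unfold bprob
  refine Finset.sum_congr rfl fun ω _ => ?_
  congr 1
  rw [bernWeight, Finset.prod_ite, Finset.prod_const, Finset.prod_const]
  simp only [Bool.not_eq_true]

theorem bernWeight_nonneg {E : Type*} [Fintype E] {α : ℝ} (h0 : 0 ≤ α) (h1 : α ≤ 1) (ω : E → Bool) :
    0 ≤ bernWeight α ω := by
  refine Finset.prod_nonneg fun e _ => ?_
  split_ifs <;> linarith

/-- Summing a product of one-coordinate functions over all configurations. -/
theorem sum_prod_bool (f : E → Bool → ℝ) :
    ∑ ω : E → Bool, ∏ e, f e (ω e) = ∏ e, (f e true + f e false) := by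
  have := Finset.prod_univ_sum (fun _ : E => (Finset.univ : Finset Bool)) f
  simp only [Fintype.piFinset_univ, Fintype.sum_bool] at this
  exact this.symm

theorem sum_bernWeight (α : ℝ) : ∑ ω : E → Bool, bernWeight α ω = 1 := by
  unfold bernWeight
  rw [sum_prod_bool (fun _ b => if b = true then α else 1 - α)]
  simp

theorem bprob_nonneg {α : ℝ} (h0 : 0 ≤ α) (h1 : α ≤ 1) (Ev : Set (E → Bool)) :
    0 ≤ bprob α Ev := by
  rw [bprob_eq_sum_bernWeight]
  refine Finset.sum_nonneg fun ω _ => ?_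
  split_ifs
  exacts [bernWeight_nonneg h0 h1 ω, le_rfl]

theorem bprob_mono {α : ℝ} (h0 : 0 ≤ α) (h1 : α ≤ 1) {Ev Ev' : Set (E → Bool)}
    (h : Ev ⊆ Ev') : bprob α Ev ≤ bprob α Ev' := by
  rw [bprob_eq_sum_bernWeight, bprob_eq_sum_bernWeight]
  refine Finset.sum_le_sum fun ω _ => ?_
  have := bernWeight_nonneg h0 h1 ω
  by_cases h2 : ω ∈ Ev
  · rw [if_pos h2, if_pos (h h2)]
  · rw [if_neg h2]; split_ifs <;> simp [this]

theorem bprob_univ (α : ℝ) : bprob α (Set.univ : Set (E → Bool)) = 1 := by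
  rw [bprob_eq_sum_bernWeight, ← sum_bernWeight (E := E) α]
  simp

theorem bprob_le_one {α : ℝ} (h0 : 0 ≤ α) (h1 : α ≤ 1) (Ev : Set (E → Bool)) :
    bprob α Ev ≤ 1 :=
  (bprob_mono h0 h1 (Set.subset_univ _)).trans_eq (bprob_univ α)

theorem one_sub_bprob (α : ℝ) (Ev : Set (E → Bool)) : 1 - bprob α Ev = bprob α Evᶜ := by
  rw [← bprob_univ (E := E) α, bprob_eq_sum_bernWeight, bprob_eq_sum_bernWeight,
    bprob_eq_sum_bernWeight, ← Finset.sum_sub_distrib]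
  refine Finset.sum_congr rfl fun ω _ => ?_
  by_cases h : ω ∈ Ev <;> simp [h]

theorem bprob_union_le {α : ℝ} (h0 : 0 ≤ α) (h1 : α ≤ 1) (Ev Ev' : Set (E → Bool)) :
    bprob α (Ev ∪ Ev') ≤ bprob α Ev + bprob α Ev' := by
  rw [bprob_eq_sum_bernWeight, bprob_eq_sum_bernWeight, bprob_eq_sum_bernWeight,
    ← Finset.sum_add_distrib]
  refine Finset.sum_le_sum fun ω _ => ?_
  have := bernWeight_nonneg h0 h1 ω
  by_cases h : ω ∈ Ev <;> by_cases h' : ω ∈ Ev' <;> simp [h, h', this]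

theorem bprob_empty (α : ℝ) : bprob α (∅ : Set (E → Bool)) = 0 := by
  simp [bprob_eq_sum_bernWeight]

theorem bprob_biUnion_le {α : ℝ} (h0 : 0 ≤ α) (h1 : α ≤ 1) (s : Finset ι)
    (Ev : ι → Set (E → Bool)) :
    bprob α (⋃ i ∈ s, Ev i) ≤ ∑ i ∈ s, bprob α (Ev i) := by
  induction s using Finset.induction_on with
  | empty => simp [bprob_empty]
  | insert a s ha ih =>
    rw [Finset.set_biUnion_insert, Finset.sum_insert ha]
    exact (bprob_union_le h0 h1 _ _).trans (by gcongr)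

theorem bprob_exists_le {α : ℝ} (h0 : 0 ≤ α) (h1 : α ≤ 1) [Fintype ι]
    (Ev : ι → Set (E → Bool)) {b : ℝ} (h : ∀ i, bprob α (Ev i) ≤ b) :
    bprob α {ω | ∃ i, ω ∈ Ev i} ≤ Fintype.card ι * b := by
  have h2 : {ω | ∃ i, ω ∈ Ev i} = ⋃ i ∈ (Finset.univ : Finset ι), Ev i := by
    ext ω; simp
  rw [h2]
  refine (bprob_biUnion_le h0 h1 _ _).trans ((Finset.sum_le_sum fun i _ => h i).trans_eq ?_)
  simp

/-- If independent coordinates `a`, `b` are combined coordinatewise by `φ` and the combination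
has the Bernoulli(α) law, then probabilities can be computed through the pair. -/
theorem bprob_eq_sum_of_coupling {α β γ : ℝ} (φ : E → Bool → Bool → Bool)
    (hφ : ∀ e c, ∑ a : Bool, ∑ b : Bool, (if φ e a b = c then
      (if a = true then β else 1 - β) * (if b = true then γ else 1 - γ) else 0) =
        if c = true then α else 1 - α) (Ev : Set (E → Bool)) :
    bprob α Ev =
      ∑ ω₁ : E → Bool, bernWeight β ω₁ * bprob γ {ω₂ | (fun e => φ e (ω₁ e) (ω₂ e)) ∈ Ev} := by
  have key : ∀ ω : E → Bool, bernWeight α ω = ∑ ω₁ : E → Bool, ∑ ω₂ : E → Bool,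
      if (fun e => φ e (ω₁ e) (ω₂ e)) = ω then bernWeight β ω₁ * bernWeight γ ω₂ else 0 := by
    intro ω
    have h1 := Finset.prod_univ_sum (fun _ : E => (Finset.univ : Finset Bool))
      (fun e a => ∑ b : Bool, (if φ e a b = ω e then
      (if a = true then β else 1 - β) * (if b = true then γ else 1 - γ) else 0))
    simp only [Fintype.piFinset_univ] at h1
    simp only [hφ] at h1
    rw [bernWeight, h1]
    refine Finset.sum_congr rfl fun ω₁ _ => ?_
    have h2 := Finset.prod_univ_sum (fun _ : E => (Finset.univ : Finset Bool))
      (fun e b => (if φ e (ω₁ e) b = ω e then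
      (if ω₁ e = true then β else 1 - β) * (if b = true then γ else 1 - γ) else 0))
    simp only [Fintype.piFinset_univ] at h2
    rw [h2]
    refine Finset.sum_congr rfl fun ω₂ _ => ?_
    split_ifs with h3
    · rw [bernWeight, bernWeight, ← Finset.prod_mul_distrib]
      refine Finset.prod_congr rfl fun e _ => ?_
      rw [if_pos (congrFun h3 e)]
    · obtain ⟨e, he⟩ := Function.ne_iff.1 h3
      exact Finset.prod_eq_zero (Finset.mem_univ e) (if_neg he)
  rw [bprob_eq_sum_bernWeight]
  have h4 : ∀ ω : E → Bool, (if ω ∈ Ev then bernWeight α ω else 0) =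
      ∑ ω₁ : E → Bool, ∑ ω₂ : E → Bool,
      if (fun e => φ e (ω₁ e) (ω₂ e)) = ω then
        (if ω ∈ Ev then bernWeight β ω₁ * bernWeight γ ω₂ else 0) else 0 := by
    intro ω
    rw [key]
    by_cases h : ω ∈ Ev <;> simp [h]
  rw [Finset.sum_congr rfl fun ω _ => h4 ω, Finset.sum_comm]
  refine Finset.sum_congr rfl fun ω₁ _ => ?_
  rw [Finset.sum_comm, bprob_eq_sum_bernWeight, Finset.mul_sum]
  refine Finset.sum_congr rfl fun ω₂ _ => ?_
  rw [Finset.sum_ite_eq]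
  simp [mul_ite]

/-- A coordinate is open as soon as one of two independent coins is. -/
theorem bprob_eq_sum_or {α β γ : ℝ} (h : 1 - α = (1 - β) * (1 - γ)) (Ev : Set (E → Bool)) :
    bprob α Ev =
      ∑ ω₁ : E → Bool, bernWeight β ω₁ * bprob γ {ω₂ | (fun e => (ω₁ e || ω₂ e)) ∈ Ev} := by
  refine bprob_eq_sum_of_coupling (fun _ a b => a || b) (fun e c => ?_) Ev
  cases c <;> simp <;> linarith

/-- Resampling the coordinates outside `S`. -/
theorem bprob_eq_sum_merge (α : ℝ) (S : Set E) (Ev : Set (E → Bool)) :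
    bprob α Ev = ∑ ω₁ : E → Bool, bernWeight α ω₁ *
      bprob α {ω₂ | (fun e => if e ∈ S then ω₁ e else ω₂ e) ∈ Ev} := by
  refine bprob_eq_sum_of_coupling (fun e a b => if e ∈ S then a else b) (fun e c => ?_) Ev
  by_cases he : e ∈ S <;> cases c <;> simp [he] <;> ring

/-- The event `Ev` depends only on the coordinates in `S`. -/
def DependsOnCoords (S : Set E) (Ev : Set (E → Bool)) : Prop :=
  ∀ ω ω' : E → Bool, (∀ e ∈ S, ω e = ω' e) → ω ∈ Ev → ω' ∈ Ev

theorem DependsOnCoords.mem_iff {E : Type*} {S : Set E} {Ev : Set (E → Bool)} (h : DependsOnCoords S Ev)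
    {ω ω' : E → Bool} (hω : ∀ e ∈ S, ω e = ω' e) : ω ∈ Ev ↔ ω' ∈ Ev :=
  ⟨h _ _ hω, h _ _ fun e he => (hω e he).symm⟩

theorem bprob_inter_of_disjoint (α : ℝ) {S T : Set E} {Ev Ev' : Set (E → Bool)}
    (hS : DependsOnCoords S Ev) (hT : DependsOnCoords T Ev') (hST : Disjoint S T) :
    bprob α (Ev ∩ Ev') = bprob α Ev * bprob α Ev' := by
  rw [bprob_eq_sum_merge α S, bprob_eq_sum_bernWeight α Ev, Finset.sum_mul]
  refine Finset.sum_congr rfl fun ω₁ _ => ?_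
  have h1 : ∀ ω₂ : E → Bool, (fun e => if e ∈ S then ω₁ e else ω₂ e) ∈ Ev ↔ ω₁ ∈ Ev :=
    fun ω₂ => hS.mem_iff fun e he => if_pos he
  have h2 : ∀ ω₂ : E → Bool, (fun e => if e ∈ S then ω₁ e else ω₂ e) ∈ Ev' ↔ ω₂ ∈ Ev' :=
    fun ω₂ => hT.mem_iff fun e he => if_neg (Set.disjoint_right.1 hST he)
  simp only [Set.mem_inter_iff, h1, h2]
  by_cases h : ω₁ ∈ Ev
  · simp [h]
  · simp [h, bprob_empty]

theorem bprob_forall_true (α : ℝ) (S : Finset E) :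
    bprob α {ω | ∀ e ∈ S, ω e = true} = α ^ S.card := by
  have h := sum_prod_bool (fun (e : E) b => if e ∈ S ∧ b = false then 0 else
    (if b = true then α else 1 - α))
  have h2 : (∏ e : E, ((if e ∈ S ∧ true = false then 0 else
      (if true = true then α else 1 - α)) + (if e ∈ S ∧ false = false then (0 : ℝ) else
      (if false = true then α else 1 - α)))) = α ^ S.card := by
    rw [← Finset.prod_const, ← Finset.prod_subset (Finset.subset_univ S)]
    · refine Finset.prod_congr rfl fun e he => ?_
      simp [he]
    · intro e _ he
      simp [he]
  rw [← h2, ← h, bprob_eq_sum_bernWeight]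
  refine Finset.sum_congr rfl fun ω _ => ?_
  split_ifs with h3
  · refine Finset.prod_congr rfl fun e _ => ?_
    have h4 : ¬(e ∈ S ∧ ω e = false) := by
      rintro ⟨h4, h5⟩
      rw [h3 e h4] at h5
      exact absurd h5 (by simp)
    rw [if_neg h4]
  · simp only [Set.mem_ofPred_eq, not_forall] at h3
    obtain ⟨e, he, h4⟩ := h3
    have h5 : e ∈ S ∧ ω e = false := ⟨he, by simpa using h4⟩
    symm
    apply Finset.prod_eq_zero (Finset.mem_univ e)
    exact if_pos h5

theorem bprob_false (α : ℝ) (e : E) : bprob α {ω | ω e = false} = 1 - α := by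
  have h := one_sub_bprob α {ω : E → Bool | ∀ e' ∈ ({e} : Finset E), ω e' = true}
  rw [bprob_forall_true] at h
  simp only [Finset.card_singleton, pow_one, Finset.mem_singleton, forall_eq] at h
  rw [h]
  congr 1
  ext ω
  simp

theorem bprob_forall_exists_false {α : ℝ} (h0 : 0 ≤ α) (h1 : α ≤ 1) (J : Finset ι)
    (S : ι → Finset E) (hd : (J : Set ι).PairwiseDisjoint S) {s : ℕ}
    (hs : ∀ j ∈ J, (S j).card ≤ s) :
    bprob α {ω | ∀ j ∈ J, ∃ e ∈ S j, ω e = false} ≤ (1 - α ^ s) ^ J.card := by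
  induction J using Finset.induction_on with
  | empty => simpa using bprob_le_one h0 h1 _
  | insert a J ha ih =>
    have hsplit : {ω : E → Bool | ∀ j ∈ insert a J, ∃ e ∈ S j, ω e = false} =
        {ω | ∃ e ∈ S a, ω e = false} ∩ {ω | ∀ j ∈ J, ∃ e ∈ S j, ω e = false} := by
      ext ω; simp
    rw [hsplit, bprob_inter_of_disjoint α (S := (S a : Set E))
      (T := {e | ∃ j ∈ J, e ∈ S j}), Finset.card_insert_of_notMem ha, pow_succ, mul_comm]
    · have hle : bprob α {ω : E → Bool | ∃ e ∈ S a, ω e = false} ≤ 1 - α ^ s := by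
        have h2 := one_sub_bprob α {ω : E → Bool | ∀ e ∈ S a, ω e = true}
        rw [bprob_forall_true] at h2
        have h3 : {ω : E → Bool | ∀ e ∈ S a, ω e = true}ᶜ = {ω | ∃ e ∈ S a, ω e = false} := by
          ext ω; simp
        rw [← h3, ← h2]
        have := pow_le_pow_of_le_one h0 h1 (hs a (Finset.mem_insert_self _ _))
        linarith
      have hpos : 0 ≤ 1 - α ^ s := sub_nonneg.2 (pow_le_one₀ h0 h1)
      exact mul_le_mul (ih (hd.subset (by simp)) fun j hj => hs j (Finset.mem_insert_of_mem hj))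
        hle (bprob_nonneg h0 h1 _) (pow_nonneg hpos _)
    · rintro ω ω' h ⟨e, he, h'⟩
      exact ⟨e, he, by rw [← h e he]; exact h'⟩
    · intro ω ω' h h' j hj
      obtain ⟨e, he, h''⟩ := h' j hj
      exact ⟨e, he, by rw [← h e ⟨j, hj, he⟩]; exact h''⟩
    · rw [Set.disjoint_left]
      rintro e he ⟨j, hj, he'⟩
      have hne : a ≠ j := fun h => ha (h ▸ hj)
      exact Finset.disjoint_left.1 (hd (by simp) (by simp [hj]) hne) he he'

/-- Among finite sets of size at most `s`, no point lying in more than `c` of them, a proportion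
`1 / (s c)` can be chosen pairwise disjoint. -/
theorem exists_pairwiseDisjoint_subfamily {E ι : Type*} [DecidableEq E] (J : Finset ι)
    (S : ι → Finset E) {s c : ℕ}
    (hs : ∀ j ∈ J, (S j).card ≤ s) (hne : ∀ j ∈ J, (S j).Nonempty)
    (hc : ∀ e, (J.filter fun j => e ∈ S j).card ≤ c) :
    ∃ J' ⊆ J, (J' : Set ι).PairwiseDisjoint S ∧ J.card ≤ J'.card * (s * c) := by
  obtain ⟨J', hJ', hmax⟩ := Finset.exists_max_image
    (J.powerset.filter fun J' : Finset ι => (J' : Set ι).PairwiseDisjoint S) Finset.card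
    ⟨∅, by simp⟩
  rw [Finset.mem_filter, Finset.mem_powerset] at hJ'
  refine ⟨J', hJ'.1, hJ'.2, ?_⟩
  have hcov : J ⊆ (J'.biUnion S).biUnion fun e => J.filter fun j => e ∈ S j := by
    intro j hj
    by_contra hcon
    have hdis : ∀ i ∈ J', Disjoint (S j) (S i) := by
      intro i hi
      rw [Finset.disjoint_left]
      intro e he he'
      apply hcon
      rw [Finset.mem_biUnion]
      exact ⟨e, Finset.mem_biUnion.2 ⟨i, hi, he'⟩, Finset.mem_filter.2 ⟨hj, he⟩⟩
    have hjn : j ∉ J' := by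
      intro hjJ
      obtain ⟨e, he⟩ := hne j hj
      exact Finset.disjoint_left.1 (hdis j hjJ) he he
    have h1 := hmax (insert j J') (by
      rw [Finset.mem_filter, Finset.mem_powerset]
      refine ⟨Finset.insert_subset hj hJ'.1, ?_⟩
      rw [Finset.coe_insert]
      exact hJ'.2.insert fun i hi _ => hdis i hi)
    rw [Finset.card_insert_of_notMem hjn] at h1
    omega
  calc J.card ≤ _ := Finset.card_le_card hcov
    _ ≤ (J'.biUnion S).card * c := Finset.card_biUnion_le_card_mul _ _ _ fun e _ => hc e
    _ ≤ (J'.card * s) * c := by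
        gcongr
        exact Finset.card_biUnion_le_card_mul _ _ _ fun j hj => hs j (hJ'.1 hj)
    _ = _ := by ring

theorem bprob_forall_exists_false_le_exp {α : ℝ} (h0 : 0 ≤ α) (h1 : α ≤ 1) (J : Finset ι)
    (S : ι → Finset E) {s c : ℕ} (hs0 : 0 < s) (hc0 : 0 < c)
    (hs : ∀ j ∈ J, (S j).card ≤ s)
    (hc : ∀ e, (J.filter fun j => e ∈ S j).card ≤ c) :
    bprob α {ω | ∀ j ∈ J, ∃ e ∈ S j, ω e = false} ≤
      Real.exp (-(α ^ s * (J.card / (s * c)))) := by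
  by_cases hne : ∀ j ∈ J, (S j).Nonempty
  swap
  · push Not at hne
    obtain ⟨j, hj, hj'⟩ := hne
    have : {ω : E → Bool | ∀ j ∈ J, ∃ e ∈ S j, ω e = false} = ∅ := by
      ext ω
      simp only [Set.mem_ofPred_eq, Set.mem_empty_iff_false, iff_false]
      intro h
      obtain ⟨e, he, -⟩ := h j hj
      simp [hj'] at he
    rw [this, bprob_empty]
    positivity
  obtain ⟨J', hJ', hd, hcard⟩ := exists_pairwiseDisjoint_subfamily J S hs hne hc
  calc bprob α {ω | ∀ j ∈ J, ∃ e ∈ S j, ω e = false}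
      ≤ bprob α {ω | ∀ j ∈ J', ∃ e ∈ S j, ω e = false} :=
        bprob_mono h0 h1 fun ω h j hj => h j (hJ' hj)
    _ ≤ (1 - α ^ s) ^ J'.card :=
        bprob_forall_exists_false h0 h1 J' S hd fun j hj => hs j (hJ' hj)
    _ ≤ (Real.exp (-α ^ s)) ^ J'.card := by
        gcongr
        · exact sub_nonneg.2 (pow_le_one₀ h0 h1)
        · have := Real.add_one_le_exp (-α ^ s); linarith
    _ = Real.exp (-(α ^ s * J'.card)) := by
        rw [← Real.exp_nat_mul]; congr 1; ring
    _ ≤ _ := by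
        apply Real.exp_le_exp.2
        apply neg_le_neg
        have : (J.card : ℝ) ≤ J'.card * (s * c) := by exact_mod_cast hcard
        have hp : (0 : ℝ) < s * c := by positivity
        have h2 : (J.card : ℝ) / (s * c) ≤ J'.card := by
          rw [div_le_iff₀ hp]; exact this
        gcongr

end Bernoulli

section Languages

variable {A : Type*}

/-- The language of an irreducible `M`-step shift of finite type with unbounded complexity. -/
structure IsLang (L : Set (List A)) (M : ℕ) : Prop where
  infix_mem : ∀ {u v : List A}, u ∈ L → v <:+: u → v ∈ L
  glue : ∀ {u v w : List A}, u ++ v ∈ L → v ++ w ∈ L → M ≤ v.length → u ++ v ++ w ∈ L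
  irred : ∀ {u v : List A}, u ∈ L → v ∈ L → ∃ g, u ++ g ++ v ∈ L
  unbounded : ∀ N : ℕ, ∃ n : ℕ, N < {l : List A | l ∈ L ∧ l.length = n}.ncard

/-- The language read backwards. -/
def revLang (L : Set (List A)) : Set (List A) := {l | l.reverse ∈ L}

theorem mem_revLang {L : Set (List A)} {l : List A} : l ∈ revLang L ↔ l.reverse ∈ L := Iff.rfl

namespace IsLang

variable {L : Set (List A)} {M : ℕ}

theorem rev (h : IsLang L M) : IsLang (revLang L) M where
  infix_mem {u v} hu hv := h.infix_mem (mem_revLang.1 hu) (List.reverse_infix.2 hv)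
  glue {u v w} huv hvw hM := by
    rw [mem_revLang, List.reverse_append] at *
    rw [List.reverse_append, ← List.append_assoc]
    exact h.glue hvw huv (by simpa using hM)
  irred {u v} hu hv := by
    obtain ⟨g, hg⟩ := h.irred (mem_revLang.1 hv) (mem_revLang.1 hu)
    exact ⟨g.reverse, by simpa [mem_revLang] using hg⟩
  unbounded N := by
    obtain ⟨n, hn⟩ := h.unbounded N
    refine ⟨n, hn.trans_eq ?_⟩
    rw [← Set.ncard_image_of_injective _ List.reverse_injective]
    congr 1
    ext l
    constructor
    · rintro ⟨l', ⟨h1, h2⟩, rfl⟩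
      exact ⟨by simpa [mem_revLang] using h1, by simpa using h2⟩
    · rintro ⟨h1, h2⟩
      exact ⟨l.reverse, ⟨h1, by simpa using h2⟩, by simp⟩

theorem left_mem (h : IsLang L M) {u v : List A} (huv : u ++ v ∈ L) : u ∈ L :=
  h.infix_mem huv (List.prefix_append u v).isInfix

theorem right_mem (h : IsLang L M) {u v : List A} (huv : u ++ v ∈ L) : v ∈ L :=
  h.infix_mem huv (List.suffix_append u v).isInfix

theorem exists_nonempty (h : IsLang L M) : ∃ u ∈ L, u ≠ [] := by
  obtain ⟨n, hn⟩ := h.unbounded 1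
  by_contra! hcon
  have : {l : List A | l ∈ L ∧ l.length = n} ⊆ {[]} := fun l hl => hcon l hl.1
  have := Set.ncard_le_ncard this (Set.finite_singleton _)
  rw [Set.ncard_singleton] at this
  omega

theorem exists_append_singleton (h : IsLang L M) {u : List A} (hu : u ∈ L) :
    ∃ a, u ++ [a] ∈ L := by
  obtain ⟨v, hv, hne⟩ := h.exists_nonempty
  obtain ⟨g, hg⟩ := h.irred hu hv
  rw [List.append_assoc] at hg
  obtain ⟨a, w, haw⟩ := List.exists_cons_of_ne_nil (l := g ++ v) (by simp [hne])
  rw [haw, ← List.singleton_append, ← List.append_assoc] at hg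
  exact ⟨a, h.left_mem hg⟩

theorem exists_append (h : IsLang L M) {u : List A} (hu : u ∈ L) (k : ℕ) :
    ∃ w : List A, w.length = k ∧ u ++ w ∈ L := by
  induction k with
  | zero => exact ⟨[], rfl, by simpa using hu⟩
  | succ k ih =>
    obtain ⟨w, hw, hw'⟩ := ih
    obtain ⟨a, ha⟩ := h.exists_append_singleton hw'
    exact ⟨w ++ [a], by simp [hw], by simpa using ha⟩

theorem exists_prepend (h : IsLang L M) {u : List A} (hu : u ∈ L) (k : ℕ) :
    ∃ w : List A, w.length = k ∧ w ++ u ∈ L := by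
  obtain ⟨w, hw, hw'⟩ := h.rev.exists_append (u := u.reverse) (by simpa [mem_revLang] using hu) k
  exact ⟨w.reverse, by simp [hw], by simpa [mem_revLang] using hw'⟩

variable [Finite A]

theorem exists_bounded_glue (h : IsLang L M) :
    ∃ L₀ : ℕ, ∀ u ∈ L, ∀ v ∈ L, ∃ g : List A, g.length ≤ L₀ ∧ u ++ g ++ v ∈ L := by
  have hfin : {l : List A | l.length = M}.Finite := List.finite_length_eq A M
  have h1 : ∀ q : List A × List A, ∃ g : List A, q.1 ∈ L → q.2 ∈ L → q.1 ++ g ++ q.2 ∈ L := by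
    intro q
    by_cases hq : q.1 ∈ L ∧ q.2 ∈ L
    · obtain ⟨g, hg⟩ := h.irred hq.1 hq.2
      exact ⟨g, fun _ _ => hg⟩
    · exact ⟨[], fun h1 h2 => absurd ⟨h1, h2⟩ hq⟩
  choose g hg using h1
  obtain ⟨L₀, hL₀⟩ := ((hfin.prod hfin).image fun q => (g q).length).bddAbove
  refine ⟨L₀, fun u hu v hv => ?_⟩
  obtain ⟨w, hw, hwu⟩ := h.exists_prepend hu M
  obtain ⟨w', hw', hvw⟩ := h.exists_append hv M
  set s := (w ++ u).drop ((w ++ u).length - M) with hs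
  set u₀ := (w ++ u).take ((w ++ u).length - M) with hu₀
  have hsu : u₀ ++ s = w ++ u := List.take_append_drop _ _
  set t := (v ++ w').take M with ht
  set v₀ := (v ++ w').drop M with hv₀
  have htv : t ++ v₀ = v ++ w' := List.take_append_drop _ _
  have hslen : s.length = M := by
    rw [hs, List.length_drop, List.length_append]; omega
  have htlen : t.length = M := by
    rw [ht, List.length_take, List.length_append]; omega
  have hsL : s ∈ L := h.right_mem (hsu ▸ hwu)
  have htL : t ∈ L := h.left_mem (htv ▸ hvw)
  have hst := hg (s, t) hsL htL
  refine ⟨g (s, t), hL₀ ⟨(s, t), ⟨hslen, htlen⟩, rfl⟩, ?_⟩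
  have h2 : u₀ ++ s ++ (g (s, t) ++ t) ∈ L :=
    h.glue (hsu ▸ hwu) (by simpa using hst) hslen.ge
  have h3 : (u₀ ++ s ++ g (s, t)) ++ t ++ v₀ ∈ L :=
    h.glue (by simpa using h2) (htv ▸ hvw) htlen.ge
  refine h.infix_mem h3 ⟨w, w', ?_⟩
  rw [hsu, List.append_assoc (w ++ u ++ _), htv]
  simp

theorem exists_two_successors (h : IsLang L M) :
    ∃ (v : List A) (a b : A), v.length = M ∧ a ≠ b ∧ v ++ [a] ∈ L ∧ v ++ [b] ∈ L := by
  by_contra! hcon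
  have hinj : ∀ k : ℕ, ∀ l l' : List A, l ∈ L → l' ∈ L → l.length = M + k → l'.length = M + k →
      l.take M = l'.take M → l = l' := by
    intro k
    induction k with
    | zero =>
      intro l l' _ _ h1 h2 h3
      rwa [List.take_of_length_le (by omega), List.take_of_length_le (by omega)] at h3
    | succ k ih =>
      intro l l' hl hl' h1 h2 h3
      obtain ⟨l₁, a, rfl⟩ := List.eq_nil_or_concat l |>.resolve_left
        (by rintro rfl; simp at h1)
      obtain ⟨l₂, b, rfl⟩ := List.eq_nil_or_concat l' |>.resolve_left
        (by rintro rfl; simp at h2)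
      simp only [List.concat_eq_append] at *
      simp only [List.length_append, List.length_singleton] at h1 h2
      rw [List.take_append_of_le_length (by omega), List.take_append_of_le_length (by omega)] at h3
      obtain rfl := ih l₁ l₂ (h.left_mem hl) (h.left_mem hl') (by omega) (by omega) h3
      have key : ∀ c, l₁ ++ [c] ∈ L → l₁.drop (l₁.length - M) ++ [c] ∈ L := by
        intro c hc
        refine h.infix_mem hc ⟨l₁.take (l₁.length - M), [], ?_⟩
        rw [← List.append_assoc, List.take_append_drop, List.append_nil]
      by_cases hab : a = b
      · rw [hab]
      · exact absurd (key b hl') (hcon _ a b (by rw [List.length_drop]; omega) hab (key a hl))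
  have hfin : ∀ n, {l : List A | l ∈ L ∧ l.length = n}.Finite := fun n =>
    (List.finite_length_eq A n).subset fun l hl => hl.2
  obtain ⟨n, hn⟩ := h.unbounded {l : List A | l ∈ L ∧ l.length = M}.ncard
  choose! f hf1 hf2 using fun (u : List A) (hu : u ∈ L) => h.exists_append hu M
  have h1 : {l : List A | l ∈ L ∧ l.length = n}.ncard ≤ {l : List A | l ∈ L ∧ l.length = M}.ncard := by
    refine Set.ncard_le_ncard_of_injOn (fun l => (l ++ f l).take M) ?_ ?_ (hfin M)
    · rintro l ⟨hl, hln⟩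
      refine ⟨h.infix_mem (hf2 l hl) (List.take_prefix _ _).isInfix, ?_⟩
      rw [List.length_take, List.length_append, hf1 l hl]; omega
    · rintro l ⟨hl, hln⟩ l' ⟨hl', hln'⟩ heq
      have := hinj n _ _ (hf2 l hl) (hf2 l' hl') (by rw [List.length_append, hf1 l hl]; omega)
        (by rw [List.length_append, hf1 l' hl']; omega) heq
      exact List.append_inj_left this (by omega)
  omega

theorem exists_two_extensions (h : IsLang L M) :
    ∃ D : ℕ, 0 < D ∧ ∀ u ∈ L, ∃ c c' : List A, c ≠ c' ∧ c.length = D ∧ c'.length = D ∧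
      u ++ c ∈ L ∧ u ++ c' ∈ L := by
  obtain ⟨L₀, hL₀⟩ := h.exists_bounded_glue
  obtain ⟨v, a, b, hv, hab, ha, hb⟩ := h.exists_two_successors
  refine ⟨L₀ + M + 1, by omega, fun u hu => ?_⟩
  obtain ⟨g, hg, hgL⟩ := hL₀ u hu v (h.left_mem ha)
  have key : ∀ x : A, v ++ [x] ∈ L → ∃ w : List A, (g ++ v ++ [x] ++ w).length = L₀ + M + 1 ∧
      u ++ (g ++ v ++ [x] ++ w) ∈ L := by
    intro x hx
    obtain ⟨w, hw, hwL⟩ := h.exists_append (h.glue hgL hx hv.ge) (L₀ - g.length)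
    exact ⟨w, by simp [hw, hv]; omega, by simpa using hwL⟩
  obtain ⟨w, hw, hwL⟩ := key a ha
  obtain ⟨w', hw', hwL'⟩ := key b hb
  refine ⟨_, _, ?_, hw, hw', hwL, hwL'⟩
  intro heq
  simp only [List.append_assoc, List.append_cancel_left_eq, List.singleton_append,
    List.cons.injEq] at heq
  exact hab heq.1

theorem exists_three_extensions (h : IsLang L M) :
    ∃ D : ℕ, 0 < D ∧ ∀ u ∈ L, ∃ c : Fin 3 → List A, Function.Injective c ∧
      ∀ i, (c i).length = D ∧ u ++ c i ∈ L := by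
  obtain ⟨D, hD, hext⟩ := h.exists_two_extensions
  refine ⟨D + D, by omega, fun u hu => ?_⟩
  obtain ⟨c, c', hne, hc, hc', hcL, hcL'⟩ := hext u hu
  obtain ⟨d, d', hne2, hd, hd', hdL, hdL'⟩ := hext _ hcL
  obtain ⟨e, -, -, he, -, heL, -⟩ := hext _ hcL'
  have h1 : c ++ d ≠ c ++ d' := fun h => hne2 (List.append_cancel_left h)
  have h2 : c ++ d ≠ c' ++ e := fun h => hne (List.append_inj_left h (by omega))
  have h3 : c ++ d' ≠ c' ++ e := fun h => hne (List.append_inj_left h (by omega))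
  refine ⟨![c ++ d, c ++ d', c' ++ e], ?_, ?_⟩
  · intro i j hij
    fin_cases i <;> fin_cases j <;> simp_all
  · intro i
    fin_cases i
    · exact ⟨by simp [hc, hd], by simpa using hdL⟩
    · exact ⟨by simp [hc, hd'], by simpa using hdL'⟩
    · exact ⟨by simp [hc', he], by simpa using heL⟩

/-- Extensions at multiples of a branching length. -/
theorem three_extensions_mul {A : Type*} {L : Set (List A)} {D : ℕ}
    (h : ∀ u ∈ L, ∃ c : Fin 3 → List A, Function.Injective c ∧
      ∀ i, (c i).length = D ∧ u ++ c i ∈ L) (k : ℕ) (hk : 0 < k) :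
    ∀ u ∈ L, ∃ c : Fin 3 → List A, Function.Injective c ∧
      ∀ i, (c i).length = k * D ∧ u ++ c i ∈ L := by
  induction k, hk using Nat.le_induction with
  | base => simpa using h
  | succ k hk ih =>
    intro u hu
    obtain ⟨c, hc, hc'⟩ := ih u hu
    choose d _ hd' using fun i => h _ (hc' i).2
    refine ⟨fun i => c i ++ d i 0, fun i j hij => hc (List.append_inj_left hij ?_), fun i => ?_⟩
    · rw [(hc' i).1, (hc' j).1]
    · refine ⟨?_, by simpa using (hd' i 0).2⟩
      rw [List.length_append, (hc' i).1, (hd' i 0).1]; ring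

end IsLang

end Languages

section TreePercolation

/-- The last `n` letters of a word. -/
def lastWord {A : Type*} (n : ℕ) (l : List A) : List A := l.drop (l.length - n)

theorem DependsOnCoords.mono {E : Type*} {S T : Set E} {Ev : Set (E → Bool)}
    (h : DependsOnCoords S Ev) (hST : S ⊆ T) : DependsOnCoords T Ev :=
  fun ω ω' hω => h ω ω' fun e he => hω e (hST he)

theorem DependsOnCoords.compl {E : Type*} {S : Set E} {Ev : Set (E → Bool)}
    (h : DependsOnCoords S Ev) : DependsOnCoords S Evᶜ :=
  fun _ _ hω hn hcon => hn (h _ _ (fun e he => (hω e he).symm) hcon)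

theorem DependsOnCoords.inter {E : Type*} {S : Set E} {Ev Ev' : Set (E → Bool)}
    (h : DependsOnCoords S Ev) (h' : DependsOnCoords S Ev') : DependsOnCoords S (Ev ∩ Ev') :=
  fun _ _ hω hn => ⟨h _ _ hω hn.1, h' _ _ hω hn.2⟩

variable {A E : Type*}

/-- All windows completed while appending `c` to `s` letter by letter are open. -/
def OpenAlong (n : ℕ) (e : List A → E) (ω : E → Bool) (s c : List A) : Prop :=
  ∀ c', c' <+: c → c' ≠ [] → ω (e (lastWord n (s ++ c'))) = true

/-- From `s` one can follow `k` generations of open binary branching, each generation consisting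
of open blocks of length `D`. -/
def Branches (L : Set (List A)) (n : ℕ) (e : List A → E) (D : ℕ) (ω : E → Bool) :
    ℕ → List A → Prop
  | 0, _ => True
  | k + 1, s => ∃ c c' : List A, c ≠ c' ∧ c.length = D ∧ c'.length = D ∧ s ++ c ∈ L ∧ s ++ c' ∈ L ∧
      OpenAlong n e ω s c ∧ OpenAlong n e ω s c' ∧
      Branches L n e D ω k (s ++ c) ∧ Branches L n e D ω k (s ++ c')

/-- Somewhere along the word `z` appended to `s`, within the first `j` blocks, there is an open
block leading to `k` generations of branching. -/
def Escapes (L : Set (List A)) (n : ℕ) (e : List A → E) (D : ℕ) (ω : E → Bool)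
    (k j : ℕ) (s z : List A) : Prop :=
  ∃ i < j, ∃ c : List A, c.length = D ∧ s ++ z.take (i * D) ++ c ∈ L ∧
    OpenAlong n e ω (s ++ z.take (i * D)) c ∧ Branches L n e D ω k (s ++ z.take (i * D) ++ c)

/-- Strict extensions of `s` by at most `m` letters. -/
def strictExt (s : List A) (m : ℕ) : Set (List A) := {l | ∃ c, c ≠ [] ∧ c.length ≤ m ∧ l = s ++ c}

/-- Coordinates attached to a set of tree nodes. -/
def nodeCoords (n : ℕ) (e : List A → E) (N : Set (List A)) : Set E :=
  (fun l => e (lastWord n l)) '' N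

theorem nodeCoords_mono {n : ℕ} {e : List A → E} {N N' : Set (List A)} (h : N ⊆ N') :
    nodeCoords n e N ⊆ nodeCoords n e N' := Set.image_mono h

variable {L : Set (List A)} {n D : ℕ} {e : List A → E} {ω : E → Bool}

theorem OpenAlong.append {s c d : List A} (h : OpenAlong n e ω s c)
    (h' : OpenAlong n e ω (s ++ c) d) : OpenAlong n e ω s (c ++ d) := by
  intro c' hc' hne
  have hcases : c' <+: c ∨ ∃ t, c' = c ++ t ∧ t <+: d := by
    rcases List.prefix_or_prefix_of_prefix hc' (List.prefix_append c d) with h | ⟨t, rfl⟩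
    · exact Or.inl h
    · exact Or.inr ⟨t, rfl, (List.prefix_append_right_inj c).1 hc'⟩
  rcases hcases with hc' | ⟨t, rfl, ht⟩
  · exact h c' hc' hne
  · by_cases htn : t = []
    · subst htn
      rw [List.append_nil] at *
      exact h c List.prefix_rfl hne
    · rw [← List.append_assoc]
      exact h' t ht htn

theorem OpenAlong.mono {ω' : E → Bool} {s c : List A} (h : OpenAlong n e ω s c)
    (hω : ∀ f, ω f = true → ω' f = true) : OpenAlong n e ω' s c :=
  fun c' h1 h2 => hω _ (h c' h1 h2)

theorem strictExt_subset {s c : List A} {m m' : ℕ} (h : c.length + m ≤ m') :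
    strictExt (s ++ c) m ⊆ strictExt s m' := by
  rintro _ ⟨d, hd, hdm, rfl⟩
  exact ⟨c ++ d, by simp [hd], by rw [List.length_append]; omega, by simp⟩

theorem dependsOn_openAlong (s c : List A) : DependsOnCoords
    (nodeCoords n e {l | ∃ c', c' <+: c ∧ c' ≠ [] ∧ l = s ++ c'}) {ω | OpenAlong n e ω s c} := by
  intro ω ω' h h' c' hc' hne
  rw [← h _ ⟨s ++ c', ⟨c', hc', hne, rfl⟩, rfl⟩]
  exact h' c' hc' hne

theorem prefixes_subset_strictExt {s c : List A} {m : ℕ} (h : c.length ≤ m) :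
    {l | ∃ c', c' <+: c ∧ c' ≠ [] ∧ l = s ++ c'} ⊆ strictExt s m := by
  rintro _ ⟨c', hc', hne, rfl⟩
  exact ⟨c', hne, hc'.length_le.trans h, rfl⟩

theorem dependsOn_branches (k : ℕ) (s : List A) : DependsOnCoords
    (nodeCoords n e (strictExt s (k * D))) {ω | Branches L n e D ω k s} := by
  induction k generalizing s with
  | zero => exact fun _ _ _ _ => trivial
  | succ k ih =>
    rintro ω ω' h ⟨c, c', hne, hc, hc', hcL, hcL', ho, ho', hb, hb'⟩
    have h1 : ∀ c : List A, c.length = D → OpenAlong n e ω s c → OpenAlong n e ω' s c :=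
      fun c hc => (dependsOn_openAlong s c).mono (nodeCoords_mono
        (prefixes_subset_strictExt (m := (k + 1) * D) (by rw [hc, add_mul]; omega))) ω ω' h
    have h2 : ∀ c : List A, c.length = D → Branches L n e D ω k (s ++ c) →
        Branches L n e D ω' k (s ++ c) :=
      fun c hc => (ih (s ++ c)).mono (nodeCoords_mono
        (strictExt_subset (by rw [hc, add_mul]; omega))) ω ω' h
    exact ⟨c, c', hne, hc, hc', hcL, hcL', h1 c hc ho, h1 c' hc' ho', h2 c hc hb, h2 c' hc' hb'⟩

theorem dependsOn_escapes (k j : ℕ) (s z : List A) : DependsOnCoords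
    (nodeCoords n e (strictExt s (j * D + k * D))) {ω | Escapes L n e D ω k j s z} := by
  rintro ω ω' h ⟨i, hi, c, hc, hcL, ho, hb⟩
  have hiD : i * D + D ≤ j * D := by nlinarith
  have hlen : (z.take (i * D)).length ≤ i * D := by rw [List.length_take]; omega
  refine ⟨i, hi, c, hc, hcL, ?_, ?_⟩
  · refine (dependsOn_openAlong _ c).mono (nodeCoords_mono ?_) ω ω' h ho
    refine (prefixes_subset_strictExt (m := D) hc.le).trans (strictExt_subset ?_)
    omega
  · refine (dependsOn_branches k _).mono (nodeCoords_mono ?_) ω ω' h hb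
    rw [List.append_assoc]
    refine strictExt_subset ?_
    rw [List.length_append]
    omega

/-- Branching for `k` generations yields `2 ^ k` open extensions of length `k * D`. -/
theorem Branches.exists_finset {k : ℕ} {s : List A} (hs : s ∈ L)
    (h : Branches L n e D ω k s) :
    ∃ F : Finset (List A), F.card = 2 ^ k ∧
      ∀ c ∈ F, c.length = k * D ∧ s ++ c ∈ L ∧ OpenAlong n e ω s c := by
  induction k generalizing s with
  | zero =>
    refine ⟨{[]}, by simp, fun c hc => ?_⟩
    rw [Finset.mem_singleton] at hc
    subst hc
    exact ⟨by simp, by simpa using hs, fun c' hc' hne => absurd (List.prefix_nil.1 hc') hne⟩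
  | succ k ih =>
    obtain ⟨c, c', hne, hc, hc', hcL, hcL', ho, ho', hb, hb'⟩ := h
    obtain ⟨F, hF, hF'⟩ := ih hcL hb
    obtain ⟨G, hG, hG'⟩ := ih hcL' hb'
    refine ⟨F.image (c ++ ·) ∪ G.image (c' ++ ·), ?_, ?_⟩
    · rw [Finset.card_union_of_disjoint, Finset.card_image_of_injective _
        (List.append_right_injective c), Finset.card_image_of_injective _
        (List.append_right_injective c'), hF, hG]
      · ring
      · rw [Finset.disjoint_left]
        intro l hl hl'
        obtain ⟨d, -, rfl⟩ := Finset.mem_image.1 hl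
        obtain ⟨d', -, h'⟩ := Finset.mem_image.1 hl'
        exact hne (List.append_inj_left h'.symm (by omega))
    · intro l hl
      rw [Finset.mem_union, Finset.mem_image, Finset.mem_image] at hl
      rcases hl with ⟨d, hd, rfl⟩ | ⟨d, hd, rfl⟩
      · obtain ⟨h1, h2, h3⟩ := hF' d hd
        exact ⟨by rw [List.length_append, h1, hc]; ring, by simpa using h2, ho.append h3⟩
      · obtain ⟨h1, h2, h3⟩ := hG' d hd
        exact ⟨by rw [List.length_append, h1, hc']; ring, by simpa using h2, ho'.append h3⟩

variable [Fintype E] [DecidableEq E] {α : ℝ}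

theorem bprob_not_openAlong_le (h0 : 0 ≤ α) (h1 : α ≤ 1) (s c : List A) :
    bprob α {ω | ¬ OpenAlong n e ω s c} ≤ c.length * (1 - α) := by
  have hsub : {ω | ¬ OpenAlong n e ω s c} ⊆
      {ω | ∃ i : Fin c.length, ω ∈ {ω | ω (e (lastWord n (s ++ c.take (i + 1)))) = false}} := by
    intro ω hω
    simp only [OpenAlong, Set.mem_ofPred_eq, not_forall] at hω
    obtain ⟨c', hc', hne, h⟩ := hω
    have hpos := List.length_pos_iff.2 hne
    have hle := hc'.length_le
    refine ⟨⟨c'.length - 1, by omega⟩, ?_⟩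
    have : c.take (c'.length - 1 + 1) = c' := by
      rw [Nat.sub_add_cancel hpos]
      exact (List.prefix_iff_eq_take.1 hc').symm
    simpa [this] using h
  refine (bprob_mono h0 h1 hsub).trans ((bprob_exists_le h0 h1 _ fun i =>
    (bprob_false α _).le).trans_eq ?_)
  simp

theorem disjoint_nodeCoords {A E : Type*} {n : ℕ} {e : List A → E} {x : List A} {T : ℕ}
    (hinj : ∀ a a' : List A, a.length ≤ T → a'.length ≤ T →
      e (lastWord n (x ++ a)) = e (lastWord n (x ++ a')) → a = a')
    {N N' : Set (List A)} (hN : N ⊆ strictExt x T) (hN' : N' ⊆ strictExt x T)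
    (hd : Disjoint N N') : Disjoint (nodeCoords n e N) (nodeCoords n e N') := by
  rw [Set.disjoint_left] at hd ⊢
  rintro _ ⟨l, hl, rfl⟩ ⟨l', hl', h⟩
  obtain ⟨a, -, ha, rfl⟩ := hN hl
  obtain ⟨a', -, ha', rfl⟩ := hN' hl'
  obtain rfl := hinj _ _ ha' ha h
  exact hd hl hl'

theorem disjoint_strictExt {s c c' : List A} (hlen : c.length = c'.length) (hne : c ≠ c')
    (m m' : ℕ) : Disjoint (strictExt (s ++ c) m) (strictExt (s ++ c') m') := by
  rw [Set.disjoint_left]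
  rintro _ ⟨d, -, -, rfl⟩ ⟨d', -, -, h⟩
  rw [List.append_assoc, List.append_assoc] at h
  exact hne (List.append_inj_left (List.append_cancel_left h) hlen)

theorem bprob_not_branches_le (h0 : 0 ≤ α) (h1 : α ≤ 1) (hδ : 6 * D * (1 - α) ≤ 1 / 6)
    (hbr : ∀ u ∈ L, ∃ c : Fin 3 → List A, Function.Injective c ∧
      ∀ i, (c i).length = D ∧ u ++ c i ∈ L) {x : List A} {T : ℕ}
    (hinj : ∀ a a' : List A, a.length ≤ T → a'.length ≤ T →
      e (lastWord n (x ++ a)) = e (lastWord n (x ++ a')) → a = a') (k : ℕ) (a : List A)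
    (ha : x ++ a ∈ L) (hT : a.length + k * D ≤ T) :
    bprob α {ω | ¬ Branches L n e D ω k (x ++ a)} ≤ 6 * D * (1 - α) := by
  induction k generalizing a with
  | zero =>
    simp only [Branches, not_true_eq_false]
    have : (0 : ℝ) ≤ 6 * D * (1 - α) := by
      have := sub_nonneg.2 h1
      positivity
    simpa [bprob_empty] using this
  | succ k ih =>
    obtain ⟨c, hc, hc'⟩ := hbr _ ha
    set δ := 6 * D * (1 - α) with hδdef
    have hTk : a.length + D + k * D ≤ T := by linarith [add_mul k 1 D]
    have hsub : {ω | ¬ Branches L n e D ω (k + 1) (x ++ a)} ⊆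
        {ω | ∃ i : Fin 3, ω ∈ {ω | ¬ OpenAlong n e ω (x ++ a) (c i)}} ∪
        {ω | ∃ i : Fin 3, ω ∈ {ω | Branches L n e D ω k (x ++ a ++ c i)}ᶜ ∩
          {ω | Branches L n e D ω k (x ++ a ++ c (i + 1))}ᶜ} := by
      intro ω hω
      by_contra hcon
      simp only [Set.mem_union, Set.mem_ofPred_eq, not_or, not_exists, not_not,
        Set.mem_inter_iff, Set.mem_compl_iff, not_and] at hcon
      obtain ⟨ho, hb⟩ := hcon
      apply hω
      have hpair : ∃ i j : Fin 3, i ≠ j ∧ Branches L n e D ω k (x ++ a ++ c i) ∧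
          Branches L n e D ω k (x ++ a ++ c j) := by
        by_cases hb0 : Branches L n e D ω k (x ++ a ++ c 0)
        · by_cases hb1 : Branches L n e D ω k (x ++ a ++ c 1)
          · exact ⟨0, 1, by decide, hb0, hb1⟩
          · exact ⟨0, 2, by decide, hb0, hb 1 hb1⟩
        · refine ⟨1, 2, by decide, hb 0 hb0, ?_⟩
          by_contra hb2
          exact hb0 (hb 2 hb2)
      obtain ⟨i, j, hij, hbi, hbj⟩ := hpair
      exact ⟨c i, c j, fun h => hij (hc h), (hc' i).1, (hc' j).1, (hc' i).2, (hc' j).2,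
        ho i, ho j, hbi, hbj⟩
    have hopen : ∀ i, bprob α {ω | ¬ OpenAlong n e ω (x ++ a) (c i)} ≤ D * (1 - α) := by
      intro i
      have := bprob_not_openAlong_le (n := n) (e := e) h0 h1 (x ++ a) (c i)
      rwa [(hc' i).1] at this
    have hchild : ∀ i, bprob α {ω | Branches L n e D ω k (x ++ a ++ c i)}ᶜ ≤ δ := by
      intro i
      have := ih (a ++ c i) (by simpa using (hc' i).2)
        (by rw [List.length_append, (hc' i).1]; omega)
      rwa [← List.append_assoc] at this
    have hpair : ∀ i : Fin 3, bprob α ({ω | Branches L n e D ω k (x ++ a ++ c i)}ᶜ ∩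
          {ω | Branches L n e D ω k (x ++ a ++ c (i + 1))}ᶜ) ≤ δ * δ := by
      intro i
      have hsubT : ∀ i, strictExt (x ++ a ++ c i) (k * D) ⊆ strictExt x T := by
        intro i
        rw [List.append_assoc]
        exact strictExt_subset (by rw [List.length_append, (hc' i).1]; omega)
      rw [bprob_inter_of_disjoint α (dependsOn_branches k _).compl (dependsOn_branches k _).compl
        (disjoint_nodeCoords hinj (hsubT i) (hsubT (i + 1))
          (disjoint_strictExt (by rw [(hc' i).1, (hc' (i + 1)).1])
            (fun h => by have := hc h; fin_cases i <;> simp at this) _ _))]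
      exact mul_le_mul (hchild i) (hchild (i + 1)) (bprob_nonneg h0 h1 _)
        ((bprob_nonneg h0 h1 _).trans (hchild i))
    have hδ0 : 0 ≤ δ := (bprob_nonneg h0 h1 _).trans (hchild 0)
    calc bprob α {ω | ¬ Branches L n e D ω (k + 1) (x ++ a)}
        ≤ _ := bprob_mono h0 h1 hsub
      _ ≤ _ := bprob_union_le h0 h1 _ _
      _ ≤ Fintype.card (Fin 3) * (D * (1 - α)) + Fintype.card (Fin 3) * (δ * δ) :=
          add_le_add (bprob_exists_le h0 h1 _ hopen) (bprob_exists_le h0 h1 _ hpair)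
      _ ≤ δ := by
          simp only [Fintype.card_fin]
          push_cast
          nlinarith

theorem bprob_not_escapes_le (h0 : 0 ≤ α) (h1 : α ≤ 1) (hδ : 6 * D * (1 - α) ≤ 1 / 6)
    (hD : 0 < D)
    (hbr : ∀ u ∈ L, ∃ c : Fin 3 → List A, Function.Injective c ∧
      ∀ i, (c i).length = D ∧ u ++ c i ∈ L) {M : ℕ} (hL : IsLang L M) {x : List A} {T : ℕ}
    (hinj : ∀ a a' : List A, a.length ≤ T → a'.length ≤ T →
      e (lastWord n (x ++ a)) = e (lastWord n (x ++ a')) → a = a') (k j : ℕ) (a z : List A)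
    (hz : z.length = j * D) (ha : x ++ a ++ z ∈ L) (hT : a.length + j * D + k * D ≤ T) :
    bprob α {ω | ¬ Escapes L n e D ω k j (x ++ a) z} ≤ (12 * D * (1 - α)) ^ j := by
  induction j generalizing a z with
  | zero => simpa using bprob_le_one h0 h1 _
  | succ j ih =>
    have hTk : a.length + D + j * D + k * D ≤ T := by linarith [add_mul j 1 D]
    set z₁ := z.take D with hz₁
    set z' := z.drop D with hz'
    have hzz : z₁ ++ z' = z := List.take_append_drop _ _
    have hz₁len : z₁.length = D := by
      rw [hz₁, List.length_take, hz, add_mul]; omega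
    have hz'len : z'.length = j * D := by
      rw [hz', List.length_drop, hz, add_mul]; omega
    have hz₁L : x ++ a ++ z₁ ++ z' ∈ L := by simpa [hzz] using ha
    obtain ⟨c, hc, hcL, hcz⟩ : ∃ c : List A, c.length = D ∧ x ++ a ++ c ∈ L ∧ c ≠ z₁ := by
      obtain ⟨c, hc, hc'⟩ := hbr _ (hL.left_mem ha)
      by_cases h : c 0 = z₁
      · exact ⟨c 1, (hc' 1).1, (hc' 1).2, fun h' => absurd (hc (h.trans h'.symm)) (by decide)⟩
      · exact ⟨c 0, (hc' 0).1, (hc' 0).2, h⟩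
    have hsub : {ω | ¬ Escapes L n e D ω k (j + 1) (x ++ a) z} ⊆
        ({ω | OpenAlong n e ω (x ++ a) c} ∩ {ω | Branches L n e D ω k (x ++ a ++ c)})ᶜ ∩
        {ω | Escapes L n e D ω k j (x ++ a ++ z₁) z'}ᶜ := by
      intro ω hω
      refine ⟨fun hcon => hω ?_, fun hcon => hω ?_⟩
      · exact ⟨0, Nat.succ_pos j, c, hc, by simpa using hcL, by simpa using hcon.1,
          by simpa using hcon.2⟩
      · obtain ⟨i, hi, d, hd, hdL, ho, hb⟩ := hcon
        have htake : z.take ((i + 1) * D) = z₁ ++ z'.take (i * D) := by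
          rw [← hzz, List.take_append, hz₁len, List.take_of_length_le (by rw [hz₁len]; nlinarith)]
          congr 2
          rw [add_mul]; omega
        refine ⟨i + 1, by omega, d, hd, ?_, ?_, ?_⟩ <;> rw [htake]
        · simpa using hdL
        · simpa using ho
        · simpa using hb
    refine (bprob_mono h0 h1 hsub).trans ?_
    have hN₁ : strictExt (x ++ a ++ c) (k * D) ⊆ strictExt x T := by
      rw [List.append_assoc]
      exact strictExt_subset (by rw [List.length_append]; omega)
    have hN₂ : {l | ∃ c', c' <+: c ∧ c' ≠ [] ∧ l = x ++ a ++ c'} ⊆ strictExt x T :=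
      (prefixes_subset_strictExt hc.le).trans (strictExt_subset (by omega))
    have hN₃ : strictExt (x ++ a ++ z₁) (j * D + k * D) ⊆ strictExt x T := by
      rw [List.append_assoc]
      exact strictExt_subset (by rw [List.length_append]; omega)
    rw [bprob_inter_of_disjoint α (DependsOnCoords.compl (DependsOnCoords.inter
      ((dependsOn_openAlong (x ++ a) c).mono (nodeCoords_mono Set.subset_union_left))
      ((dependsOn_branches k (x ++ a ++ c)).mono (nodeCoords_mono Set.subset_union_right))))
      (dependsOn_escapes k j _ z').compl (disjoint_nodeCoords hinj (Set.union_subset hN₂ hN₁)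
        hN₃ ?_)]
    · rw [pow_succ, mul_comm]
      have hfirst : bprob α ({ω | OpenAlong n e ω (x ++ a) c} ∩
          {ω | Branches L n e D ω k (x ++ a ++ c)})ᶜ ≤ 12 * D * (1 - α) := by
        rw [Set.compl_inter]
        refine (bprob_union_le h0 h1 _ _).trans ?_
        have h2 := bprob_not_openAlong_le (n := n) (e := e) h0 h1 (x ++ a) c
        have h3 := bprob_not_branches_le h0 h1 hδ hbr hinj k (a ++ c) (by simpa using hcL)
          (by rw [List.length_append]; omega)
        rw [hc] at h2
        rw [← List.append_assoc] at h3
        have h4 : (0 : ℝ) ≤ D * (1 - α) := mul_nonneg (Nat.cast_nonneg _) (sub_nonneg.2 h1)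
        calc _ ≤ D * (1 - α) + 6 * D * (1 - α) := add_le_add h2 h3
          _ ≤ _ := by nlinarith
      have hrest : bprob α {ω | Escapes L n e D ω k j (x ++ a ++ z₁) z'}ᶜ ≤
          (12 * D * (1 - α)) ^ j := by
        have := ih (a ++ z₁) z' hz'len (by simpa using hz₁L)
          (by rw [List.length_append]; omega)
        rwa [← List.append_assoc] at this
      have h5 : (0 : ℝ) ≤ 12 * D * (1 - α) :=
        mul_nonneg (by positivity) (sub_nonneg.2 h1)
      exact mul_le_mul hrest hfirst (bprob_nonneg h0 h1 _) (pow_nonneg h5 _) |>.trans_eq' (by ring)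
    · rw [Set.disjoint_union_left]
      refine ⟨?_, disjoint_strictExt (by omega) hcz _ _⟩
      rw [Set.disjoint_left]
      rintro _ ⟨c', hc', -, rfl⟩ ⟨d, hd, -, h⟩
      rw [List.append_assoc (x ++ a)] at h
      have h2 := congrArg List.length (List.append_cancel_left h)
      have h3 := hc'.length_le
      have h4 := List.length_pos_iff.2 hd
      rw [List.length_append] at h2
      omega

end TreePercolation

section Connecting

variable {A E : Type*}

/-- The word `x` of length `n` has no period `q ≤ T` beyond position `T`. -/
def AperiodicFrom (T n : ℕ) (x : List A) : Prop :=
  ∀ q, 1 ≤ q → q ≤ T → ∃ t, T ≤ t ∧ t + q < n ∧ x[t]? ≠ x[t + q]?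

/-- `e` separates words of length `n`. -/
def SeparatesWords (n : ℕ) (e : List A → E) : Prop :=
  ∀ w w' : List A, w.length = n → w'.length = n → e w = e w' → w = w'

theorem SeparatesWords.comp_reverse {n : ℕ} {e : List A → E} (he : SeparatesWords n e) :
    SeparatesWords n (fun l => e l.reverse) :=
  fun w w' hw hw' h => List.reverse_injective
    (he _ _ (by simpa using hw) (by simpa using hw') h)

theorem length_lastWord {n : ℕ} {l : List A} (h : n ≤ l.length) :
    (lastWord n l).length = n := by
  rw [lastWord, List.length_drop]; omega

theorem AperiodicFrom.eq_of_lastWord_eq {T n : ℕ} {x : List A} (hx : AperiodicFrom T n x)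
    (hlen : x.length = n) {a a' : List A} (ha : a.length ≤ T)
    (ha' : a'.length ≤ T) (hTn : T ≤ n) (h : lastWord n (x ++ a) = lastWord n (x ++ a')) :
    a = a' := by
  have key : ∀ a : List A, lastWord n (x ++ a) = (x ++ a).drop a.length := by
    intro a
    rw [lastWord, List.length_append, hlen]
    congr 1; omega
  have main : ∀ a a' : List A, a.length ≤ T → a'.length ≤ T →
      lastWord n (x ++ a) = lastWord n (x ++ a') → ¬ a.length < a'.length := by
    intro a a' ha ha' h hlt
    obtain ⟨t, hTt, htn, hne⟩ := hx (a'.length - a.length) (by omega) (by omega)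
    apply hne
    have h2 := congrArg (fun l => l[t - a.length]?) h
    simp only [key, List.getElem?_drop] at h2
    rw [show a.length + (t - a.length) = t by omega,
      show a'.length + (t - a.length) = t + (a'.length - a.length) by omega,
      List.getElem?_append_left (by omega), List.getElem?_append_left (by omega)] at h2
    exact h2
  have hl : a.length = a'.length :=
    le_antisymm (not_lt.1 (main a' a ha' ha h.symm)) (not_lt.1 (main a a' ha ha' h))
  rw [key, key, List.drop_append_of_le_length (by omega),
    List.drop_append_of_le_length (by omega)] at h
  exact List.append_inj_right h (by simp [hl])

theorem card_filter_infix_le {ι : Type*} (J : Finset ι) {c : ι → List A} {m : ℕ}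
    (hc : Set.InjOn c J) (hm : ∀ j ∈ J, (c j).length = m) (w : List A) :
    (J.filter fun j => c j <:+: w).card ≤ w.length + 1 := by
  calc _ ≤ ((Finset.range (w.length + 1)).image fun t => (w.drop t).take m).card := by
        refine Finset.card_le_card_of_injOn c ?_ (hc.mono (Finset.filter_subset _ _))
        intro j hj
        obtain ⟨hjJ, p, q, rfl⟩ := Finset.mem_filter.1 hj
        refine Finset.mem_coe.2 (Finset.mem_image.2 ⟨p.length, ?_, ?_⟩)
        · rw [Finset.mem_range, List.length_append, List.length_append]; omega
        · rw [List.append_assoc, List.drop_left, List.take_left' (hm j hjJ)]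
    _ ≤ _ := Finset.card_image_le.trans (by simp)

variable [Fintype E] [DecidableEq E] {α : ℝ}

theorem bprob_forall_exists_window_false_le (h0 : 0 ≤ α) (h1 : α ≤ 1) {ι : Type*} (J : Finset ι)
    {n m s : ℕ} (hs0 : 0 < s) {e : List A → E} (he : SeparatesWords n e) (S : ι → Finset E)
    (hS : ∀ j ∈ J, (S j).card ≤ s) {c r : ι → List A} (hc : Set.InjOn c J) (hr : Set.InjOn r J)
    (hcm : ∀ j ∈ J, (c j).length = m) (hrm : ∀ j ∈ J, (r j).length = m)
    (hcr : ∀ j ∈ J, ∀ f ∈ S j, ∃ w : List A, w.length = n ∧ e w = f ∧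
      (c j <:+: w ∨ r j <:+: w)) :
    bprob α {ω | ∀ j ∈ J, ∃ f ∈ S j, ω f = false} ≤
      Real.exp (-(α ^ s * (J.card / (s * (2 * (n + 1) : ℕ))))) := by
  refine bprob_forall_exists_false_le_exp h0 h1 J S hs0 (by positivity) hS fun f => ?_
  by_cases hf : ∃ w : List A, w.length = n ∧ e w = f
  · obtain ⟨w, hw, rfl⟩ := hf
    have hsub : (J.filter fun j => e w ∈ S j) ⊆
        (J.filter fun j => c j <:+: w) ∪ (J.filter fun j => r j <:+: w) := by
      intro j hj
      obtain ⟨hjJ, hjS⟩ := Finset.mem_filter.1 hj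
      obtain ⟨w', hw', hww, h⟩ := hcr j hjJ _ hjS
      obtain rfl := he _ _ hw' hw hww
      rcases h with h | h
      · exact Finset.mem_union_left _ (Finset.mem_filter.2 ⟨hjJ, h⟩)
      · exact Finset.mem_union_right _ (Finset.mem_filter.2 ⟨hjJ, h⟩)
    have h2 := card_filter_infix_le J hc hcm w
    have h3 := card_filter_infix_le J hr hrm w
    have := (Finset.card_le_card hsub).trans (Finset.card_union_le _ _)
    omega
  · rw [Finset.card_eq_zero.2]
    · omega
    · refine Finset.filter_eq_empty_iff.2 fun j hj hjS => ?_
      obtain ⟨w, hw, hwf, -⟩ := hcr j hj _ hjS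
      exact hf ⟨w, hw, hwf⟩

/-- All words of length `n` occurring in `F ++ g ++ B` and lying neither inside `F` nor inside `B`
are open. -/
def MidOpen (n : ℕ) (e : List A → E) (ω : E → Bool) (F g B : List A) : Prop :=
  ∀ p w q : List A, F ++ g ++ B = p ++ w ++ q → w.length = n → F.length < p.length + n →
    p.length < F.length + g.length → ω (e w) = true

theorem bprob_not_midOpen_le (h0 : 0 ≤ α) (h1 : α ≤ 1) {L : Set (List A)} {n m k L₀ : ℕ}
    (hn : 0 < n)
    {e : List A → E} (he : SeparatesWords n e)
    (hglue : ∀ u ∈ L, ∀ v ∈ L, ∃ g : List A, g.length ≤ L₀ ∧ u ++ g ++ v ∈ L)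
    {s s' : List A} (hs : n ≤ s.length) (hs' : n ≤ s'.length) {P Q : Finset (List A)}
    (hP : P.card = 2 ^ k) (hQ : Q.card = 2 ^ k)
    (hPm : ∀ c ∈ P, c.length = m ∧ s ++ c ∈ L) (hQm : ∀ r ∈ Q, r.length = m ∧ r ++ s' ∈ L)
    (hmn : 2 * m + L₀ ≤ n) :
    bprob α {ω | ¬ ∃ c ∈ P, ∃ r ∈ Q, ∃ g : List A, (s ++ c) ++ g ++ (r ++ s') ∈ L ∧
      MidOpen n e ω (s ++ c) g (r ++ s')} ≤
      Real.exp (-(α ^ (2 * n) * (2 ^ k / ((2 * n : ℕ) * (2 * (n + 1) : ℕ))))) := by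
  obtain ⟨f⟩ : Nonempty (P ≃ Q) := ⟨Finset.equivOfCardEq (hP.trans hQ.symm)⟩
  set r : P → List A := fun c => (f c : List A)
  have hg : ∀ c : P, ∃ g : List A, g.length ≤ L₀ ∧ (s ++ c) ++ g ++ (r c ++ s') ∈ L :=
    fun c => hglue _ (hPm _ c.2).2 _ (hQm _ (f c).2).2
  choose g hg hgL using hg
  set V : P → List A := fun c => (s ++ c) ++ g c ++ (r c ++ s')
  have hlen1 : ∀ c : P, (s ++ (c : List A)).length = s.length + m := fun c => by
    rw [List.length_append, (hPm _ c.2).1]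
  have hrlen : ∀ c : P, (r c).length = m := fun c => (hQm _ (f c).2).1
  set S : P → Finset E := fun c => (Finset.range (2 * n)).image fun i =>
    e (((V c).drop (s.length + m + 1 - n + min i (n + (g c).length - 2))).take n)
  have hcard : (2 : ℝ) ^ k = (Finset.univ : Finset P).card := by
    rw [Finset.card_univ, Fintype.card_coe, hP]; norm_num
  rw [hcard]
  refine (bprob_mono h0 h1 ?_).trans (bprob_forall_exists_window_false_le h0 h1
    (J := (Finset.univ : Finset P)) (by omega) he S ?_ (c := fun c => (c : List A)) (r := r)
    (m := m) ?_ ?_ ?_ ?_ ?_)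
  · intro ω hω c _
    by_contra hcon
    push Not at hcon
    refine hω ⟨c, c.2, r c, (f c).2, g c, hgL c, ?_⟩
    intro p w q hpq hw h2 h3
    have hmem : e w ∈ S c := by
      rw [hlen1] at h2 h3
      refine Finset.mem_image.2 ⟨p.length - (s.length + m + 1 - n), ?_, ?_⟩
      · rw [Finset.mem_range]
        have := hg c
        omega
      · have : s.length + m + 1 - n + min (p.length - (s.length + m + 1 - n))
            (n + (g c).length - 2) = p.length := by
          have := hg c
          omega
        rw [this]
        simp only [V]
        rw [hpq, List.append_assoc, List.drop_left, List.take_left' hw]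
    simpa using hcon _ hmem
  · intro c _
    exact Finset.card_image_le.trans (by simp)
  · exact Subtype.val_injective.injOn
  · exact (Subtype.val_injective.comp f.injective).injOn
  · exact fun c _ => (hPm _ c.2).1
  · exact fun c _ => hrlen c
  · intro c _ x hx
    obtain ⟨i, -, rfl⟩ := Finset.mem_image.1 hx
    set t := s.length + m + 1 - n + min i (n + (g c).length - 2) with ht
    have hgc := hg c
    have hVlen : (V c).length = s.length + m + (g c).length + m + s'.length := by
      simp only [V, List.length_append, hrlen, (hPm _ c.2).1]; omega
    refine ⟨_, ?_, rfl, ?_⟩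
    · rw [List.length_take, List.length_drop]; omega
    · have sub : ∀ p u q : List A, V c = p ++ u ++ q → t ≤ p.length →
          p.length + u.length ≤ t + n → u <:+: ((V c).drop t).take n := by
        intro p u q hV h2 h3
        rw [hV, List.append_assoc, List.drop_append_of_le_length h2, ← List.append_assoc]
        refine ⟨p.drop t, q.take (n - (p.drop t ++ u).length), ?_⟩
        have hl : (p.drop t ++ u).length ≤ n := by
          rw [List.length_append, List.length_drop]; omega
        rw [List.take_append, List.take_of_length_le hl]
      by_cases htm : t ≤ s.length
      · left
        refine sub s c (g c ++ (r c ++ s')) (by simp [V]) htm ?_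
        rw [(hPm _ c.2).1]; omega
      · right
        refine sub (s ++ c ++ g c) (r c) s' (by simp [V]) ?_ ?_
        · rw [List.length_append, hlen1]; omega
        · rw [List.length_append, hlen1, hrlen]; omega

theorem bprob_exists_list_le [Fintype A] (h0 : 0 ≤ α) (h1 : α ≤ 1) (N : ℕ)
    (Ev : List A → Set (E → Bool)) {b : ℝ} (h : ∀ l, l.length ≤ N → bprob α (Ev l) ≤ b) :
    bprob α {ω | ∃ l : List A, l.length ≤ N ∧ ω ∈ Ev l} ≤ (Fintype.card A + 1 : ℝ) ^ N * b := by
  have hb : 0 ≤ b := (bprob_nonneg h0 h1 _).trans (h [] (by simp))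
  set dec : (Fin N → Option A) → List A := fun f => (List.ofFn f).reduceOption
  have hdec : ∀ l : List A, l.length ≤ N → ∃ f, dec f = l := by
    intro l hl
    have : ∃ l' : List (Option A), l'.length = N ∧ l'.reduceOption = l :=
      ⟨l.map some ++ List.replicate (N - l.length) none, by simp; omega, by
        simp [List.reduceOption]⟩
    obtain ⟨l', rfl, hl'⟩ := this
    exact ⟨l'.get, by simpa [dec] using hl'⟩
  have hsub : {ω | ∃ l : List A, l.length ≤ N ∧ ω ∈ Ev l} ⊆
      {ω | ∃ f : Fin N → Option A, ω ∈ if (dec f).length ≤ N then Ev (dec f) else ∅} := by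
    rintro ω ⟨l, hl, hω⟩
    obtain ⟨f, rfl⟩ := hdec l hl
    exact ⟨f, by rwa [if_pos hl]⟩
  refine (bprob_mono h0 h1 hsub).trans ((bprob_exists_le h0 h1 _ (b := b) fun f => ?_).trans_eq ?_)
  · split_ifs with hf
    · exact h _ hf
    · rw [bprob_empty]; exact hb
  · simp

end Connecting

section Sprinkling

variable {A E : Type*}

theorem OpenAlong.of_prefix {n : ℕ} {e : List A → E} {ω : E → Bool} {s c d : List A}
    (h : OpenAlong n e ω s d) (hcd : c <+: d) : OpenAlong n e ω s c :=
  fun c' hc' hne => h c' (hc'.trans hcd) hne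

theorem OpenAlong.open_of_infix {n : ℕ} {e : List A → E} {ω : E → Bool} {x a w : List A}
    (hx : x.length = n) (hox : ω (e x) = true) (h : OpenAlong n e ω x a) (hw : w <:+: x ++ a)
    (hwn : w.length = n) : ω (e w) = true := by
  obtain ⟨p, q, hpq⟩ := hw
  obtain ⟨t, ht⟩ : x <+: p ++ w :=
    List.prefix_of_prefix_length_le (List.prefix_append x a) ⟨q, hpq⟩
      (by rw [List.length_append]; omega)
  have hta : t <+: a := by
    refine ⟨q, ?_⟩
    rw [← ht, List.append_assoc] at hpq
    exact List.append_cancel_left hpq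
  by_cases htn : t = []
  · subst htn
    rw [List.append_nil] at ht
    have hl := congrArg List.length ht
    rw [List.length_append] at hl
    obtain rfl : p = [] := List.eq_nil_of_length_eq_zero (by omega)
    rw [List.nil_append] at ht
    rwa [← ht]
  · have := h t hta htn
    rwa [ht, lastWord, List.length_append, hwn, Nat.add_sub_cancel, List.drop_left] at this

theorem MidOpen.open_of_infix {n : ℕ} {e : List A → E} {ω : E → Bool} {x y a a' g : List A}
    (hx : x.length = n) (hy : y.length = n) (hox : ω (e x) = true) (hoy : ω (e y) = true)
    (ha : OpenAlong n e ω x a) (ha' : OpenAlong n (fun l => e l.reverse) ω y.reverse a')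
    (hmid : MidOpen n e ω (x ++ a) g (a'.reverse ++ y)) {w : List A}
    (hw : w <:+: (x ++ a) ++ g ++ (a'.reverse ++ y)) (hwn : w.length = n) :
    ω (e w) = true := by
  obtain ⟨p, q, hpq⟩ := hw
  by_cases h1 : p.length + n ≤ (x ++ a).length
  · refine ha.open_of_infix hx hox ?_ hwn
    refine (List.suffix_append p w).isInfix.trans (List.IsPrefix.isInfix ?_)
    refine List.prefix_of_prefix_length_le ⟨q, hpq⟩ ?_ (by rw [List.length_append]; omega)
    rw [List.append_assoc (x ++ a)]
    exact List.prefix_append _ _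
  by_cases h2 : (x ++ a).length + g.length ≤ p.length
  · have hsuf : w ++ q <:+ a'.reverse ++ y := by
      refine List.suffix_of_suffix_length_le (l₃ := (x ++ a) ++ g ++ (a'.reverse ++ y))
        ⟨p, by rw [← List.append_assoc, hpq]⟩ (List.suffix_append _ _) ?_
      have := congrArg List.length hpq
      simp only [List.length_append] at this h2 ⊢
      omega
    have hrev : w.reverse <:+: y.reverse ++ a' := by
      have : w <:+: a'.reverse ++ y :=
        (List.prefix_append w q).isInfix.trans hsuf.isInfix
      simpa using List.reverse_infix.2 this
    have := ha'.open_of_infix (by simpa using hy) (by simpa using hoy) hrev (by simpa using hwn)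
    simpa using this
  · exact hmid p w q hpq.symm hwn (by omega) (by omega)

/-- Any two aperiodic open words `x` and `y`, the first with an open continuation to the right and
the second with an open continuation to the left, are joined by a word of `L` all of whose
subwords of length `n` are open. -/
def Connects (L : Set (List A)) (n T m : ℕ) (e : List A → E) (ω : E → Bool) : Prop :=
  ∀ x z z' y : List A, x.length = n → y.length = n → z.length = m → z'.length = m →
    x ++ z ∈ L → z' ++ y ∈ L → AperiodicFrom T n x → AperiodicFrom T n y.reverse →
    OpenAlong n e ω x z → OpenAlong n (fun l => e l.reverse) ω y.reverse z'.reverse →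
    ω (e x) = true → ω (e y) = true →
    ∃ V ∈ L, x <+: V ∧ y <:+ V ∧ ∀ w, w <:+: V → w.length = n → ω (e w) = true

/-- A word of length at most `2 * n` witnessing the failure of an escape. -/
def FailsEscape (L : Set (List A)) (n D J : ℕ) (e : List A → E) (ω : E → Bool)
    (l : List A) : Prop :=
  l ∈ L ∧ l.length = n + J * D ∧ AperiodicFrom (2 * J * D) n (l.take n) ∧
    ¬ Escapes L n e D ω J J (l.take n) (l.drop n)

/-- The branching subtrees at `s` and `s'` (in `L` and its reversal) that are open in `ω₁` can be
joined by middle words that are open in `ω₂`. -/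
def Joins (L : Set (List A)) (n : ℕ) (e : List A → E) (ω₁ ω₂ : E → Bool)
    (s s' : List A) : Prop :=
  ∃ c r g : List A, OpenAlong n e ω₁ s c ∧ OpenAlong n (fun l => e l.reverse) ω₁ s' r ∧
    (s ++ c) ++ g ++ (r.reverse ++ s'.reverse) ∈ L ∧
    MidOpen n e ω₂ (s ++ c) g (r.reverse ++ s'.reverse)

theorem connects_of_joins {L : Set (List A)} {n D J : ℕ} {e : List A → E} {ω₁ ω₂ : E → Bool}
    (hJ : J * D ≤ n)
    (h1 : ¬ ∃ l : List A, l.length ≤ 2 * n ∧ FailsEscape L n D J e ω₁ l)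
    (h2 : ¬ ∃ l : List A, l.length ≤ 2 * n ∧
      FailsEscape (revLang L) n D J (fun l => e l.reverse) ω₁ l)
    (hjoin : ∀ s s' : List A, s.length ≤ 2 * n → s'.length ≤ 2 * n → n ≤ s.length →
      n ≤ s'.length → s ∈ L → s' ∈ revLang L → Branches L n e D ω₁ J s →
      Branches (revLang L) n (fun l => e l.reverse) D ω₁ J s' → Joins L n e ω₁ ω₂ s s') :
    Connects L n (2 * J * D) (J * D) e (fun f => ω₁ f || ω₂ f) := by
  intro x z z' y hx hy hz hz' hxz hzy hax hay hoz hoz' hox hoy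
  have esc : ∀ (L : Set (List A)) (e : List A → E), (¬ ∃ l : List A, l.length ≤ 2 * n ∧
      FailsEscape L n D J e ω₁ l) → ∀ x z : List A, x.length = n → z.length = J * D →
      x ++ z ∈ L → AperiodicFrom (2 * J * D) n x →
      OpenAlong n e (fun f => ω₁ f || ω₂ f) x z →
      ∃ a : List A, x ++ a ∈ L ∧ n + a.length ≤ 2 * n ∧ Branches L n e D ω₁ J (x ++ a) ∧
        OpenAlong n e (fun f => ω₁ f || ω₂ f) x a := by
    intro L e h x z hx hz hxz hax hoz
    have hesc : Escapes L n e D ω₁ J J x z := by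
      by_contra hcon
      refine h ⟨x ++ z, by rw [List.length_append]; omega, hxz, by rw [List.length_append]; omega,
        ?_, ?_⟩
      · rwa [List.take_left' hx]
      · rwa [List.take_left' hx, List.drop_left' hx]
    obtain ⟨i, hi, c, hc, hcL, ho, hb⟩ := hesc
    have hle : i * D + D ≤ J * D := by nlinarith
    refine ⟨z.take (i * D) ++ c, by simpa using hcL, ?_, by simpa using hb, ?_⟩
    · rw [List.length_append, List.length_take]; omega
    · exact (hoz.of_prefix (List.take_prefix _ _)).append
        (ho.mono fun f hf => by simp [hf])
  obtain ⟨a, haL, han, hab, hao⟩ := esc L e h1 x z hx hz hxz hax hoz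
  obtain ⟨a', haL', han', hab', hao'⟩ := esc (revLang L) _ h2 y.reverse z'.reverse (by simpa)
    (by simpa) (by simpa [mem_revLang] using hzy) hay hoz'
  obtain ⟨c, r, g, hc, hr, hV, hmid⟩ := hjoin (x ++ a) (y.reverse ++ a')
    (by rw [List.length_append]; omega) (by rw [List.length_append, List.length_reverse]; omega)
    (by rw [List.length_append]; omega) (by rw [List.length_append, List.length_reverse]; omega)
    haL haL' hab hab'
  have hB : r.reverse ++ (y.reverse ++ a').reverse = (a' ++ r).reverse ++ y := by simp
  rw [hB, List.append_assoc x a c] at hV hmid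
  refine ⟨_, hV, ?_, ?_, fun w hw hwn => ?_⟩
  · rw [List.append_assoc x, List.append_assoc x]; exact List.prefix_append _ _
  · rw [← List.append_assoc]; exact List.suffix_append _ _
  · refine MidOpen.open_of_infix hx hy hox hoy (hao.append (hc.mono fun f hf => by simp [hf]))
      (hao'.append (hr.mono fun f hf => by simp [hf])) (g := g) ?_ hw hwn
    intro p w q h1 h2 h3 h4
    have := hmid p w q h1 h2 h3 h4
    simp [this]

variable [Fintype E] [DecidableEq E] {β : ℝ}

theorem bprob_not_joins_le (h0 : 0 ≤ β) (h1 : β ≤ 1) {L : Set (List A)} {n D J L₀ : ℕ}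
    (hn : 0 < n) {e : List A → E} (he : SeparatesWords n e)
    (hglue : ∀ u ∈ L, ∀ v ∈ L, ∃ g : List A, g.length ≤ L₀ ∧ u ++ g ++ v ∈ L)
    (hJ : 2 * (J * D) + L₀ ≤ n) (ω₁ : E → Bool) {s s' : List A} (hs : n ≤ s.length)
    (hs' : n ≤ s'.length) (hsL : s ∈ L) (hsL' : s' ∈ revLang L) (hb : Branches L n e D ω₁ J s)
    (hb' : Branches (revLang L) n (fun l => e l.reverse) D ω₁ J s') :
    bprob β {ω₂ | ¬ Joins L n e ω₁ ω₂ s s'} ≤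
      Real.exp (-(β ^ (2 * n) * (2 ^ J / ((2 * n : ℕ) * (2 * (n + 1) : ℕ))))) := by
  obtain ⟨P, hP, hP'⟩ := hb.exists_finset hsL
  obtain ⟨Q, hQ, hQ'⟩ := hb'.exists_finset hsL'
  refine (bprob_mono h0 h1 ?_).trans (bprob_not_midOpen_le h0 h1 (s := s) (s' := s'.reverse)
    (P := P) (Q := Q.image List.reverse) (m := J * D) hn he hglue hs (by simpa using hs') hP
    (by rw [Finset.card_image_of_injective _ List.reverse_injective, hQ])
    (fun c hc => ⟨(hP' c hc).1, (hP' c hc).2.1⟩) ?_ hJ)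
  · rintro ω₂ hω ⟨c, hc, r, hr, g, hV, hmid⟩
    obtain ⟨r', hr', rfl⟩ := Finset.mem_image.1 hr
    exact hω ⟨c, r', g, (hP' c hc).2.2, (hQ' r' hr').2.2, hV, hmid⟩
  · intro r hr
    obtain ⟨r', hr', rfl⟩ := Finset.mem_image.1 hr
    refine ⟨by simpa using (hQ' r' hr').1, ?_⟩
    simpa [mem_revLang] using (hQ' r' hr').2.1

theorem bprob_exists_failsEscape_le [Fintype A] (h0 : 0 ≤ β) (h1 : β ≤ 1) {L : Set (List A)}
    {n D J M : ℕ} (hδ : 6 * D * (1 - β) ≤ 1 / 6) (hD : 0 < D) {e : List A → E}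
    (he : SeparatesWords n e) (hL : IsLang L M)
    (hbr : ∀ u ∈ L, ∃ c : Fin 3 → List A, Function.Injective c ∧
      ∀ i, (c i).length = D ∧ u ++ c i ∈ L) (hJ : 2 * J * D ≤ n) :
    bprob β {ω | ∃ l : List A, l.length ≤ 2 * n ∧ FailsEscape L n D J e ω l} ≤
      (Fintype.card A + 1 : ℝ) ^ (2 * n) * (12 * D * (1 - β)) ^ J := by
  have hδ0 : (0 : ℝ) ≤ 12 * D * (1 - β) := mul_nonneg (by positivity) (sub_nonneg.2 h1)
  refine bprob_exists_list_le h0 h1 (2 * n) (fun l => {ω | FailsEscape L n D J e ω l})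
    fun l _ => ?_
  by_cases h : l ∈ L ∧ l.length = n + J * D ∧ AperiodicFrom (2 * J * D) n (l.take n)
  · obtain ⟨hl, hlen, hap⟩ := h
    have hx : (l.take n).length = n := by rw [List.length_take]; omega
    have key := bprob_not_escapes_le (n := n) (e := e) h0 h1 hδ hD hbr hL (x := l.take n)
      (T := 2 * J * D) (fun a a' ha ha' h => hap.eq_of_lastWord_eq hx ha ha' hJ
        (he _ _ (length_lastWord (by rw [List.length_append]; omega))
          (length_lastWord (by rw [List.length_append]; omega)) h)) J J [] (l.drop n)
      (by rw [List.length_drop]; omega) (by simpa using hl)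
      (by simp only [List.length_nil]; linarith)
    refine (bprob_mono h0 h1 ?_).trans key
    rintro ω ⟨-, -, -, hω⟩
    simpa using hω
  · refine (bprob_mono h0 h1 (Ev' := ∅) ?_).trans ?_
    · rintro ω ⟨h2, h3, h4, -⟩
      exact h ⟨h2, h3, h4⟩
    · rw [bprob_empty]; positivity

theorem bprob_not_connects_le [Fintype A] (h0 : 0 ≤ β) (h1 : β ≤ 1) {L : Set (List A)}
    {n D J L₀ M : ℕ} (hδ : 6 * D * (1 - β) ≤ 1 / 6) (hD : 0 < D) (hn : 0 < n) {e : List A → E}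
    (he : SeparatesWords n e) (hL : IsLang L M)
    (hbr : ∀ u ∈ L, ∃ c : Fin 3 → List A, Function.Injective c ∧
      ∀ i, (c i).length = D ∧ u ++ c i ∈ L)
    (hbr' : ∀ u ∈ revLang L, ∃ c : Fin 3 → List A, Function.Injective c ∧
      ∀ i, (c i).length = D ∧ u ++ c i ∈ revLang L)
    (hglue : ∀ u ∈ L, ∀ v ∈ L, ∃ g : List A, g.length ≤ L₀ ∧ u ++ g ++ v ∈ L)
    (hJ : 2 * J * D + L₀ ≤ n) {α : ℝ} (hα : 1 - α = (1 - β) * (1 - β)) :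
    bprob α {ω | ¬ Connects L n (2 * J * D) (J * D) e ω} ≤
      2 * ((Fintype.card A + 1 : ℝ) ^ (2 * n) * (12 * D * (1 - β)) ^ J) +
      (Fintype.card A + 1 : ℝ) ^ (4 * n) *
        Real.exp (-(β ^ (2 * n) * (2 ^ J / ((2 * n : ℕ) * (2 * (n + 1) : ℕ))))) := by
  set b₁ := (Fintype.card A + 1 : ℝ) ^ (2 * n) * (12 * D * (1 - β)) ^ J
  set ex := Real.exp (-(β ^ (2 * n) * (2 ^ J / ((2 * n : ℕ) * (2 * (n + 1) : ℕ)))))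
  set b₂ := (Fintype.card A + 1 : ℝ) ^ (4 * n) * ex
  have hb₂ : 0 ≤ b₂ := by positivity
  set Bad : Set (E → Bool) := {ω | ∃ l : List A, l.length ≤ 2 * n ∧ FailsEscape L n D J e ω l} ∪
    {ω | ∃ l : List A, l.length ≤ 2 * n ∧
      FailsEscape (revLang L) n D J (fun l => e l.reverse) ω l} with hBad
  have hbad : bprob β Bad ≤ 2 * b₁ := by
    refine (bprob_union_le h0 h1 _ _).trans ?_
    have h2 := bprob_exists_failsEscape_le h0 h1 hδ hD he hL hbr (J := J) (by omega)
    have h3 := bprob_exists_failsEscape_le h0 h1 hδ hD he.comp_reverse hL.rev hbr' (J := J)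
      (by omega)
    linarith
  have hrest : ∀ ω₁ ∉ Bad, bprob β {ω₂ | (fun f => (ω₁ f || ω₂ f)) ∈
      {ω | ¬ Connects L n (2 * J * D) (J * D) e ω}} ≤ b₂ := by
    intro ω₁ hω₁
    simp only [hBad, Set.mem_union, not_or] at hω₁
    set Ev : List A → List A → Set (E → Bool) := fun s s' => {ω₂ | n ≤ s.length ∧ n ≤ s'.length ∧
      s ∈ L ∧ s' ∈ revLang L ∧ Branches L n e D ω₁ J s ∧
      Branches (revLang L) n (fun l => e l.reverse) D ω₁ J s' ∧ ¬ Joins L n e ω₁ ω₂ s s'}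
    have hsub : {ω₂ | (fun f => (ω₁ f || ω₂ f)) ∈
        {ω | ¬ Connects L n (2 * J * D) (J * D) e ω}} ⊆
        {ω₂ | ∃ s : List A, s.length ≤ 2 * n ∧
          ω₂ ∈ {ω₂ | ∃ s' : List A, s'.length ≤ 2 * n ∧ ω₂ ∈ Ev s s'}} := by
      intro ω₂ hω₂
      by_contra hcon
      refine hω₂ (connects_of_joins (by linarith) hω₁.1 hω₁.2
        fun s s' h1 h2 h3 h4 h5 h6 h7 h8 => ?_)
      by_contra hj
      exact hcon ⟨s, h1, s', h2, h3, h4, h5, h6, h7, h8, hj⟩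
    have hEv : ∀ s s', bprob β (Ev s s') ≤ ex := by
      intro s s'
      by_cases h : n ≤ s.length ∧ n ≤ s'.length ∧ s ∈ L ∧ s' ∈ revLang L ∧
          Branches L n e D ω₁ J s ∧ Branches (revLang L) n (fun l => e l.reverse) D ω₁ J s'
      · obtain ⟨h2, h3, h4, h5, h6, h7⟩ := h
        exact (bprob_mono h0 h1 fun ω₂ hω => hω.2.2.2.2.2.2).trans
          (bprob_not_joins_le h0 h1 hn he hglue (by linarith) ω₁ h2 h3 h4 h5 h6 h7)
      · refine (bprob_mono h0 h1 (Ev' := ∅) ?_).trans ?_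
        · rintro ω₂ ⟨h2, h3, h4, h5, h6, h7, -⟩
          exact h ⟨h2, h3, h4, h5, h6, h7⟩
        · rw [bprob_empty]; positivity
    refine (bprob_mono h0 h1 hsub).trans ((bprob_exists_list_le h0 h1 _ _ fun s _ =>
      bprob_exists_list_le h0 h1 _ _ fun s' _ => hEv s s').trans_eq ?_)
    simp only [b₂]
    rw [← mul_assoc, ← pow_add]
    congr 2; ring
  rw [bprob_eq_sum_or hα]
  calc _ ≤ ∑ ω₁, bernWeight β ω₁ * ((if ω₁ ∈ Bad then 1 else 0) + b₂) := by
        refine Finset.sum_le_sum fun ω₁ _ =>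
          mul_le_mul_of_nonneg_left ?_ (bernWeight_nonneg h0 h1 ω₁)
        split_ifs with h
        · linarith [bprob_le_one h0 h1 {ω₂ | (fun f => (ω₁ f || ω₂ f)) ∈
            {ω | ¬ Connects L n (2 * J * D) (J * D) e ω}}]
        · rw [zero_add]; exact hrest ω₁ h
    _ = bprob β Bad + b₂ := by
        simp only [mul_add, Finset.sum_add_distrib]
        rw [← Finset.sum_mul, sum_bernWeight, one_mul, bprob_eq_sum_bernWeight]
        congr 1
        exact Finset.sum_congr rfl fun ω _ => by split_ifs <;> simp
    _ ≤ _ := by linarith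

end Sprinkling

section Points

variable {A : Type*}

/-- The block of length `m` of the point `x` starting at position `i`, as a list. -/
def block (x : ℤ → A) (i : ℤ) (m : ℕ) : List A := List.ofFn (subword x i m)

/-- The set of finite words occurring in points of `X`. -/
def langOf (X : Set (ℤ → A)) : Set (List A) := {l | ∃ x ∈ X, ∃ i : ℤ, block x i l.length = l}

@[simp]
theorem length_block (x : ℤ → A) (i : ℤ) (m : ℕ) : (block x i m).length = m := by
  simp [block]

theorem getElem?_block (x : ℤ → A) (i : ℤ) {m j : ℕ} (h : j < m) :
    (block x i m)[j]? = some (x (i + j)) := by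
  simp [block, subword, h]

theorem block_eq_iff {x : ℤ → A} {i : ℤ} {l : List A} {m : ℕ} (hl : l.length = m) :
    block x i m = l ↔ ∀ j < m, l[j]? = some (x (i + j)) := by
  constructor
  · rintro rfl j hj
    exact getElem?_block x i hj
  · intro h
    apply List.ext_getElem?
    intro j
    by_cases hj : j < m
    · rw [h j hj, getElem?_block x i hj]
    · rw [List.getElem?_eq_none (by rw [length_block]; omega), List.getElem?_eq_none (by omega)]

theorem block_eq_block_iff {x y : ℤ → A} {i j : ℤ} {m : ℕ} :
    block x i m = block y j m ↔ ∀ k < m, x (i + k) = y (j + k) := by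
  rw [block_eq_iff (length_block y j m)]
  refine forall₂_congr fun k hk => ?_
  rw [getElem?_block y j hk, Option.some_inj, eq_comm]

theorem block_add (x : ℤ → A) (i : ℤ) (m k : ℕ) :
    block x i (m + k) = block x i m ++ block x (i + m) k := by
  rw [block_eq_iff (by simp)]
  intro j hj
  by_cases h : j < m
  · rw [List.getElem?_append_left (by simpa using h), getElem?_block x i h]
  · rw [List.getElem?_append_right (by simpa using h), length_block,
      getElem?_block x _ (by omega)]
    congr 2
    push_cast [not_lt.1 h]
    ring

theorem block_append_iff {x : ℤ → A} {i : ℤ} {u v : List A} :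
    block x i (u ++ v).length = u ++ v ↔
      block x i u.length = u ∧ block x (i + u.length) v.length = v := by
  rw [List.length_append, block_add]
  constructor
  · intro h
    exact List.append_inj h (by simp)
  · rintro ⟨h1, h2⟩
    rw [h1, h2]

theorem block_translate (x : ℤ → A) (k i : ℤ) (m : ℕ) :
    block (fun t => x (t + k)) i m = block x (i + k) m := by
  rw [block_eq_block_iff]
  intro j _
  congr 1; ring

theorem infix_block_iff {x : ℤ → A} {i : ℤ} {m : ℕ} {w : List A} (h : w <:+: block x i m) :
    ∃ j : ℕ, j + w.length ≤ m ∧ block x (i + j) w.length = w := by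
  obtain ⟨p, q, h⟩ := h
  have hm : m = (p ++ (w ++ q)).length := by
    rw [← List.append_assoc, h, length_block]
  rw [List.append_assoc, hm] at h
  have h2 := (block_append_iff.1 (block_append_iff.1 h.symm).2).1
  refine ⟨p.length, ?_, h2⟩
  rw [hm]
  simp only [List.length_append]; omega

theorem shiftMap_iterate (m : ℕ) (x : ℤ → A) : shiftMap^[m] x = fun t => x (t + m) := by
  induction m generalizing x with
  | zero => simp
  | succ m ih =>
    rw [Function.iterate_succ_apply, ih]
    funext t
    simp only [shiftMap]
    congr 1; push_cast; ring

theorem mem_wordsOf_iff {X : Set (ℤ → A)} {n : ℕ} {w : Fin n → A} :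
    w ∈ wordsOf X n ↔ List.ofFn w ∈ langOf X := by
  constructor
  · rintro ⟨x, hx, i, h⟩
    refine ⟨x, hx, i, ?_⟩
    rw [List.length_ofFn, block]
    congr 1
    funext j
    exact h j
  · rintro ⟨x, hx, i, h⟩
    refine ⟨x, hx, i, fun j => ?_⟩
    rw [List.length_ofFn, block] at h
    exact congrFun (List.ofFn_injective h) j

theorem block_mem_langOf {X : Set (ℤ → A)} {x : ℤ → A} (hx : x ∈ X) (i : ℤ) (m : ℕ) :
    block x i m ∈ langOf X := ⟨x, hx, i, by rw [length_block]⟩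

theorem ncard_wordsOf (X : Set (ℤ → A)) (n : ℕ) :
    (wordsOf X n).ncard = {l : List A | l ∈ langOf X ∧ l.length = n}.ncard := by
  rw [← Set.ncard_image_of_injective _ (List.ofFn_injective (n := n) (α := A))]
  congr 1
  ext l
  constructor
  · rintro ⟨w, hw, rfl⟩
    exact ⟨mem_wordsOf_iff.1 hw, by simp⟩
  · rintro ⟨h, rfl⟩
    exact ⟨l.get, mem_wordsOf_iff.2 (by simpa using h), by simp⟩

theorem IsSFT.translate {X : Set (ℤ → A)} (h : IsSFT X) {x : ℤ → A} (hx : x ∈ X) (k : ℤ) :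
    (fun t => x (t + k)) ∈ X := by
  obtain ⟨F, -, rfl⟩ := h
  rintro w hw ⟨i, hi⟩
  refine hx w hw ⟨i + k, fun j => ?_⟩
  rw [← hi j]
  congr 1; ring

/-- Points are built by following `y` and then `z` where they overlap. -/
theorem exists_glued_point {G : Set (List A)} {N : ℕ} {y z : ℤ → A} {a : ℤ} {K : ℕ}
    (hK : N ≤ K + 1) (P : ℤ → Prop)
    (hy : ∀ i, P i → i + N ≤ a + K → block y i N ∈ G)
    (hz : ∀ i, P i → a ≤ i → block z i N ∈ G) (hyz : ∀ t, a ≤ t → t < a + K → y t = z t) :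
    ∃ ζ : ℤ → A, (∀ i, P i → block ζ i N ∈ G) ∧ (∀ t, t < a + K → ζ t = y t) ∧
      ∀ t, a ≤ t → ζ t = z t := by
  set ζ : ℤ → A := fun t => if t < a + K then y t else z t with hζ
  have h1 : ∀ t, t < a + K → ζ t = y t := fun t ht => if_pos ht
  have h2 : ∀ t, a ≤ t → ζ t = z t := by
    intro t ht
    by_cases h : t < a + K
    · rw [h1 t h, hyz t ht h]
    · exact if_neg h
  refine ⟨ζ, fun i hi => ?_, h1, h2⟩
  by_cases h : i + N ≤ a + K
  · rw [block_eq_block_iff.2 fun j hj => h1 (i + j) (by omega)]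
    exact hy i hi h
  · rw [block_eq_block_iff.2 fun j hj => h2 (i + j) (by omega)]
    exact hz i hi (by omega)

theorem IsSFT.exists_memory {X : Set (ℤ → A)} (h : IsSFT X) :
    ∃ M : ℕ, ∀ m ≥ M, ∀ x : ℤ → A, (∀ i, block x i m ∈ langOf X) → x ∈ X := by
  obtain ⟨F, hF, rfl⟩ := h
  obtain ⟨M, hM⟩ := (hF.image Sigma.fst).bddAbove
  refine ⟨M, fun m hm x hx w hw => ?_⟩
  rintro ⟨i, hi⟩
  obtain ⟨y, hy, k, hyk⟩ := hx i
  rw [length_block, block_eq_block_iff] at hyk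
  refine hy w hw ⟨k, fun j => ?_⟩
  rw [← hi j]
  exact hyk j (j.2.trans_le ((hM ⟨w, hw, rfl⟩).trans hm))

/-- Two points of `X` agreeing on `M` consecutive positions can be glued. -/
theorem exists_glued_mem {X : Set (ℤ → A)} {M : ℕ}
    (hM : ∀ m ≥ M, ∀ x : ℤ → A, (∀ i, block x i m ∈ langOf X) → x ∈ X) {y z : ℤ → A}
    (hy : y ∈ X) (hz : z ∈ X) {a : ℤ} {K : ℕ} (hK : M ≤ K)
    (hyz : ∀ t, a ≤ t → t < a + K → y t = z t) :
    ∃ ζ ∈ X, (∀ t, t < a + K → ζ t = y t) ∧ ∀ t, a ≤ t → ζ t = z t := by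
  obtain ⟨ζ, h1, h2⟩ := exists_glued_point (G := langOf X) (N := M) (by omega) (fun _ => True)
    (fun i _ _ => block_mem_langOf hy i M) (fun i _ _ => block_mem_langOf hz i M) hyz
  exact ⟨ζ, hM M le_rfl ζ fun i => h1 i trivial, h2⟩

theorem isOpen_setOf_block_eq [TopologicalSpace A] [DiscreteTopology A] (i : ℤ) (m : ℕ)
    (l : List A) : IsOpen {x : ℤ → A | block x i m = l} := by
  have hc : Continuous fun x : ℤ → A => subword x i m :=
    continuous_pi fun j => continuous_apply _
  exact (isOpen_discrete {w : Fin m → A | List.ofFn w = l}).preimage hc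

theorem exists_block_nhd [TopologicalSpace A] {U : Set (ℤ → A)} (hU : IsOpen U)
    {x : ℤ → A} (hx : x ∈ U) : ∃ k : ℕ, ∀ y : ℤ → A, (∀ t : ℤ, -k ≤ t → t < k → y t = x t) →
      y ∈ U := by
  obtain ⟨I, u, hu, hIu⟩ := isOpen_pi_iff.1 hU x hx
  refine ⟨I.sup Int.natAbs + 1, fun y hy => hIu fun t ht => ?_⟩
  have : t.natAbs ≤ I.sup Int.natAbs := Finset.le_sup (f := Int.natAbs) ht
  rw [hy t (by omega) (by omega)]
  exact (hu t ht).2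

theorem exists_connecting_point [TopologicalSpace A] [DiscreteTopology A] {X : Set (ℤ → A)}
    (h : IsIrredSubshift X) {x y : ℤ → A} (hx : x ∈ X) (hy : y ∈ X) (m N : ℕ) (i j : ℤ) :
    ∃ z ∈ X, ∃ k : ℕ, N ≤ k ∧ block z i m = block x i m ∧ block z (j + k) m = block y j m := by
  obtain ⟨k, hk, w, ⟨z, ⟨hz, hzU⟩, rfl⟩, -, hwV⟩ := h.2 _ _ (isOpen_setOf_block_eq i m (block x i m))
    (isOpen_setOf_block_eq j m (block y j m)) ⟨x, hx, rfl⟩ ⟨y, hy, rfl⟩ N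
  refine ⟨z, hz, k, hk, hzU, ?_⟩
  rw [shiftMap_iterate] at hwV
  rw [← block_translate]
  exact hwV

theorem isLang_langOf [Finite A] [TopologicalSpace A] [DiscreteTopology A] {X : Set (ℤ → A)}
    (hSFT : IsSFT X) (hirr : IsIrredSubshift X) {lam : ℝ} (hlam : 1 < lam)
    (hent : Tendsto (fun n : ℕ => Real.log ((wordsOf X n).ncard) / (n : ℝ))
      atTop (𝓝 (Real.log lam))) {M : ℕ}
    (hM : ∀ m ≥ M, ∀ x : ℤ → A, (∀ i, block x i m ∈ langOf X) → x ∈ X) :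
    IsLang (langOf X) M where
  infix_mem := by
    rintro u v ⟨x, hx, i, h⟩ hv
    rw [← h] at hv
    obtain ⟨j, -, hj⟩ := infix_block_iff hv
    exact ⟨x, hx, _, hj⟩
  glue := by
    rintro u v w ⟨x, hx, i, h⟩ ⟨y, hy, j, h'⟩ hv
    obtain ⟨h1, h2⟩ := block_append_iff.1 h
    obtain ⟨h3, h4⟩ := block_append_iff.1 h'
    obtain ⟨ζ, hζ, hζx, hζy⟩ := exists_glued_mem hM hx (hSFT.translate hy (j - (i + u.length)))
      (a := i + u.length) hv (by
        intro t ht1 ht2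
        have := block_eq_block_iff.1 (h2.trans h3.symm) (t - (i + u.length)).toNat (by omega)
        rw [Int.toNat_of_nonneg (by omega)] at this
        convert this using 2 <;> ring)
    refine ⟨ζ, hζ, i, block_append_iff.2 ⟨?_, ?_⟩⟩
    · exact (block_eq_block_iff.2 fun t ht => hζx _ (by
        rw [List.length_append] at ht; omega)).trans h
    · rw [List.length_append]
      refine (block_eq_block_iff.2 fun t ht => ?_).trans h4
      rw [hζy _ (by omega)]
      congr 1; push_cast; ring
  irred := by
    rintro u v ⟨x, hx, i, h⟩ ⟨y, hy, j, h'⟩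
    obtain ⟨z, hz, k, hk, h1, h2⟩ := exists_connecting_point hirr hx hy (max u.length v.length)
      (i + u.length - j).toNat i j
    rw [block_eq_block_iff] at h1 h2
    have hu : block z i u.length = u :=
      (block_eq_block_iff.2 fun t ht => h1 t (lt_max_of_lt_left ht)).trans h
    have hv : block z (j + k) v.length = v :=
      (block_eq_block_iff.2 fun t ht => h2 t (lt_max_of_lt_right ht)).trans h'
    refine ⟨block z (i + u.length) (j + k - i - u.length).toNat, z, hz, i, ?_⟩
    refine block_append_iff.2 ⟨block_append_iff.2 ⟨hu, by rw [length_block]⟩, ?_⟩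
    rw [List.length_append, length_block]
    convert hv using 2
    omega
  unbounded N := by
    have hl : 0 < Real.log lam := Real.log_pos hlam
    have h1 : ∀ᶠ n : ℕ in atTop, Real.log lam / 2 < Real.log ((wordsOf X n).ncard) / (n : ℝ) :=
      hent.eventually (lt_mem_nhds (by linarith))
    have h2 : Tendsto (fun n : ℕ => Real.log lam / 2 * (n : ℝ)) atTop atTop :=
      tendsto_natCast_atTop_atTop.const_mul_atTop (by linarith)
    obtain ⟨n, h1, h2, h3⟩ := (h1.and ((h2.eventually_ge_atTop (Real.log (N + 1))).and
      (eventually_gt_atTop 0))).exists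
    refine ⟨n, ?_⟩
    rw [← ncard_wordsOf]
    rw [lt_div_iff₀ (by exact_mod_cast h3)] at h1
    have h4 : Real.log (N + 1) < Real.log ((wordsOf X n).ncard) := h2.trans_lt h1
    by_contra hcon
    rcases Nat.eq_zero_or_pos (wordsOf X n).ncard with h0 | h0
    · rw [h0, Nat.cast_zero, Real.log_zero] at h4
      exact absurd h4 (not_lt.2 (Real.log_nonneg (by linarith [Nat.cast_nonneg (α := ℝ) N])))
    · refine absurd h4 (not_lt.2 (Real.log_le_log (by exact_mod_cast h0) ?_))
      have : (((wordsOf X n).ncard : ℕ) : ℝ) ≤ N := by exact_mod_cast not_lt.1 hcon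
      linarith

end Points

section WindowShift

variable {A : Type*}

/-- The points all of whose blocks of length `n` lie in `G`. -/
def WindowShift (n : ℕ) (G : Set (List A)) : Set (ℤ → A) := {x | ∀ i : ℤ, block x i n ∈ G}

/-- `v` can be reached from `u` along a word all of whose subwords of length `n` lie in `G`. -/
def Reach (n : ℕ) (G : Set (List A)) (u v : List A) : Prop :=
  ∃ V : List A, u <+: V ∧ v <:+ V ∧ ∀ w, w <:+: V → w.length = n → w ∈ G

/-- The words mutually reachable with `u`. -/
def commClass (n : ℕ) (G : Set (List A)) (u : List A) : Set (List A) :=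
  {w | Reach n G u w ∧ Reach n G w u}

theorem isSFT_windowShift [Finite A] (n : ℕ) (G : Set (List A)) : IsSFT (WindowShift n G) := by
  refine ⟨(fun w : Fin n → A => (⟨n, w⟩ : (n : ℕ) × (Fin n → A))) '' {w | List.ofFn w ∉ G},
    (Set.toFinite _).image _, ?_⟩
  ext x
  constructor
  · rintro hx _ ⟨w, hw, rfl⟩ ⟨i, hi⟩
    refine hw ?_
    convert hx i using 1
    rw [block]
    congr 1
    exact (funext hi).symm
  · intro h i
    by_contra hcon
    exact h ⟨n, subword x i n⟩ ⟨_, hcon, rfl⟩ ⟨i, fun j => rfl⟩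

theorem IsSFT.isSubshift [TopologicalSpace A] [DiscreteTopology A] {X : Set (ℤ → A)}
    (h : IsSFT X) : IsSubshift X := by
  constructor
  · obtain ⟨F, -, rfl⟩ := h
    have : {x : ℤ → A | ∀ w ∈ F, ¬ OccursIn w.2 x} =
        ⋂ w ∈ F, ⋂ i : ℤ, {x : ℤ → A | block x i w.1 = List.ofFn w.2}ᶜ := by
      ext x
      simp only [Set.mem_iInter, Set.mem_compl_iff, Set.mem_ofPred_eq, OccursIn, not_exists]
      refine forall₃_congr fun w _ i => not_congr ?_
      rw [block, List.ofFn_injective.eq_iff, funext_iff]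
      rfl
    rw [this]
    exact isClosed_biInter fun w _ => isClosed_iInter fun i =>
      (isOpen_setOf_block_eq i w.1 _).isClosed_compl
  · ext x
    constructor
    · rintro ⟨y, hy, rfl⟩
      exact h.translate hy 1
    · intro hx
      exact ⟨_, h.translate hx (-1), funext fun t => by simp [shiftMap]⟩

variable {n : ℕ} {G : Set (List A)}

theorem Reach.mem_right {u v : List A} (h : Reach n G u v) (hv : v.length = n) : v ∈ G := by
  obtain ⟨V, -, h1, h⟩ := h
  exact h v h1.isInfix hv

theorem infix_append_cases {p v q w : List A} (h : w <:+: p ++ v ++ q)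
    (hw : w.length ≤ v.length + 1) : w <:+: p ++ v ∨ w <:+: v ++ q := by
  obtain ⟨a, b, hab⟩ := h
  by_cases hlen : a.length + w.length ≤ (p ++ v).length
  · left
    refine (List.suffix_append a w).isInfix.trans (List.IsPrefix.isInfix ?_)
    exact List.prefix_of_prefix_length_le ⟨b, hab⟩ (List.prefix_append _ _)
      (by rw [List.length_append]; omega)
  · right
    refine (List.prefix_append w b).isInfix.trans (List.IsSuffix.isInfix ?_)
    refine List.suffix_of_suffix_length_le (l₃ := p ++ v ++ q)
      ⟨a, by rw [← List.append_assoc, hab]⟩ ⟨p, by rw [List.append_assoc]⟩ ?_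
    have := congrArg List.length hab
    simp only [List.length_append] at this hlen ⊢
    omega

theorem Reach.trans {u v w : List A} (hv : v.length = n) (h : Reach n G u v)
    (h' : Reach n G v w) : Reach n G u w := by
  obtain ⟨V, hV1, ⟨p, rfl⟩, hV⟩ := h
  obtain ⟨V', ⟨q, rfl⟩, hV2, hV'⟩ := h'
  refine ⟨p ++ v ++ q, hV1.trans (List.prefix_append _ _), ?_, fun x hx hxn => ?_⟩
  · rw [List.append_assoc]
    exact hV2.trans (List.suffix_append _ _)
  · rcases infix_append_cases hx (by omega) with h | h
    · exact hV x h hxn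
    · exact hV' x h hxn

theorem reach_block {x : ℤ → A} (hx : x ∈ WindowShift n G) {i j : ℤ} (hij : i ≤ j) :
    Reach n G (block x i n) (block x j n) := by
  refine ⟨block x i ((j - i).toNat + n), ?_, ?_, fun w hw hwn => ?_⟩
  · rw [add_comm, block_add]; exact List.prefix_append _ _
  · rw [block_add, Int.toNat_of_nonneg (by omega), add_sub_cancel]
    exact List.suffix_append _ _
  · obtain ⟨k, -, hk⟩ := infix_block_iff hw
    rw [← hk, hwn]
    exact hx _

/-- A left ray and a right ray joined by a path combine to a point. -/
theorem Reach.exists_point [Nonempty A] {ξ η : ℤ → A} (hξ : ξ ∈ WindowShift n G)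
    (hη : η ∈ WindowShift n G) (h : Reach n G (block ξ 0 n) (block η 0 n)) :
    ∃ ζ ∈ WindowShift n G, ∃ k : ℕ, (∀ t < (n : ℤ), ζ t = ξ t) ∧
      ∀ t, 0 ≤ t → ζ (t + k) = η t := by
  obtain ⟨V, hV1, ⟨p, hp⟩, hV⟩ := h
  have hVlen : p.length + n = V.length := by rw [← hp]; simp
  set y : ℤ → A := fun t => V.getD t.toNat (Classical.arbitrary A) with hy
  have hyV : ∀ (i j : ℕ), i + j ≤ V.length → block y i j = (V.drop i).take j := by
    intro i j hij
    rw [block_eq_iff (by rw [List.length_take, List.length_drop]; omega)]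
    intro t ht
    rw [List.getElem?_take_of_lt ht, List.getElem?_drop]
    simp only [hy]
    rw [← Nat.cast_add, Int.toNat_natCast, List.getD_eq_getElem?_getD,
      List.getElem?_eq_getElem (by omega), Option.getD_some]
  have hywin : ∀ i : ℤ, 0 ≤ i → i + n ≤ V.length → block y i n ∈ G := by
    intro i hi hin
    lift i to ℕ using hi
    rw [hyV _ _ (by omega)]
    exact hV _ ((List.take_prefix _ _).isInfix.trans (List.drop_suffix _ _).isInfix)
      (by rw [List.length_take, List.length_drop]; omega)
  obtain ⟨z, hz, hzy, hzη⟩ := exists_glued_point (G := G) (N := n) (y := y)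
    (z := fun t => η (t + -(p.length : ℤ))) (a := p.length) (K := n) (by omega) (fun i => 0 ≤ i)
    (fun i hi h => hywin i hi (by omega))
    (fun i _ _ => by rw [block_translate]; exact hη _) (by
      intro t h1 h2
      have h3 : block y p.length n = block η 0 n := by
        rw [hyV _ _ (by omega), ← hp, List.drop_left, List.take_of_length_le (by simp)]
      have := block_eq_block_iff.1 h3 (t - p.length).toNat (by omega)
      rw [Int.toNat_of_nonneg (by omega)] at this
      convert this using 2 <;> ring)
  obtain ⟨ζ, hζ, hζξ, hζz⟩ := exists_glued_point (G := G) (N := n) (y := ξ)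
    (z := z) (a := 0) (K := n) (by omega) (fun _ => True)
    (fun i _ _ => hξ i) (fun i _ hi => hz i hi) (by
      intro t h1 h2
      have h3 : block ξ 0 n = block y 0 n := by
        have := hyV 0 n (by omega)
        rw [Nat.cast_zero] at this
        rw [this, List.drop_zero]
        simpa using List.prefix_iff_eq_take.1 hV1
      have := block_eq_block_iff.1 h3 t.toNat (by omega)
      rw [Int.toNat_of_nonneg (by omega), zero_add] at this
      rw [this, hzy t (by omega)])
  refine ⟨ζ, fun i => hζ i trivial, p.length, fun t ht => hζξ t (by omega), fun t ht => ?_⟩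
  rw [hζz _ (by omega), hzη _ (by omega)]
  congr 1; ring

theorem reach_commClass {u v w : List A} (hu : u.length = n) (hvn : v.length = n)
    (hwn : w.length = n) (hv : v ∈ commClass n G u)
    (hw : w ∈ commClass n G u) : Reach n (commClass n G u) v w := by
  obtain ⟨V, hV1, hV2, hV⟩ := hv.2.trans hu hw.1
  refine ⟨V, hV1, hV2, fun x hx hxn => ?_⟩
  obtain ⟨p, q, rfl⟩ := hx
  have hpx : p ++ x <:+: p ++ x ++ q := (List.prefix_append _ _).isInfix
  have hxq : x ++ q <:+: p ++ x ++ q := by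
    rw [List.append_assoc]; exact (List.suffix_append _ _).isInfix
  constructor
  · refine hv.1.trans hvn ⟨p ++ x, ?_, List.suffix_append _ _, fun y hy => hV y (hy.trans hpx)⟩
    exact List.prefix_of_prefix_length_le hV1 (List.prefix_append _ _)
      (by rw [List.length_append]; omega)
  · refine Reach.trans hwn ⟨x ++ q, List.prefix_append _ _, ?_, fun y hy => hV y (hy.trans hxq)⟩
      hw.2
    exact List.suffix_of_suffix_length_le hV2 ⟨p, by rw [List.append_assoc]⟩
      (by rw [List.length_append]; omega)

theorem windowShift_commClass_subset {u : List A} :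
    WindowShift n (commClass n G u) ⊆ WindowShift n G :=
  fun x hx i => (hx i).1.mem_right (length_block x i n)

theorem WindowShift.translate {x : ℤ → A} (hx : x ∈ WindowShift n G) (k : ℤ) :
    (fun t => x (t + k)) ∈ WindowShift n G := by
  intro i
  rw [block_translate]
  exact hx _

theorem reach_of_isIrredSubshift [TopologicalSpace A] [DiscreteTopology A] {C : Set (ℤ → A)}
    (hC : IsIrredSubshift C) (hCG : C ⊆ WindowShift n G) {x y : ℤ → A} (hx : x ∈ C)
    (hy : y ∈ C) (i j : ℤ) : Reach n G (block x i n) (block y j n) := by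
  obtain ⟨z, hz, k, hk, h1, h2⟩ := exists_connecting_point hC hx hy n (i - j).toNat i j
  rw [← h1, ← h2]
  exact reach_block (hCG hz) (by omega)

theorem isIrredSubshift_commClass [Finite A] [TopologicalSpace A] [DiscreteTopology A]
    {u : List A} (hu : u.length = n) : IsIrredSubshift (WindowShift n (commClass n G u)) := by
  refine ⟨(isSFT_windowShift n _).isSubshift, ?_⟩
  rintro U V hU hV ⟨x, hx, hxU⟩ ⟨y, hy, hyV⟩ N
  obtain ⟨k₁, hk₁⟩ := exists_block_nhd hU hxU
  obtain ⟨k₂, hk₂⟩ := exists_block_nhd hV hyV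
  set k := k₁ + k₂ + N
  have : Nonempty A := ⟨x 0⟩
  have hr : Reach n (commClass n G u) (block (fun t => x (t + k)) 0 n)
      (block (fun t => y (t + -(k : ℤ))) 0 n) := by
    rw [block_translate, block_translate]
    exact reach_commClass hu (length_block _ _ _) (length_block _ _ _) (hx _) (hy _)
  obtain ⟨ζ, hζ, s, h1, h2⟩ := hr.exists_point (WindowShift.translate hx _)
    (WindowShift.translate hy _)
  have hζk := WindowShift.translate hζ (-(k : ℤ))
  refine ⟨2 * k + s, by omega, _, ⟨_, ⟨hζk, ?_⟩, rfl⟩, ?_, ?_⟩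
  · refine hk₁ _ fun t ht1 ht2 => ?_
    rw [h1 _ (by omega), neg_add_cancel_right]
  · rw [shiftMap_iterate]
    exact WindowShift.translate hζk _
  · refine hk₂ _ fun t ht1 ht2 => ?_
    rw [shiftMap_iterate]
    have := h2 (t + k) (by omega)
    rw [show t + k + -(k : ℤ) = t by ring] at this
    exact (congrArg ζ (by push_cast; ring)).trans this

theorem subset_commClass [TopologicalSpace A] [DiscreteTopology A] {C : Set (ℤ → A)}
    (hC : IsIrredSubshift C) (hCG : C ⊆ WindowShift n G) {x : ℤ → A} (hx : x ∈ C) (i : ℤ) :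
    C ⊆ WindowShift n (commClass n G (block x i n)) := fun _ hy j =>
  ⟨reach_of_isIrredSubshift hC hCG hx hy i j, reach_of_isIrredSubshift hC hCG hy hx j i⟩

theorem isIrredComponent_commClass [Finite A] [TopologicalSpace A] [DiscreteTopology A]
    {x : ℤ → A} {i : ℤ} (hx : x ∈ WindowShift n (commClass n G (block x i n))) :
    IsIrredComponent (WindowShift n G) (WindowShift n (commClass n G (block x i n))) := by
  refine ⟨⟨x, hx⟩, isSFT_windowShift n _, windowShift_commClass_subset,
    isIrredSubshift_commClass (length_block _ _ _), fun C' _ hC' hirr hsub => ?_⟩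
  exact (subset_commClass hirr hC' (hsub hx) i).antisymm hsub

theorem IsIrredComponent.eq_commClass [Finite A] [TopologicalSpace A] [DiscreteTopology A]
    {C : Set (ℤ → A)} (hC : IsIrredComponent (WindowShift n G) C) {x : ℤ → A} (hx : x ∈ C)
    (i : ℤ) : C = WindowShift n (commClass n G (block x i n)) :=
  (hC.2.2.2.2 _ (isSFT_windowShift n _) windowShift_commClass_subset
    (isIrredSubshift_commClass (length_block _ _ _))
    (subset_commClass hC.2.2.2.1 hC.2.2.1 hx i)).symm

theorem IsIrredComponent.eq_of_reach [Finite A] [TopologicalSpace A] [DiscreteTopology A]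
    {C C' : Set (ℤ → A)} (hC : IsIrredComponent (WindowShift n G) C)
    (hC' : IsIrredComponent (WindowShift n G) C') {x y x' y' : ℤ → A} (hx : x ∈ C) (hy : y ∈ C')
    (hx' : x' ∈ C) (hy' : y' ∈ C') {i j i' j' : ℤ} (h : Reach n G (block x i n) (block y j n))
    (h' : Reach n G (block y' j' n) (block x' i' n)) : C = C' := by
  have hyx : Reach n G (block y j n) (block x i n) :=
    ((reach_of_isIrredSubshift hC'.2.2.2.1 hC'.2.2.1 hy hy' j j').trans (length_block _ _ _)
      h').trans (length_block _ _ _)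
      (reach_of_isIrredSubshift hC.2.2.2.1 hC.2.2.1 hx' hx i' i)
  rw [hC.eq_commClass hx i, hC'.eq_commClass hy j]
  ext z
  refine forall_congr' fun k => ⟨fun hz => ⟨hyx.trans (length_block _ _ _) hz.1,
    hz.2.trans (length_block _ _ _) h⟩, fun hz => ⟨h.trans (length_block _ _ _) hz.1,
    hz.2.trans (length_block _ _ _) hyx⟩⟩

end WindowShift

section Entropy

variable {A : Type*}

/-- If consecutive windows have small periods, the right ray has a single small period. -/
theorem exists_period_ray {x : ℤ → A} {m T : ℕ} (hm : 2 * T + 1 ≤ m)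
    (h : ∀ t : ℤ, ∃ q, 1 ≤ q ∧ q ≤ T ∧ ∀ s : ℕ, s + q < m → x (t + s) = x (t + s + q)) (t : ℤ) :
    ∃ q, 1 ≤ q ∧ q ≤ T ∧ ∀ s : ℕ, x (t + s) = x (t + s + q) := by
  obtain ⟨q, hq1, hqT, hq⟩ := h t
  have key : ∀ k s : ℕ, s + q < m + k → x (t + s) = x (t + s + q) := by
    intro k
    induction k with
    | zero => exact hq
    | succ k ih =>
      intro s hs
      by_cases hlt : s + q < m + k
      · exact ih s hlt
      obtain ⟨q', hq1', hqT', hq'⟩ := h (t + k + 1)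
      have e1 := hq' (m - 1 - q') (by omega)
      have e2 := ih (m + k - q' - q) (by omega)
      have e3 := hq' (m - 1 - q' - q) (by omega)
      have c1 : t + k + 1 + ((m - 1 - q' : ℕ) : ℤ) + q' = t + s + q := by omega
      have c2 : t + k + 1 + ((m - 1 - q' : ℕ) : ℤ) = t + ((m + k - q' - q : ℕ) : ℤ) + q := by omega
      have c3 : t + k + 1 + ((m - 1 - q' - q : ℕ) : ℤ) = t + ((m + k - q' - q : ℕ) : ℤ) := by omega
      have c4 : t + k + 1 + ((m - 1 - q' - q : ℕ) : ℤ) + q' = t + s := by omega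
      rw [c1, c2] at e1
      rw [c4, c3] at e3
      exact e3.symm.trans (e2.trans e1)
  exact ⟨q, hq1, hqT, fun s => key (s + q) s (by omega)⟩

theorem eq_add_factorial_of_local_periods {x : ℤ → A} {m T : ℕ} (hm : 2 * T + 1 ≤ m)
    (h : ∀ t : ℤ, ∃ q, 1 ≤ q ∧ q ≤ T ∧ ∀ s : ℕ, s + q < m → x (t + s) = x (t + s + q)) (t : ℤ) :
    x (t + T.factorial) = x t := by
  obtain ⟨q, hq1, hqT, hq⟩ := exists_period_ray hm h t
  obtain ⟨k, hk⟩ := Nat.dvd_factorial hq1 hqT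
  have key : ∀ k : ℕ, x (t + (q * k : ℕ)) = x t := by
    intro k
    induction k with
    | zero => simp
    | succ k ih =>
      rw [← ih, hq (q * k)]
      congr 1; push_cast; ring
  rw [hk, key]

theorem subEntropy_nonpos_of_period [Finite A] {C : Set (ℤ → A)} {Q : ℕ} (hQ : 0 < Q)
    (h : ∀ x ∈ C, ∀ t, x (t + Q) = x t) : subEntropy C ≤ 0 := by
  have hbd : BddBelow (Set.range fun n : ℕ => Real.log ((wordsOf C (n + 1)).ncard) / (n + 1)) :=
    ⟨0, by rintro _ ⟨n, rfl⟩; exact div_nonneg (Real.log_natCast_nonneg _) (by positivity)⟩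
  set B := Nat.card (Fin Q → A)
  have hcard : ∀ n, (wordsOf C n).ncard ≤ B := by
    intro n
    set f : (Fin Q → A) → (Fin n → A) := fun w j => w ⟨j % Q, Nat.mod_lt _ hQ⟩
    have hsub : wordsOf C n ⊆ f '' Set.univ := by
      rintro w ⟨x, hx, i, hi⟩
      refine ⟨subword x i Q, trivial, funext fun j => ?_⟩
      have key : ∀ r k : ℕ, x (i + (r + Q * k : ℕ)) = x (i + r) := by
        intro r k
        induction k with
        | zero => simp
        | succ k ih =>
          rw [← ih, ← h x hx (i + (r + Q * k : ℕ))]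
          congr 1; push_cast; ring
      rw [← hi j]
      have := key (j % Q) (j / Q)
      rw [Nat.mod_add_div] at this
      exact this.symm
    calc _ ≤ (f '' Set.univ).ncard := Set.ncard_le_ncard hsub (Set.toFinite _)
      _ ≤ (Set.univ : Set (Fin Q → A)).ncard := Set.ncard_image_le (Set.toFinite _)
      _ = B := Set.ncard_univ _
  have hlim : Tendsto (fun n : ℕ => Real.log B / ((n : ℝ) + 1)) atTop (𝓝 0) :=
    (tendsto_const_div_atTop_nhds_zero_nat (Real.log B)).comp (tendsto_add_atTop_nat 1) |>.congr
      fun n => by simp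
  refine ge_of_tendsto' hlim fun n => (ciInf_le hbd n).trans ?_
  refine div_le_div_of_nonneg_right ?_ (by positivity)
  rcases Nat.eq_zero_or_pos (wordsOf C (n + 1)).ncard with h0 | h0
  · rw [h0, Nat.cast_zero, Real.log_zero]; exact Real.log_natCast_nonneg _
  · exact Real.log_le_log (by exact_mod_cast h0) (by exact_mod_cast hcard _)

/-- A subshift of positive entropy has aperiodic windows. -/
theorem exists_aperiodic_window [Finite A] {C : Set (ℤ → A)} (hC : 0 < subEntropy C) {m T : ℕ}
    (hm : 2 * T + 1 ≤ m) : ∃ x ∈ C, ∃ t : ℤ, ∀ q, 1 ≤ q → q ≤ T →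
      ∃ s : ℕ, s + q < m ∧ x (t + s) ≠ x (t + s + q) := by
  by_contra! hcon
  exact absurd (subEntropy_nonpos_of_period (Nat.factorial_pos T) fun x hx =>
    eq_add_factorial_of_local_periods hm (hcon x hx)) (not_le.2 hC)

theorem ncard_lang_add_le [Finite A] (C : Set (ℤ → A)) (m k : ℕ) :
    (wordsOf C (m + k)).ncard ≤ (wordsOf C m).ncard * (wordsOf C k).ncard := by
  simp only [ncard_wordsOf]
  rw [← Set.ncard_prod]
  have hfin : ∀ m, {l : List A | l ∈ langOf C ∧ l.length = m}.Finite := fun m =>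
    (List.finite_length_eq A m).subset fun l hl => hl.2
  refine Set.ncard_le_ncard_of_injOn (fun l => (l.take m, l.drop m)) ?_ ?_
    ((hfin m).prod (hfin k))
  · rintro l ⟨⟨x, hx, i, h⟩, hl⟩
    rw [hl, block_add] at h
    rw [← h]
    simp only [List.take_left' (length_block x i m), List.drop_left' (length_block x i m)]
    exact ⟨⟨block_mem_langOf hx _ _, length_block _ _ _⟩,
      ⟨block_mem_langOf hx _ _, length_block _ _ _⟩⟩
  · intro l _ l' _ h
    rw [← List.take_append_drop m l, ← List.take_append_drop m l', (Prod.mk.inj h).1,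
      (Prod.mk.inj h).2]

theorem ncard_wordsOf_mul_le [Finite A] (C : Set (ℤ → A)) (m k : ℕ) :
    (wordsOf C (m * k)).ncard ≤ (wordsOf C m).ncard ^ k := by
  induction k with
  | zero =>
    rw [pow_zero, mul_zero]
    exact Set.ncard_le_one_of_subsingleton _
  | succ k ih =>
    rw [mul_add, mul_one, pow_succ]
    exact (ncard_lang_add_le C _ _).trans (Nat.mul_le_mul_right _ ih)

theorem subEntropy_pos_of_pow_le [Finite A] {C : Set (ℤ → A)} {N : ℕ} (hN : 0 < N)
    (h : ∀ k : ℕ, 2 ^ k ≤ (wordsOf C (k * N)).ncard) : 0 < subEntropy C := by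
  refine lt_of_lt_of_le (div_pos (Real.log_pos one_lt_two) (Nat.cast_pos.2 hN)) (le_ciInf ?_)
  intro n
  have h1 := (h (n + 1)).trans (ncard_wordsOf_mul_le C _ _)
  have h2 : (n + 1 : ℝ) * Real.log 2 ≤ N * Real.log ((wordsOf C (n + 1)).ncard) := by
    have := Real.log_le_log (by positivity) (show ((2 : ℝ) ^ (n + 1)) ≤
      ((wordsOf C (n + 1)).ncard : ℝ) ^ N by exact_mod_cast h1)
    rw [Real.log_pow, Real.log_pow] at this
    exact_mod_cast this
  rw [div_le_div_iff₀ (by positivity) (by positivity)]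
  linarith

/-- The point following `P₁` or `P₂` on the successive blocks of length `N`, as told by `s`. -/
def mixPoint (N : ℕ) (P₁ P₂ : ℤ → A) (s : ℤ → Bool) : ℤ → A :=
  fun t => if s (t / N) = true then P₁ t else P₂ t

theorem mixPoint_mem {n N : ℕ} {K : Set (List A)} {P₁ P₂ : ℤ → A} (hN : 0 < N)
    (h1 : P₁ ∈ WindowShift n K) (h2 : P₂ ∈ WindowShift n K) (hp1 : ∀ t, P₁ (t + N) = P₁ t)
    (hp2 : ∀ t, P₂ (t + N) = P₂ t) (h : block P₁ 0 n = block P₂ 0 n) (s : ℤ → Bool) :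
    mixPoint N P₁ P₂ s ∈ WindowShift n K := by
  have hN' : (0 : ℤ) < N := by exact_mod_cast hN
  have hper : ∀ P : ℤ → A, (∀ t, P (t + N) = P t) → ∀ k t : ℤ, P (t + k * N) = P t := by
    intro P hP k t
    have : Function.Periodic P (N : ℤ) := hP
    simpa using this.int_mul k t
  have hagree : ∀ q t : ℤ, q * N ≤ t → t < q * N + n → P₁ t = P₂ t := by
    intro q t ht1 ht2
    have := block_eq_block_iff.1 h (t - q * N).toNat (by omega)
    rw [Int.toNat_of_nonneg (by omega), zero_add] at this
    rw [← hper P₁ hp1 q, ← hper P₂ hp2 q] at this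
    simpa using this
  intro i
  set q := i / (N : ℤ) with hq
  have hq1 : q * N ≤ i := Int.ediv_mul_le i hN'.ne'
  have hq2 : i < (q + 1) * N := Int.lt_ediv_add_one_mul_self i hN'
  set P := if s q = true then P₁ else P₂ with hP
  have hPK : P ∈ WindowShift n K := by rw [hP]; split_ifs <;> assumption
  have : block (mixPoint N P₁ P₂ s) i n = block P i n := by
    rw [block_eq_block_iff]
    intro k hk
    by_cases hlt : i + k < (q + 1) * N
    · have : (i + k) / (N : ℤ) = q :=
        (Int.ediv_eq_iff_of_pos hN').2 ⟨by linarith, by linarith⟩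
      simp only [mixPoint, this, hP]
      split_ifs <;> rfl
    · have := hagree (q + 1) (i + k) (by omega) (by omega)
      simp only [mixPoint, hP]
      split_ifs <;> first | rfl | exact this | exact this.symm
  rw [this]
  exact hPK i

theorem subEntropy_windowShift_pos [Finite A] {n N : ℕ} {K : Set (List A)} {P₁ P₂ : ℤ → A}
    (hN : 0 < N) (h1 : P₁ ∈ WindowShift n K) (h2 : P₂ ∈ WindowShift n K)
    (hp1 : ∀ t, P₁ (t + N) = P₁ t) (hp2 : ∀ t, P₂ (t + N) = P₂ t) (h : block P₁ 0 n = block P₂ 0 n) (hne : P₁ ≠ P₂) :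
    0 < subEntropy (WindowShift n K) := by
  have hN' : (0 : ℤ) < N := by exact_mod_cast hN
  have hper : ∀ P : ℤ → A, (∀ t, P (t + N) = P t) → ∀ k t : ℤ, P (t + k * N) = P t := by
    intro P hP k t
    have : Function.Periodic P (N : ℤ) := hP
    simpa using this.int_mul k t
  obtain ⟨r, hr0, hrN, hr⟩ : ∃ r : ℤ, 0 ≤ r ∧ r < N ∧ P₁ r ≠ P₂ r := by
    obtain ⟨t, ht⟩ := Function.ne_iff.1 hne
    refine ⟨t % N, Int.emod_nonneg _ hN'.ne', Int.emod_lt_of_pos _ hN', ?_⟩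
    rw [← hper P₁ hp1 (t / N), ← hper P₂ hp2 (t / N), Int.emod_add_ediv_mul]
    exact ht
  refine subEntropy_pos_of_pow_le hN fun k => ?_
  set f : (Fin k → Bool) → (Fin (k * N) → A) := fun s => subword (mixPoint N P₁ P₂
    fun j => if hj : j.toNat < k then s ⟨j.toNat, hj⟩ else true) 0 (k * N)
  have hf : Function.Injective f := by
    intro s s' hss
    funext j
    have hlt : j * N + r.toNat < k * N := by
      have : ((j : ℕ) + 1) * N ≤ k * N := Nat.mul_le_mul_right _ j.2
      have : r.toNat < N := by omega
      nlinarith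
    have key := congrFun hss ⟨j * N + r.toNat, hlt⟩
    have hdiv : ((j * N + r.toNat : ℕ) : ℤ) / N = j := by
      rw [Nat.cast_add, Int.toNat_of_nonneg hr0]
      exact (Int.ediv_eq_iff_of_pos hN').2 ⟨by push_cast; linarith, by push_cast; linarith⟩
    have hval : ∀ P : ℤ → A, (∀ t, P (t + N) = P t) → P ((j * N + r.toNat : ℕ) : ℤ) = P r := by
      intro P hP
      rw [← hper P hP j r, Nat.cast_add, Int.toNat_of_nonneg hr0]
      congr 1; push_cast; ring
    simp only [f, subword, mixPoint, zero_add, hdiv, Int.toNat_natCast, j.2, dif_pos, hval _ hp1,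
      hval _ hp2] at key
    cases hs : s j <;> cases hs' : s' j <;> simp_all
  calc 2 ^ k = (f '' Set.univ).ncard := by
        rw [Set.ncard_image_of_injective _ hf, Set.ncard_univ]; simp
    _ ≤ _ := by
        refine Set.ncard_le_ncard ?_ (Set.toFinite _)
        rintro _ ⟨s, -, rfl⟩
        exact ⟨_, mixPoint_mem hN h1 h2 hp1 hp2 h _, 0, fun j => rfl⟩

end Entropy

section Uniqueness

variable {A : Type*}

/-- The word of length `n` given by a list, padded by `a₀`. -/
def toWord (a₀ : A) (n : ℕ) (l : List A) : Fin n → A := fun j => (l[(j : ℕ)]?).getD a₀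

theorem separatesWords_toWord (a₀ : A) (n : ℕ) : SeparatesWords n (toWord a₀ n) := by
  intro w w' hw hw' h
  refine List.ext_getElem (by omega) fun j h1 h2 => ?_
  have := congrFun h ⟨j, by omega⟩
  simpa [toWord, h1, h2] using this

theorem toWord_block (a₀ : A) (n : ℕ) (x : ℤ → A) (i : ℤ) :
    toWord a₀ n (block x i n) = subword x i n := by
  funext j
  rw [toWord, getElem?_block x i j.2]
  rfl

/-- The words of length `n` of `X` allowed by `ω`. -/
def openWords (X : Set (ℤ → A)) (a₀ : A) {n : ℕ} (ω : (Fin n → A) → Bool) : Set (List A) :=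
  {l | l ∈ langOf X ∧ ω (toWord a₀ n l) = true}

theorem xRes_eq_windowShift {X : Set (ℤ → A)} {M n : ℕ}
    (hM : ∀ m ≥ M, ∀ x : ℤ → A, (∀ i, block x i m ∈ langOf X) → x ∈ X) (hn : M ≤ n) (a₀ : A)
    (ω : (Fin n → A) → Bool) : XRes X ω = WindowShift n (openWords X a₀ ω) := by
  ext x
  constructor
  · rintro ⟨hx, h⟩ i
    exact ⟨block_mem_langOf hx i n, by rw [toWord_block]; exact h i⟩
  · intro h
    exact ⟨hM n hn x fun i => (h i).1, fun i => by rw [← toWord_block a₀]; exact (h i).2⟩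

theorem aperiodicFrom_block {x : ℤ → A} {t : ℤ} {T n : ℕ}
    (h : ∀ q, 1 ≤ q → q ≤ T → ∃ s : ℕ, s + q < n - T ∧ x (t + s) ≠ x (t + s + q)) :
    AperiodicFrom T n (block x (t - T) n) := by
  intro q hq1 hqT
  obtain ⟨s, hs, hne⟩ := h q hq1 hqT
  refine ⟨T + s, by omega, by omega, ?_⟩
  rw [getElem?_block _ _ (by omega), getElem?_block _ _ (by omega)]
  intro heq
  apply hne
  have := Option.some_inj.1 heq
  rw [show t - T + ((T + s : ℕ) : ℤ) = t + s by push_cast; ring,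
    show t - T + ((T + s + q : ℕ) : ℤ) = t + s + q by push_cast; ring] at this
  exact this

theorem aperiodicFrom_reverse_block {x : ℤ → A} {t : ℤ} {T n : ℕ}
    (h : ∀ q, 1 ≤ q → q ≤ T → ∃ s : ℕ, s + q < n - T ∧ x (t + s) ≠ x (t + s + q)) :
    AperiodicFrom T n (block x t n).reverse := by
  intro q hq1 hqT
  obtain ⟨s, hs, hne⟩ := h q hq1 hqT
  refine ⟨n - 1 - (s + q), by omega, by omega, ?_⟩
  rw [List.getElem?_reverse (by rw [length_block]; omega),
    List.getElem?_reverse (by rw [length_block]; omega), length_block,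
    getElem?_block _ _ (by omega), getElem?_block _ _ (by omega)]
  intro heq
  apply hne
  have := Option.some_inj.1 heq
  rw [show t + ((n - 1 - (n - 1 - (s + q)) : ℕ) : ℤ) = t + s + q by omega,
    show t + ((n - 1 - (n - 1 - (s + q) + q) : ℕ) : ℤ) = t + s by omega] at this
  exact this.symm

theorem openAlong_block {E : Type*} {e : List A → E} {ω : E → Bool} {x : ℤ → A} {n : ℕ}
    (h : ∀ i, ω (e (block x i n)) = true) (i : ℤ) (m : ℕ) :
    OpenAlong n e ω (block x i n) (block x (i + n) m) := by
  intro c hc _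
  obtain ⟨d, hd⟩ := hc
  have hlen : c.length + d.length = m := by simpa using congrArg List.length hd
  have hc : block x (i + n) c.length = c := by
    subst hlen
    rw [block_add] at hd
    exact (List.append_inj hd (by simp)).1.symm
  have : block x i n ++ c = block x i c.length ++ block x (i + c.length) n := by
    rw [← block_add, Nat.add_comm, block_add, hc]
  rw [this, lastWord, List.length_append, length_block, length_block, Nat.add_sub_cancel,
    List.drop_left' (length_block _ _ _)]
  exact h _

theorem openAlong_reverse_block {E : Type*} {e : List A → E} {ω : E → Bool} {x : ℤ → A} {n : ℕ}
    (h : ∀ i, ω (e (block x i n)) = true) (i : ℤ) (m : ℕ) :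
    OpenAlong n (fun l => e l.reverse) ω (block x (i + m) n).reverse (block x i m).reverse := by
  intro c hc _
  obtain ⟨d, hd⟩ : c.reverse <:+ block x i m := by
    rw [← List.reverse_prefix, List.reverse_reverse]; exact hc
  have hlen : d.length + c.length = m := by simpa using congrArg List.length hd
  subst hlen
  have hc : block x (i + d.length) c.length = c.reverse := by
    rw [block_add] at hd
    exact (List.append_inj hd (by simp)).2.symm
  have : c.reverse ++ block x (i + (d.length + c.length : ℕ)) n =
      block x (i + d.length) n ++ block x (i + d.length + n) c.length := by
    rw [← block_add, Nat.add_comm n, block_add, hc]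
    push_cast; rw [add_assoc]
  have h2 : (block x (i + (d.length + c.length : ℕ)) n).reverse ++ c =
      (block x (i + d.length + n) c.length).reverse ++ (block x (i + d.length) n).reverse := by
    rw [← List.reverse_append, ← this]; simp
  rw [h2, lastWord, List.length_append, List.length_reverse, List.length_reverse, length_block,
    length_block, Nat.add_sub_cancel, List.drop_left' (by simp)]
  simpa using h _

/-- If any two open aperiodic words are connected, there is at most one component of positive
entropy. -/
theorem IsIrredComponent.eq_of_connects [Finite A] [TopologicalSpace A] [DiscreteTopology A]
    {X : Set (ℤ → A)} {M : ℕ} (hL : IsLang (langOf X) M) {a₀ : A} {n T m : ℕ}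
    {ω : (Fin n → A) → Bool} (hX : WindowShift n (openWords X a₀ ω) ⊆ X) (hT : 3 * T + 1 ≤ n)
    (h : Connects (langOf X) n T m (toWord a₀ n) ω) {C C' : Set (ℤ → A)}
    (hC : IsIrredComponent (WindowShift n (openWords X a₀ ω)) C) (hpos : 0 < subEntropy C)
    (hC' : IsIrredComponent (WindowShift n (openWords X a₀ ω)) C')
    (hpos' : 0 < subEntropy C') : C = C' := by
  have key : ∀ C C' : Set (ℤ → A), IsIrredComponent (WindowShift n (openWords X a₀ ω)) C →
      0 < subEntropy C → IsIrredComponent (WindowShift n (openWords X a₀ ω)) C' →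
      0 < subEntropy C' → ∃ x ∈ C, ∃ y ∈ C', ∃ i j : ℤ,
        Reach n (openWords X a₀ ω) (block x i n) (block y j n) := by
    intro C C' hC hpos hC' hpos'
    obtain ⟨x, hx, t, ht⟩ := exists_aperiodic_window (T := T) (m := n - T) hpos (by omega)
    obtain ⟨y, hy, t', ht'⟩ := exists_aperiodic_window (T := T) (m := n - T) hpos' (by omega)
    have hxW := hC.2.2.1 hx
    have hyW := hC'.2.2.1 hy
    have hlang : ∀ z ∈ WindowShift n (openWords X a₀ ω), ∀ (i : ℤ) (k : ℕ),
        block z i k ∈ langOf X := fun z hz i k => block_mem_langOf (hX hz) i k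
    refine ⟨x, hx, y, hy, t - T, t', ?_⟩
    have hsplit : t' = t' - m + m := by ring
    obtain ⟨V, hVL, hV1, hV2, hV⟩ := h (block x (t - T) n) (block x (t - T + n) m)
      (block y (t' - m) m) (block y t' n) (by simp) (by simp) (by simp) (by simp)
      (by rw [← block_add]; exact hlang x hxW _ _)
      (by
        have := hlang y hyW (t' - m) (m + n)
        rwa [block_add, ← hsplit] at this)
      (aperiodicFrom_block ht) (aperiodicFrom_reverse_block ht')
      (openAlong_block (fun i => (hxW i).2) _ _)
      (by
        have := openAlong_reverse_block (e := toWord a₀ n) (fun i => (hyW i).2) (t' - m) m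
        rwa [← hsplit] at this)
      (hxW _).2 (hyW _).2
    exact ⟨V, hV1, hV2, fun w hw hwn => ⟨hL.infix_mem hVL hw, hV w hw hwn⟩⟩
  obtain ⟨x, hx, y, hy, i, j, h1⟩ := key C C' hC hpos hC' hpos'
  obtain ⟨y', hy', x', hx', j', i', h2⟩ := key C' C hC' hpos' hC hpos
  exact hC.eq_of_reach hC' hx hy hx' hy' h1 h2

end Uniqueness

section Loops

variable {A : Type*}

theorem block_infix_block (x : ℤ → A) {i s : ℤ} {m K : ℕ} (h1 : s ≤ i) (h2 : i + m ≤ s + K) :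
    block x i m <:+: block x s K := by
  refine ⟨block x s (i - s).toNat, block x (i + m) (s + K - (i + m)).toNat, ?_⟩
  have e1 : K = (i - s).toNat + m + (s + K - (i + m)).toNat := by omega
  have e2 : s + ((i - s).toNat : ℤ) = i := by omega
  have e3 : s + (((i - s).toNat + m : ℕ) : ℤ) = i + m := by omega
  rw [e1, block_add, block_add, e2, e3, ← e1]

theorem exists_straddling {O : Set ℤ} {Q : ℤ → ℤ → Prop} (hlow : ∀ t, ∃ s ∈ O, s ≤ t)
    (hstep : ∀ s ∈ O, ∃ s' ∈ O, s < s' ∧ Q s s') (t : ℤ) :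
    ∃ s ∈ O, ∃ s' ∈ O, s ≤ t ∧ t < s' ∧ Q s s' := by
  obtain ⟨s₀, hs₀, hs₀t⟩ := hlow t
  obtain ⟨s, ⟨hs, hst⟩, hmax⟩ := Int.exists_greatest_of_bdd (P := fun s => s ∈ O ∧ s ≤ t)
    ⟨t, fun z hz => hz.2⟩ ⟨s₀, hs₀, hs₀t⟩
  obtain ⟨s', hs', hlt, hQ⟩ := hstep s hs
  refine ⟨s, hs, s', hs', hst, ?_, hQ⟩
  by_contra hcon
  exact absurd (hmax s' ⟨hs', not_lt.1 hcon⟩) (not_le.2 hlt)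

theorem mem_of_cover {X : Set (ℤ → A)} {M : ℕ} (hL : IsLang (langOf X) M)
    (hM : ∀ m ≥ M, ∀ x : ℤ → A, (∀ i, block x i m ∈ langOf X) → x ∈ X) {x : ℤ → A} {O : Set ℤ}
    (hlow : ∀ t, ∃ s ∈ O, s ≤ t)
    (hstep : ∀ s ∈ O, ∃ s' ∈ O, s < s' ∧ block x s ((s' - s).toNat + M) ∈ langOf X) : x ∈ X := by
  refine hM M le_rfl x fun i => ?_
  obtain ⟨s, -, s', -, h1, h2, h3⟩ := exists_straddling hlow hstep i
  exact hL.infix_mem h3 (block_infix_block x h1 (by omega))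

/-- The periodic point `…uuu…`. -/
def perPoint (a₀ : A) (u : List A) : ℤ → A := fun t => (u[(t % u.length).toNat]?).getD a₀

theorem perPoint_add (a₀ : A) (u : List A) (t : ℤ) :
    perPoint a₀ u (t + u.length) = perPoint a₀ u t := by
  simp [perPoint]

theorem block_perPoint (a₀ : A) (u : List A) (k : ℤ) :
    block (perPoint a₀ u) (k * u.length) u.length = u := by
  rw [block_eq_iff rfl]
  intro j hj
  have : (k * u.length + j) % (u.length : ℤ) = j := by
    rw [add_comm, Int.add_mul_emod_self_right, Int.emod_eq_of_lt (by omega) (by omega)]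
  simp [perPoint, this, hj]

theorem block_eq_of_append {x : ℤ → A} {i : ℤ} {u v : List A} {m : ℕ} (hm : (u ++ v).length = m)
    (h : block x i m = u ++ v) : block x i u.length = u := by
  subst hm; exact (block_append_iff.1 h).1

/-- A loop at `v` gives a periodic point. -/
theorem exists_periodic_of_loop {X : Set (ℤ → A)} {M : ℕ} (hL : IsLang (langOf X) M)
    (hM : ∀ m ≥ M, ∀ x : ℤ → A, (∀ i, block x i m ∈ langOf X) → x ∈ X) {v g : List A}
    (hv : M ≤ v.length) (hv0 : v ≠ []) (h : v ++ g ++ v ∈ langOf X) :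
    ∃ x ∈ X, ∀ t, x (t + (v ++ g).length) = x t := by
  obtain ⟨a₀, v', rfl⟩ := List.exists_cons_of_ne_nil hv0
  set v := a₀ :: v'
  have hvl : 1 ≤ v.length := by simp [v]
  set u := v ++ g with hu
  have hul : u.length = v.length + g.length := by simp [hu]
  refine ⟨perPoint a₀ u, mem_of_cover hL hM (O := Set.range fun k : ℤ => k * u.length) ?_ ?_,
    perPoint_add a₀ u⟩
  · intro t
    exact ⟨_, ⟨t / u.length, rfl⟩, Int.ediv_mul_le t (by omega)⟩
  · rintro _ ⟨k, rfl⟩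
    refine ⟨_, ⟨k + 1, rfl⟩, ?_, ?_⟩
    · simp only [add_mul]; omega
    · have e1 := block_perPoint a₀ u k
      have e2 := block_eq_of_append rfl (block_perPoint a₀ u (k + 1))
      have e3 : ((k + 1) * (u.length : ℤ) - k * u.length).toNat = u.length := by
        rw [add_mul, one_mul, add_sub_cancel_left, Int.toNat_natCast]
      simp only [e3]
      refine hL.infix_mem h ?_
      have : u ++ v = block (perPoint a₀ u) (k * u.length) (u.length + v.length) := by
        rw [block_add, e1]
        rw [add_mul, one_mul] at e2
        rw [e2]
      rw [this]
      exact block_infix_block _ le_rfl (by push_cast; omega)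

/-- The lengths of loops at `v`. -/
def loopLengths (L : Set (List A)) (v : List A) : Set ℕ :=
  {N | ∃ g : List A, (v ++ g).length = N ∧ v ++ g ++ v ∈ L}

theorem IsLang.glue' {L : Set (List A)} {M : ℕ} (hL : IsLang L M) {u v w : List A}
    (hu : u ++ v ∈ L) (hw : v ++ w ∈ L) (hv : M ≤ v.length) : u ++ (v ++ w) ∈ L := by
  rw [← List.append_assoc]; exact hL.glue hu hw hv

theorem add_mem_loopLengths {L : Set (List A)} {M : ℕ} (hL : IsLang L M) {v : List A}
    (hv : M ≤ v.length) {N N' : ℕ} (h : N ∈ loopLengths L v) (h' : N' ∈ loopLengths L v) :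
    N + N' ∈ loopLengths L v := by
  obtain ⟨g, rfl, hg⟩ := h
  obtain ⟨g', rfl, hg'⟩ := h'
  refine ⟨g ++ v ++ g', by simp; omega, ?_⟩
  have := hL.glue' hg (by rwa [List.append_assoc] at hg') hv
  simpa using this

theorem mem_loopLengths_of_mem_closure {L : Set (List A)} {M : ℕ} (hL : IsLang L M) {v : List A}
    (hv : M ≤ v.length) {N : ℕ} (h : N ∈ AddSubmonoid.closure (loopLengths L v)) :
    N = 0 ∨ N ∈ loopLengths L v := by
  induction h using AddSubmonoid.closure_induction with
  | mem x hx => exact Or.inr hx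
  | zero => exact Or.inl rfl
  | add x y _ _ hx hy =>
    rcases hx with rfl | hx
    · simpa using hy
    rcases hy with rfl | hy
    · simpa using Or.inr hx
    · exact Or.inr (add_mem_loopLengths hL hv hx hy)

theorem setGcd_loopLengths_dvd {X : Set (ℤ → A)} {M : ℕ} (hL : IsLang (langOf X) M)
    {v : List A} (hv : v ∈ langOf X) {k : ℕ} (hk : k ∈ periodSet X) :
    Nat.setGcd (loopLengths (langOf X) v) ∣ k := by
  obtain ⟨-, x, hx, hxk⟩ := hk
  rw [shiftMap_iterate] at hxk
  have hper : block x k M = block x 0 M := by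
    rw [block_eq_block_iff]
    intro j _
    have := congrFun hxk j
    simpa [add_comm] using this
  obtain ⟨h, hh⟩ := hL.irred hv (block_mem_langOf hx 0 M)
  obtain ⟨h', hh'⟩ := hL.irred (block_mem_langOf hx 0 M) hv
  rw [List.append_assoc] at hh'
  have e1 := hL.glue' hh hh' (by simp)
  have e2 := hL.glue' (u := block x 0 k) (v := block x 0 M) (by
    have := block_mem_langOf hx 0 (k + M)
    rwa [block_add, zero_add, hper] at this) hh' (by simp)
  have e3 : block x 0 M ++ block x M k = block x 0 k ++ block x 0 M := by
    have e := block_add x 0 M k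
    rw [add_comm M k, block_add, zero_add, zero_add, hper] at e
    exact e.symm
  rw [← List.append_assoc, ← e3, List.append_assoc] at e2
  have e4 := hL.glue' hh e2 (by simp)
  have m1 : (v ++ (h ++ block x 0 M ++ h')).length ∈ loopLengths (langOf X) v :=
    ⟨_, rfl, by simpa using e1⟩
  have m2 : (v ++ (h ++ block x 0 M ++ block x M k ++ h')).length ∈ loopLengths (langOf X) v :=
    ⟨_, rfl, by simpa using e4⟩
  have d1 := Nat.setGcd_dvd_of_mem m1
  have d2 := Nat.setGcd_dvd_of_mem m2
  rw [show (v ++ (h ++ block x 0 M ++ block x M k ++ h')).length =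
    (v ++ (h ++ block x 0 M ++ h')).length + k by simp; omega] at d2
  exact (Nat.dvd_add_right d1).1 d2

/-- Every long word has two loops of bounded lengths which differ by the period. -/
theorem exists_loops [Finite A] {X : Set (ℤ → A)} {M : ℕ} (hL : IsLang (langOf X) M)
    (hM : ∀ m ≥ M, ∀ x : ℤ → A, (∀ i, block x i m ∈ langOf X) → x ∈ X) {p : ℕ}
    (hp : IsGCDOf (periodSet X) p) :
    0 < p ∧ ∃ L₁ : ℕ, ∀ b ∈ langOf X, M ≤ b.length → ∃ g₁ g₂ : List A,
      g₂.length = g₁.length + p ∧ g₂.length ≤ L₁ ∧ b ++ g₁ ++ b ∈ langOf X ∧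
      b ++ g₂ ++ b ∈ langOf X := by
  obtain ⟨L₀, hL₀⟩ := hL.exists_bounded_glue
  obtain ⟨u, hu, hu0⟩ := hL.exists_nonempty
  obtain ⟨w, hw, hv⟩ := hL.exists_append hu M
  set v := u ++ w with hvdef
  have hv0 : v ≠ [] := by simp [hvdef, hu0]
  have hvM : M ≤ v.length := by rw [hvdef, List.length_append]; omega
  have hvpos : 0 < v.length := List.length_pos_iff.2 hv0
  obtain ⟨g, hg⟩ := hL.irred hv hv
  have hmem : (v ++ g).length ∈ loopLengths (langOf X) v := ⟨g, rfl, hg⟩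
  obtain ⟨x, hx, hxp⟩ := exists_periodic_of_loop hL hM hvM hv0 hg
  have hpd : p ∣ (v ++ g).length := hp.1 _ ⟨by rw [List.length_append]; omega, x, hx, by
    rw [shiftMap_iterate]; exact funext hxp⟩
  have hp0 : 0 < p := Nat.pos_of_dvd_of_pos hpd (by rw [List.length_append]; omega)
  refine ⟨hp0, ?_⟩
  have hdp := hp.2 _ fun k hk => setGcd_loopLengths_dvd hL hv hk
  obtain ⟨r, hr0, hr1, hr2⟩ : ∃ r, 0 < r ∧ r ∈ loopLengths (langOf X) v ∧
      r + p ∈ loopLengths (langOf X) v := by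
    obtain ⟨n₀, hn₀⟩ := Nat.exists_mem_closure_of_ge (loopLengths (langOf X) v)
    have hd := Nat.pos_of_dvd_of_pos hdp hp0
    set d := Nat.setGcd (loopLengths (langOf X) v)
    have hge : n₀ + 1 ≤ d * (n₀ + 1) := Nat.le_mul_of_pos_left _ hd
    have a1 := mem_loopLengths_of_mem_closure hL hvM (hn₀ (d * (n₀ + 1)) (by omega) ⟨_, rfl⟩)
    have a2 := mem_loopLengths_of_mem_closure hL hvM (hn₀ (d * (n₀ + 1) + p) (by omega)
      (dvd_add ⟨_, rfl⟩ hdp))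
    exact ⟨_, by omega, a1.resolve_left (by omega), a2.resolve_left (by omega)⟩
  obtain ⟨f₁, hf₁, hvf₁⟩ := hr1
  obtain ⟨f₂, hf₂, hvf₂⟩ := hr2
  refine ⟨2 * L₀ + v.length + (r + p), fun b hb hbM => ?_⟩
  obtain ⟨h, hhl, hh⟩ := hL₀ b hb v hv
  obtain ⟨h', hhl', hh'⟩ := hL₀ v hv b hb
  rw [List.append_assoc] at hh'
  have key : ∀ f, v ++ f ++ v ∈ langOf X → b ++ (h ++ v ++ f ++ v ++ h') ++ b ∈ langOf X := by
    intro f hf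
    have e1 := hL.glue' hf hh' hvM
    rw [List.append_assoc] at e1
    simpa using hL.glue' hh e1 hvM
  refine ⟨h ++ v ++ f₁ ++ v ++ h', h ++ v ++ f₂ ++ v ++ h', ?_, ?_, key _ hvf₁, key _ hvf₂⟩ <;>
  · simp only [List.length_append] at hf₁ hf₂ ⊢
    omega

end Loops

section LoopPoints

variable {A : Type*}

/-- Two loops at `b` whose lengths differ by `p` give two periodic points, the second of which
follows the first for a long time and sees `b` in all long windows. -/
theorem exists_loop_points {X : Set (ℤ → A)} {M : ℕ} (hL : IsLang (langOf X) M)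
    (hM : ∀ m ≥ M, ∀ x : ℤ → A, (∀ i, block x i m ∈ langOf X) → x ∈ X) {b g₁ g₂ : List A} {p : ℕ}
    (hbM : M ≤ b.length) (hb0 : b ≠ []) (h₁ : b ++ g₁ ++ b ∈ langOf X)
    (h₂ : b ++ g₂ ++ b ∈ langOf X) (hlen : g₂.length = g₁.length + p)
    (hper : ∃ j, j + p < b.length ∧ b[j]? ≠ b[j + p]?) {κ m N : ℕ} (hκ : 0 < κ)
    (hm : (b ++ g₁).length = m) (hN : N = κ * m + m + p) :
    ∃ P₁ P₂ : ℤ → A, P₂ ∈ X ∧ (∀ t, P₁ (t + m) = P₁ t) ∧ (∀ t, P₂ (t + N) = P₂ t) ∧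
      (∀ t : ℤ, 0 ≤ t → t < κ * m → P₁ t = P₂ t) ∧
      (∀ t : ℤ, ∃ s, t < s ∧ s ≤ t + (b ++ g₂).length ∧ block P₂ s b.length = b) ∧ P₁ ≠ P₂ := by
  obtain ⟨a₀, -, -⟩ := List.exists_cons_of_ne_nil hb0
  have hbpos : 0 < b.length := List.length_pos_iff.2 hb0
  have hbm : b.length ≤ m := by rw [← hm]; simp
  have hm2 : (b ++ g₂).length = m + p := by
    rw [← hm, List.length_append, List.length_append]; omega
  have hκm : m ≤ κ * m := Nat.le_mul_of_pos_left _ hκ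
  set P₁ := perPoint a₀ (b ++ g₁) with hP₁
  set τ := block P₁ 0 (κ * m) ++ (b ++ g₂) with hτ
  have hτN : τ.length = N := by
    rw [hτ, List.length_append, length_block, hm2]; omega
  set P₂ := perPoint a₀ τ with hP₂
  have hb1 : ∀ k : ℤ, block P₁ (k * m) m = b ++ g₁ := by
    intro k
    have := block_perPoint a₀ (b ++ g₁) k
    rwa [hm] at this
  have hb2 : ∀ k : ℤ, block P₂ (k * N) (κ * m) = block P₁ 0 (κ * m) ∧
      block P₂ (k * N + (κ * m : ℕ)) (m + p) = b ++ g₂ := by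
    intro k
    have := block_perPoint a₀ τ k
    rw [← hP₂, hτN] at this
    have h := block_append_iff (x := P₂) (i := k * N) (u := block P₁ 0 (κ * m)) (v := b ++ g₂)
    rw [← hτ, hτN, length_block, hm2] at h
    exact h.1 this
  have hP21 : ∀ (k : ℤ) (j : ℕ), j < κ * m → P₂ (k * N + j) = P₁ j := by
    intro k j hj
    have := block_eq_block_iff.1 (hb2 k).1 j hj
    rwa [zero_add] at this
  have hblk : ∀ (k : ℤ) (i : ℕ), i < κ → block P₂ (k * N + (i * m : ℕ)) m = b ++ g₁ := by
    intro k i hi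
    rw [← hb1 i, block_eq_block_iff]
    intro j hj
    have : i * m + j < κ * m := by
      have : (i + 1) * m ≤ κ * m := Nat.mul_le_mul_right _ hi
      nlinarith
    have := hP21 k (i * m + j) this
    push_cast at this ⊢
    rw [add_assoc, this]
  set O : Set ℤ := {s | ∃ (k : ℤ) (i : ℕ), i ≤ κ ∧ s = k * N + (i * m : ℕ)} with hO
  have hnext : ∀ s ∈ O, ∃ s' ∈ O, ∃ g, (g = g₁ ∨ g = g₂) ∧ s' = s + (b ++ g).length ∧
      block P₂ s (b ++ g).length = b ++ g := by
    rintro s ⟨k, i, hi, rfl⟩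
    rcases hi.lt_or_eq with hi | rfl
    · refine ⟨_, ⟨k, i + 1, hi, rfl⟩, g₁, Or.inl rfl, ?_, ?_⟩
      · rw [hm]; push_cast; ring
      · rw [hm]; exact hblk k i hi
    · refine ⟨_, ⟨k + 1, 0, by omega, rfl⟩, g₂, Or.inr rfl, ?_, ?_⟩
      · rw [hm2, hN]; push_cast; ring
      · rw [hm2]; exact (hb2 k).2
  have hbO : ∀ s ∈ O, block P₂ s b.length = b := by
    intro s hs
    obtain ⟨-, -, g, -, -, hg⟩ := hnext s hs
    exact block_eq_of_append rfl hg
  have hlow : ∀ t, ∃ s ∈ O, s ≤ t := fun t =>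
    ⟨t / N * N, ⟨t / N, 0, by omega, by simp⟩, Int.ediv_mul_le t (by omega)⟩
  refine ⟨P₁, P₂, ?_, ?_, ?_, ?_, ?_, ?_⟩
  · refine mem_of_cover hL hM hlow fun s hs => ?_
    obtain ⟨s', hs', g, hg, rfl, hblock⟩ := hnext s hs
    refine ⟨_, hs', ?_, ?_⟩
    · rw [List.length_append]; omega
    · rw [add_sub_cancel_left, Int.toNat_natCast]
      have hmem : b ++ g ++ b ∈ langOf X := by rcases hg with rfl | rfl <;> assumption
      refine hL.infix_mem hmem ?_
      have : b ++ g ++ b = block P₂ s ((b ++ g).length + b.length) := by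
        rw [block_add, hblock, hbO _ hs']
      rw [this]
      exact block_infix_block _ le_rfl (by push_cast; omega)
  · intro t
    have := perPoint_add a₀ (b ++ g₁) t
    rwa [hm] at this
  · intro t
    have := perPoint_add a₀ τ t
    rwa [hτN] at this
  · intro t ht0 ht
    lift t to ℕ using ht0
    have := hP21 0 t (by exact_mod_cast ht)
    rw [zero_mul, zero_add] at this
    exact this.symm
  · intro t
    obtain ⟨s, -, s', hs', h1, h2, h3⟩ := exists_straddling
      (Q := fun s s' => s' ≤ s + (b ++ g₂).length) hlow (fun s hs => by
        obtain ⟨s', hs', g, hg, rfl, -⟩ := hnext s hs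
        refine ⟨_, hs', ?_, ?_⟩
        · rw [List.length_append]; omega
        · rcases hg with rfl | rfl
          · rw [hm, hm2]; push_cast; omega
          · rfl) t
    exact ⟨s', h2, by omega, hbO s' hs'⟩
  · intro heq
    obtain ⟨j, hj, hne⟩ := hper
    apply hne
    have hp1 : Function.Periodic P₁ (m : ℤ) := fun t => by
      have := perPoint_add a₀ (b ++ g₁) t
      rwa [hm] at this
    have hp2 : Function.Periodic P₁ (N : ℤ) := fun t => by
      rw [heq]
      have := perPoint_add a₀ τ t
      rwa [hτN] at this
    have hpp : Function.Periodic P₁ (p : ℤ) := by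
      have := hp2.sub_period ((hp1.nat_mul κ).add_period hp1)
      have e : (N : ℤ) - (κ * m + m) = p := by rw [hN]; push_cast; ring
      rwa [e] at this
    have hbb : block P₁ 0 b.length = b := by
      have := block_eq_of_append hm (by simpa using hb1 0)
      exact this
    rw [← hbb, getElem?_block _ _ (by omega), getElem?_block _ _ (by omega)]
    congr 1
    have := hpp (0 + j)
    rw [← this]
    congr 1; push_cast; ring

/-- Two such periodic points with open windows give a component of positive entropy with the right
period. -/
theorem exists_component_of_loop_points [Finite A] [TopologicalSpace A] [DiscreteTopology A]
    {X : Set (ℤ → A)} {n p κ m N : ℕ} {G : Set (List A)} (hGX : WindowShift n G ⊆ X)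
    (hp : IsGCDOf (periodSet X) p) {P₁ P₂ : ℤ → A} (hm0 : 0 < m) (hn : n + m ≤ κ * m)
    (hN : N = κ * m + m + p) (hP₂ : P₂ ∈ WindowShift n G) (h1 : ∀ t, P₁ (t + m) = P₁ t)
    (h2 : ∀ t, P₂ (t + N) = P₂ t) (h12 : ∀ t : ℤ, 0 ≤ t → t < κ * m → P₁ t = P₂ t)
    (hne : P₁ ≠ P₂) :
    ∃ C, IsIrredComponent (WindowShift n G) C ∧ 0 < subEntropy C ∧ IsGCDOf (periodSet C) p := by
  have hp1 : Function.Periodic P₁ (m : ℤ) := h1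
  have hp2 : Function.Periodic P₂ (N : ℤ) := h2
  have hP₁ : P₁ ∈ WindowShift n G := by
    intro i
    have : block P₁ i n = block P₂ (i % m) n := by
      rw [block_eq_block_iff]
      intro j hj
      have hi0 := Int.emod_nonneg i (b := (m : ℤ)) (by omega)
      have him := Int.emod_lt_of_pos i (b := (m : ℤ)) (by omega)
      have hn' : (n : ℤ) + m ≤ κ * m := by exact_mod_cast hn
      rw [← h12 _ (by omega) (by omega), ← (hp1.int_mul (i / m)) (i % m + j)]
      congr 1
      have := Int.emod_add_ediv_mul i m
      simp only [Int.cast_id]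
      omega
    rw [this]
    exact hP₂ _
  have hreach : ∀ (P : ℤ → A) (q : ℕ), 0 < q → Function.Periodic P (q : ℤ) →
      P ∈ WindowShift n G → ∀ i j, Reach n G (block P i n) (block P j n) := by
    intro P q hq hPq hPG i j
    have : block P j n = block P (j + (i - j).toNat * q) n := by
      rw [block_eq_block_iff]
      intro k _
      rw [← hPq.nat_mul (i - j).toNat (j + k)]
      congr 1; ring
    rw [this]
    refine reach_block hPG ?_
    have : ((i - j).toNat : ℤ) ≤ (i - j).toNat * q := by exact_mod_cast Nat.le_mul_of_pos_right _ hq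
    omega
  have hblock : block P₁ 0 n = block P₂ 0 n := by
    rw [block_eq_block_iff]
    intro j hj
    exact h12 _ (by omega) (by have : (n : ℤ) + m ≤ κ * m := by exact_mod_cast hn
                               omega)
  have hC1 : P₁ ∈ WindowShift n (commClass n G (block P₁ 0 n)) := fun i =>
    ⟨hreach P₁ m hm0 hp1 hP₁ _ _, hreach P₁ m hm0 hp1 hP₁ _ _⟩
  have hN0 : 0 < N := by omega
  have hC2 : P₂ ∈ WindowShift n (commClass n G (block P₁ 0 n)) := fun i => by
    rw [hblock]
    exact ⟨hreach P₂ N hN0 hp2 hP₂ _ _, hreach P₂ N hN0 hp2 hP₂ _ _⟩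
  have hcomp := isIrredComponent_commClass hC1
  refine ⟨_, hcomp, ?_, ?_, ?_⟩
  · refine subEntropy_windowShift_pos (N := N * m) (Nat.mul_pos hN0 hm0) hC1 hC2 (fun t => ?_) (fun t => ?_)
      hblock hne
    · rw [← hp1.nat_mul N t]; congr 1
    · rw [← hp2.nat_mul m t]; congr 1; push_cast; ring
  · rintro k ⟨hk, x, hx, hxk⟩
    exact hp.1 k ⟨hk, x, hGX (hcomp.2.2.1 hx), hxk⟩
  · intro q hq
    have q1 : q ∣ m := hq m ⟨hm0, P₁, hC1, by rw [shiftMap_iterate]; exact funext h1⟩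
    have q2 : q ∣ N := hq N ⟨hN0, P₂, hC2, by rw [shiftMap_iterate]; exact funext h2⟩
    rw [hN] at q2
    exact (Nat.dvd_add_right ((q1.mul_left κ).add q1)).1 q2

/-- Some extension of a word avoids a given period. -/
theorem exists_word_not_periodic [Finite A] {L : Set (List A)} {M : ℕ} (hL : IsLang L M) {p : ℕ}
    (hp : 0 < p) : ∃ b ∈ L, M ≤ b.length ∧ ∃ j, j + p < b.length ∧ b[j]? ≠ b[j + p]? := by
  obtain ⟨D, -, h3⟩ := hL.exists_three_extensions
  obtain ⟨u₀, hu₀, -⟩ := hL.exists_nonempty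
  obtain ⟨w, hw, hu⟩ := hL.exists_append hu₀ (M + p)
  set u := u₀ ++ w with hudef
  have hul : M + p ≤ u.length := by rw [hudef, List.length_append]; omega
  obtain ⟨c, hc, hc'⟩ := h3 u hu
  by_contra! hcon
  have hper : ∀ (i : Fin 3) (j : ℕ), j + p < u.length + D → (u ++ c i)[j]? = (u ++ c i)[j + p]? := by
    intro i j hj
    exact hcon _ (hc' i).2 (by rw [List.length_append]; omega) j
      (by rw [List.length_append, (hc' i).1]; exact hj)
  have heq : ∀ j : ℕ, (u ++ c 0)[j]? = (u ++ c 1)[j]? := by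
    intro j
    induction j using Nat.strong_induction_on with
    | _ j ih =>
      by_cases hj : j < u.length
      · rw [List.getElem?_append_left hj, List.getElem?_append_left hj]
      by_cases hj' : j < u.length + D
      · obtain ⟨k, rfl⟩ : ∃ k, j = k + p := ⟨j - p, by omega⟩
        rw [← hper 0 k hj', ← hper 1 k hj']
        exact ih k (by omega)
      · rw [List.getElem?_eq_none (by rw [List.length_append, (hc' 0).1]; omega),
          List.getElem?_eq_none (by rw [List.length_append, (hc' 1).1]; omega)]
  have := hc (List.append_cancel_left (List.ext_getElem? heq))
  simp at this

end LoopPoints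

section Existence

variable {A : Type*}

theorem exists_extensions_finset {L : Set (List A)} {D : ℕ}
    (hbr : ∀ u ∈ L, ∃ c : Fin 3 → List A, Function.Injective c ∧
      ∀ i, (c i).length = D ∧ u ++ c i ∈ L) {b : List A} (hb : b ∈ L) (J : ℕ) :
    ∃ F : Finset (List A), F.card = 2 ^ J ∧ ∀ c ∈ F, c.length = J * D ∧ b ++ c ∈ L := by
  have key : ∀ (k : ℕ), ∀ s ∈ L,
      Branches L 0 (fun _ => ()) D (fun _ => true) k s := by
    intro k
    induction k with
    | zero => exact fun _ _ => trivial
    | succ k ih =>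
      intro s hs
      obtain ⟨c, hc, hc'⟩ := hbr s hs
      exact ⟨c 0, c 1, fun h => absurd (hc h) (by decide), (hc' 0).1, (hc' 1).1, (hc' 0).2,
        (hc' 1).2, fun _ _ _ => rfl, fun _ _ _ => rfl, ih _ (hc' 0).2, ih _ (hc' 1).2⟩
  obtain ⟨F, hF, hF'⟩ := (key J b hb).exists_finset hb
  exact ⟨F, hF, fun c hc => ⟨(hF' c hc).1, (hF' c hc).2.1⟩⟩

/-- With overwhelming probability there is a component of positive entropy with the right
period. -/
theorem bprob_no_component_le [Fintype A] [DecidableEq A] [TopologicalSpace A]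
    [DiscreteTopology A] {X : Set (ℤ → A)} {M : ℕ} (hL : IsLang (langOf X) M)
    (hM : ∀ m ≥ M, ∀ x : ℤ → A, (∀ i, block x i m ∈ langOf X) → x ∈ X) {p : ℕ}
    (hp : IsGCDOf (periodSet X) p) {D : ℕ}
    (hbr : ∀ u ∈ langOf X, ∃ c : Fin 3 → List A, Function.Injective c ∧
      ∀ i, (c i).length = D ∧ u ++ c i ∈ langOf X) (a₀ : A) :
    ∃ B : ℕ, ∀ n J : ℕ, M ≤ n → 0 < n → 34 * (J * D + B) ≤ 3 * n → n ≤ 32 * (J * D) →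
      ∀ α : ℝ, 0 ≤ α → α ≤ 1 →
      bprob α {ω : (Fin n → A) → Bool | ¬ ∃ C, IsIrredComponent
        (WindowShift n (openWords X a₀ ω)) C ∧ 0 < subEntropy C ∧ IsGCDOf (periodSet C) p} ≤
      Real.exp (-(α ^ (3 * n) * (2 ^ J / ((3 * n : ℕ) * (2 * (n + 1) : ℕ))))) := by
  obtain ⟨hp0, L₁, hloop⟩ := exists_loops hL hM hp
  obtain ⟨b₀, hb₀, hbM, j₀, hj₀, hne₀⟩ := exists_word_not_periodic hL hp0
  refine ⟨b₀.length + L₁, fun n J hMn hn0 hn1 hn2 α h0 h1 => ?_⟩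
  obtain ⟨F, hF, hF'⟩ := exists_extensions_finset hbr hb₀ J
  have : Nonempty A := ⟨a₀⟩
  have hpts : ∀ l ∈ F, ∃ (P₁ P₂ : ℤ → A) (m N : ℕ), P₂ ∈ X ∧ 0 < m ∧ n + m ≤ 33 * m ∧
      N = 33 * m + m + p ∧ N ≤ 3 * n ∧ (∀ t, P₁ (t + m) = P₁ t) ∧ (∀ t, P₂ (t + N) = P₂ t) ∧
      (∀ t : ℤ, 0 ≤ t → t < (33 : ℕ) * m → P₁ t = P₂ t) ∧ (∀ t : ℤ, l <:+: block P₂ t n) ∧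
      P₁ ≠ P₂ := by
    intro l hl
    obtain ⟨hlJ, hbl⟩ := hF' l hl
    have hbll : (b₀ ++ l).length = b₀.length + J * D := by rw [List.length_append, hlJ]
    obtain ⟨g₁, g₂, hg, hgL, h₁, h₂⟩ := hloop _ hbl (by omega)
    have hl1 : (b₀ ++ l ++ g₁).length = b₀.length + J * D + g₁.length := by
      rw [List.length_append, hbll]
    have hl2 : (b₀ ++ l ++ g₂).length = b₀.length + J * D + g₂.length := by
      rw [List.length_append, hbll]
    obtain ⟨P₁, P₂, hX, q1, q2, q3, q4, q5⟩ := exists_loop_points hL hM (by omega)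
      (List.length_pos_iff.1 (by omega)) h₁ h₂ hg ⟨j₀, by omega, by
        rwa [List.getElem?_append_left (by omega), List.getElem?_append_left (by omega)]⟩
      (κ := 33) (by norm_num) rfl rfl
    refine ⟨P₁, P₂, _, _, hX, ?_, ?_, rfl, ?_, q1, q2, q3, fun t => ?_, q5⟩
    · omega
    · omega
    · omega
    · obtain ⟨s, hs1, hs2, hs⟩ := q4 (t - 1)
      have : b₀ ++ l <:+: block P₂ t n := by
        rw [← hs]
        exact block_infix_block _ (by omega) (by omega)
      exact (List.suffix_append b₀ l).isInfix.trans this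
  choose! P₁ P₂ m N hX hm0 hnm hN hNn h1' h2' h12 hinf hne using hpts
  set S : List A → Finset (Fin n → A) := fun l =>
    (Finset.range (N l)).image fun i : ℕ => toWord a₀ n (block (P₂ l) i n) with hS
  have hsub : {ω : (Fin n → A) → Bool | ¬ ∃ C, IsIrredComponent
        (WindowShift n (openWords X a₀ ω)) C ∧ 0 < subEntropy C ∧ IsGCDOf (periodSet C) p} ⊆
      {ω | ∀ l ∈ F, ∃ f ∈ S l, ω f = false} := by
    intro ω hω l hl
    by_contra! hcon
    refine hω ?_
    have hGX : WindowShift n (openWords X a₀ ω) ⊆ X := fun x hx => hM n hMn x fun i => (hx i).1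
    have hN0 : 0 < N l := by have := hN l hl; have := hm0 l hl; omega
    refine exists_component_of_loop_points hGX hp (hm0 l hl) (hnm l hl) (hN l hl) (fun t => ?_)
      (h1' l hl) (h2' l hl) (h12 l hl) (hne l hl)
    refine ⟨block_mem_langOf (hX l hl) _ _, ?_⟩
    have hper : Function.Periodic (P₂ l) (N l : ℤ) := h2' l hl
    have hr0 := Int.emod_nonneg t (b := (N l : ℤ)) (by omega)
    have hrN := Int.emod_lt_of_pos t (b := (N l : ℤ)) (by omega)
    have : block (P₂ l) t n = block (P₂ l) ((t % N l).toNat : ℤ) n := by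
      rw [block_eq_block_iff]
      intro j _
      rw [Int.toNat_of_nonneg hr0, ← hper.int_mul (t / N l) (t % N l + j)]
      congr 1
      have := Int.emod_add_ediv_mul t (N l)
      simp only [Int.cast_id]
      omega
    rw [this]
    have := hcon _ (Finset.mem_image_of_mem _ (Finset.mem_range.2
      (show (t % N l).toNat < N l by omega)))
    simpa using this
  refine (bprob_mono h0 h1 hsub).trans ?_
  have := bprob_forall_exists_window_false_le h0 h1 F (n := n) (m := J * D) (s := 3 * n)
    (by omega) (separatesWords_toWord a₀ n) S
    (fun l hl => Finset.card_image_le.trans (by rw [Finset.card_range]; exact hNn l hl))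
    (c := id) (r := id) Function.injective_id.injOn Function.injective_id.injOn
    (fun l hl => (hF' l hl).1) (fun l hl => (hF' l hl).1) (by
      intro l hl f hf
      obtain ⟨i, -, rfl⟩ := Finset.mem_image.1 hf
      exact ⟨_, length_block _ _ _, rfl, Or.inl (hinf l hl _)⟩)
  rw [hF] at this
  exact_mod_cast this

end Existence

section Asymptotics

theorem eventually_mul_le_pow_div {β C : ℝ} {D : ℕ} (hD : 0 < D) (hβ0 : 0 ≤ β) (hβ1 : β ≤ 1)
    (hβ : 3 / 4 ≤ β ^ (48 * D)) (hC : 0 < C) : ∀ᶠ n : ℕ in atTop,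
      C * n ≤ β ^ (3 * n) * (2 ^ (n / (16 * D)) / ((3 * n : ℕ) * (2 * (n + 1) : ℕ))) := by
  have hlim := tendsto_pow_const_div_const_pow_of_one_lt 3 (show (1 : ℝ) < 3 / 2 by norm_num)
  set δ : ℝ := 1 / (24 * C * (16 * D) ^ 3) with hδ
  have hδ0 : 0 < δ := by positivity
  have hk : Tendsto (fun n : ℕ => n / (16 * D) + 1) atTop atTop :=
    tendsto_add_atTop_nat 1 |>.comp (Nat.tendsto_div_const_atTop (by omega))
  filter_upwards [hk.eventually (hlim.eventually (gt_mem_nhds hδ0)), eventually_ge_atTop 1]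
    with n hn hn1
  set J := n / (16 * D) with hJ
  have hnJ : n ≤ 16 * D * (J + 1) := by
    have := Nat.lt_mul_div_succ n (show 0 < 16 * D by omega)
    exact this.le
  have hb : (3 / 4 : ℝ) ^ (J + 1) ≤ β ^ (3 * n) := by
    calc (3 / 4 : ℝ) ^ (J + 1) ≤ (β ^ (48 * D)) ^ (J + 1) := by gcongr
      _ = β ^ (48 * D * (J + 1)) := (pow_mul _ _ _).symm
      _ ≤ β ^ (3 * n) := pow_le_pow_of_le_one hβ0 hβ1 (by nlinarith)
  rw [div_lt_iff₀ (by positivity), hδ, one_div_mul_eq_div, lt_div_iff₀ (by positivity)] at hn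
  have hn' : (1 : ℝ) ≤ n := by exact_mod_cast hn1
  have hnJ' : (n : ℝ) ≤ 16 * D * (J + 1) := by exact_mod_cast hnJ
  have hpow : (3 / 4 : ℝ) ^ (J + 1) * 2 ^ J = (3 / 2) ^ (J + 1) / 2 := by
    rw [show (3 / 2 : ℝ) = 3 / 4 * 2 by norm_num, mul_pow, pow_succ 2 J]; ring
  have hcube : (n : ℝ) ^ 3 ≤ (16 * D * (J + 1)) ^ 3 := by gcongr
  rw [← mul_div_assoc, le_div_iff₀ (by positivity)]
  calc C * n * (((3 * n : ℕ) : ℝ) * (2 * (n + 1) : ℕ)) = C * n ^ 2 * (6 * (n + 1)) := by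
        push_cast; ring
    _ ≤ C * n ^ 2 * (12 * n) :=
        mul_le_mul_of_nonneg_left (by linarith) (by positivity)
    _ = 12 * C * n ^ 3 := by ring
    _ ≤ 12 * C * (16 * D * (J + 1)) ^ 3 := by gcongr
    _ ≤ (3 / 2) ^ (J + 1) / 2 := by push_cast at hn; linarith
    _ = (3 / 4 : ℝ) ^ (J + 1) * 2 ^ J := hpow.symm
    _ ≤ _ := by gcongr

/-- The bounds on the failure probabilities decay exponentially. -/
theorem eventually_failure_bound_le {a : ℝ} (ha : 1 ≤ a) {D : ℕ} (hD : 0 < D) {ε α : ℝ}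
    (hε0 : 0 ≤ ε) (hε : ε ≤ 1 / (576 * D * a ^ (32 * D))) (hα : 1 - α = ε * ε) :
    ∀ᶠ n : ℕ in atTop,
      2 * (a ^ (2 * n) * (12 * D * ε) ^ (n / (16 * D))) +
      a ^ (4 * n) * Real.exp (-((1 - ε) ^ (2 * n) *
        (2 ^ (n / (16 * D)) / ((2 * n : ℕ) * (2 * (n + 1) : ℕ))))) +
      Real.exp (-(α ^ (3 * n) * (2 ^ (n / (16 * D)) / ((3 * n : ℕ) * (2 * (n + 1) : ℕ))))) ≤
      (6 * a ^ (32 * D) + 2) * Real.exp (-(1 / (16 * D)) * n) := by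
  have hD' : (1 : ℝ) ≤ D := by exact_mod_cast hD
  set q := a ^ (32 * D) with hq
  have hq1 : 1 ≤ q := one_le_pow₀ ha
  have hεD : 576 * D * q * ε ≤ 1 := by
    rw [le_div_iff₀ (by positivity)] at hε; linarith
  have hDε : 576 * (D * ε) ≤ 1 := by
    have : D * ε * 1 ≤ D * ε * q := by gcongr
    linarith
  have hε1 : 576 * ε ≤ 1 := by
    have : 1 * ε ≤ D * ε := by gcongr
    linarith
  have hβ : 3 / 4 ≤ (1 - ε) ^ (48 * D) := by
    have := one_add_mul_le_pow (a := -ε) (by linarith) (48 * D)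
    rw [← sub_eq_add_neg] at this
    refine le_trans ?_ this
    push_cast; linarith
  have hC : 0 < 1 + 4 * Real.log a := by have := Real.log_nonneg ha; linarith
  filter_upwards [eventually_mul_le_pow_div hD (by linarith : (0 : ℝ) ≤ 1 - ε) (by linarith) hβ hC,
    eventually_ge_atTop 1] with n hX hn1
  set J := n / (16 * D) with hJ
  have hnJ : n ≤ 16 * D * (J + 1) := (Nat.lt_mul_div_succ n (show 0 < 16 * D by omega)).le
  have hn' : (1 : ℝ) ≤ n := by exact_mod_cast hn1
  have hρ : 1 / (16 * (D : ℝ)) * n ≤ J + 1 := by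
    rw [one_div_mul_eq_div, div_le_iff₀ (by positivity)]
    have : (n : ℝ) ≤ 16 * D * (J + 1) := by exact_mod_cast hnJ
    linarith
  have hρn : 1 / (16 * (D : ℝ)) * n ≤ n := by
    rw [one_div_mul_eq_div]
    exact div_le_self (by positivity) (by linarith)
  set X := (1 - ε) ^ (3 * n) * (2 ^ J / ((3 * n : ℕ) * (2 * (n + 1) : ℕ)) : ℝ) with hXdef
  have t1 : a ^ (2 * n) * (12 * D * ε) ^ J ≤ 3 * q * Real.exp (-(1 / (16 * D)) * n) := by
    have h1 : a ^ (2 * n) ≤ q * q ^ J := by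
      rw [hq, ← pow_mul, ← pow_add]
      exact pow_le_pow_right₀ ha (by nlinarith)
    have h2 : 12 * D * ε * q ≤ Real.exp (-1) := by
      have : (1 / 3 : ℝ) ≤ Real.exp (-1) := by
        rw [Real.exp_neg, one_div]
        exact inv_anti₀ (Real.exp_pos _) (by linarith [Real.exp_one_lt_d9])
      linarith
    calc a ^ (2 * n) * (12 * D * ε) ^ J ≤ q * q ^ J * (12 * D * ε) ^ J := by gcongr
      _ = q * (12 * D * ε * q) ^ J := by rw [mul_pow _ q]; ring
      _ ≤ q * Real.exp (-1) ^ J := by gcongr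
      _ = q * (Real.exp 1 * Real.exp (-(J + 1))) := by
          rw [← Real.exp_nat_mul, ← Real.exp_add]; congr 2; ring
      _ ≤ q * (3 * Real.exp (-(1 / (16 * D)) * n)) := by
          gcongr
          · linarith [Real.exp_one_lt_d9]
          · linarith
      _ = _ := by ring
  have hexp : a ^ (4 * n) * Real.exp (-X) ≤ Real.exp (-(1 / (16 * D)) * n) := by
    have : a ^ (4 * n) = Real.exp (4 * n * Real.log a) := by
      rw [show (4 * n * Real.log a : ℝ) = (4 * n : ℕ) * Real.log a by push_cast; ring,
        Real.exp_nat_mul, Real.exp_log (by linarith)]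
    rw [this, ← Real.exp_add, Real.exp_le_exp]
    linarith
  have t2 : a ^ (4 * n) * Real.exp (-((1 - ε) ^ (2 * n) *
      (2 ^ J / ((2 * n : ℕ) * (2 * (n + 1) : ℕ))))) ≤ Real.exp (-(1 / (16 * D)) * n) := by
    refine le_trans ?_ hexp
    gcongr
    rw [hXdef]
    have : (1 - ε) ^ (3 * n) ≤ (1 - ε) ^ (2 * n) :=
      pow_le_pow_of_le_one (by linarith) (by linarith) (by omega)
    have h0 : 0 ≤ 1 - ε := by linarith
    gcongr
    norm_num
  have t3 : Real.exp (-(α ^ (3 * n) * (2 ^ J / ((3 * n : ℕ) * (2 * (n + 1) : ℕ))))) ≤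
      Real.exp (-(1 / (16 * D)) * n) := by
    refine le_trans ?_ hexp
    have h1 : 1 ≤ a ^ (4 * n) := one_le_pow₀ ha
    refine le_trans ?_ (le_mul_of_one_le_left (Real.exp_pos _).le h1)
    have h0 : 0 ≤ 1 - ε := by linarith
    have h2 : 1 - ε ≤ α := by nlinarith
    rw [Real.exp_le_exp, hXdef]
    gcongr
  linarith

end Asymptotics

section Main

/-- The failure probability is eventually exponentially small. -/
theorem exists_eventually_one_sub_bprob_le {A : Type*} [Fintype A] [DecidableEq A]
    [TopologicalSpace A] [DiscreteTopology A] {X : Set (ℤ → A)} (hSFT : IsSFT X)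
    (hirr : IsIrredSubshift X) {lam : ℝ} (hlam : 1 < lam)
    (hent : Tendsto (fun n : ℕ => Real.log ((wordsOf X n).ncard) / (n : ℝ))
      atTop (𝓝 (Real.log lam))) {p : ℕ} (hp : IsGCDOf (periodSet X) p) :
    ∃ c : ℝ, 0 < c ∧ c ≤ 1 ∧ ∃ K : ℝ, 0 < K ∧ ∃ ρ : ℝ, 0 < ρ ∧
      ∀ α : ℝ, 1 - c < α → α ≤ 1 → ∀ᶠ n : ℕ in atTop,
        1 - bprob α
          {ω : (Fin n → A) → Bool |
            ∃ C : Set (ℤ → A), IsIrredComponent (XRes X ω) C ∧ 0 < subEntropy C ∧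
              (∀ C' : Set (ℤ → A),
                IsIrredComponent (XRes X ω) C' → 0 < subEntropy C' → C' = C) ∧
              IsGCDOf (periodSet C) p}
          ≤ K * Real.exp (-ρ * n) := by
  obtain ⟨M, hM⟩ := hSFT.exists_memory
  have hL := isLang_langOf hSFT hirr hlam hent hM
  obtain ⟨u, -, hu⟩ := hL.exists_nonempty
  let a₀ := u.head hu
  obtain ⟨D₁, hD₁, h₁⟩ := hL.exists_three_extensions
  obtain ⟨D₂, hD₂, h₂⟩ := hL.rev.exists_three_extensions
  obtain ⟨D, hD, hbr, hbr'⟩ : ∃ D : ℕ, 0 < D ∧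
      (∀ u ∈ langOf X, ∃ c : Fin 3 → List A, Function.Injective c ∧
        ∀ i, (c i).length = D ∧ u ++ c i ∈ langOf X) ∧
      (∀ u ∈ revLang (langOf X), ∃ c : Fin 3 → List A, Function.Injective c ∧
        ∀ i, (c i).length = D ∧ u ++ c i ∈ revLang (langOf X)) := by
    refine ⟨D₂ * D₁, by positivity, IsLang.three_extensions_mul h₁ D₂ hD₂, ?_⟩
    rw [mul_comm]
    exact IsLang.three_extensions_mul h₂ D₁ hD₁
  obtain ⟨L₀, hglue⟩ := hL.exists_bounded_glue
  obtain ⟨B, hB⟩ := bprob_no_component_le hL hM hp hbr a₀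
  set a : ℝ := (Fintype.card A : ℝ) + 1 with ha
  have ha1 : 1 ≤ a := by rw [ha]; linarith [(Fintype.card A).cast_nonneg (α := ℝ)]
  have hD' : (1 : ℝ) ≤ D := by exact_mod_cast hD
  have hq : (1 : ℝ) ≤ a ^ (32 * D) := one_le_pow₀ ha1
  set ε₀ : ℝ := 1 / (576 * D * a ^ (32 * D)) with hε₀
  have hε₀pos : 0 < ε₀ := by positivity
  have hε₀D : 576 * (D * ε₀) ≤ 1 := by
    have h1 : 576 * D * a ^ (32 * D) * ε₀ = 1 := by rw [hε₀]; field_simp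
    have h2 : D * ε₀ * 1 ≤ D * ε₀ * a ^ (32 * D) := by gcongr
    linarith
  have hε₀1 : ε₀ ≤ 1 := by
    have : 1 * ε₀ ≤ D * ε₀ := by gcongr
    linarith
  refine ⟨ε₀ * ε₀, by positivity, mul_le_one₀ hε₀1 hε₀pos.le hε₀1, 6 * a ^ (32 * D) + 2,
    by positivity, 1 / (16 * D), by positivity, fun α hα hα1 => ?_⟩
  set ε := √(1 - α) with hε
  have hεε : 1 - α = ε * ε := (Real.mul_self_sqrt (by linarith)).symm
  have hε0 : 0 ≤ ε := Real.sqrt_nonneg _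
  have hεle : ε ≤ ε₀ := Real.sqrt_le_iff.2 ⟨hε₀pos.le, by nlinarith⟩
  have hα0 : 0 ≤ α := by
    have := mul_le_one₀ hε₀1 hε₀pos.le hε₀1
    linarith
  have hDε : 576 * (D * ε) ≤ 1 := le_trans (by gcongr) hε₀D
  filter_upwards [eventually_failure_bound_le ha1 hD hε0 hεle hεε, eventually_ge_atTop
    (M + 16 * D + 4 * L₀ + 64 * B + 16)] with n hbound hn
  set J := n / (16 * D) with hJ
  have hJn : 16 * (J * D) ≤ n := by
    have := Nat.div_mul_le_self n (16 * D)
    rw [← hJ] at this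
    linarith
  have hnJ : n < 16 * (J * D) + 16 * D := by
    have := Nat.lt_mul_div_succ n (show 0 < 16 * D by omega)
    rw [← hJ] at this
    linarith
  have hJ1 : 1 ≤ J := by
    rw [hJ, Nat.one_le_div_iff (by omega)]; omega
  have hJD : D ≤ J * D := Nat.le_mul_of_pos_left D hJ1
  have hassoc : 2 * J * D = 2 * (J * D) := by ring
  have hX (ω : (Fin n → A) → Bool) := xRes_eq_windowShift hM (show M ≤ n by omega) a₀ ω
  have hconn := bprob_not_connects_le (β := 1 - ε) (by linarith) (by linarith)
    (by linarith) hD (show 0 < n by omega) (separatesWords_toWord a₀ n) hL hbr hbr' hglue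
    (J := J) (by omega) (α := α) (by rw [hεε]; ring)
  have hcomp := hB n J (by omega) (by omega) (by omega) (by omega) α hα0 hα1
  rw [sub_sub_cancel] at hconn
  rw [one_sub_bprob]
  refine le_trans (le_trans (bprob_mono hα0 hα1 ?_)
    ((bprob_union_le hα0 hα1 _ _).trans (add_le_add hconn hcomp))) hbound
  intro ω hω
  by_contra hcon
  simp only [Set.mem_union, Set.mem_ofPred_eq, not_or, not_not] at hcon
  obtain ⟨hc, C, hC, hpos, hper⟩ := hcon
  refine hω ⟨C, by rwa [hX], hpos, fun C' hC' hpos' => ?_, hper⟩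
  rw [hX] at hC'
  refine hC'.eq_of_connects hL ?_ (by omega) hc hpos' hC hpos
  rw [← hX]
  exact fun x hx => hx.1

end Main

/-- **Theorem 1.4.**  Let `X` be an irreducible SFT with positive entropy
`h(X) = log λ` and period `p`.  Let `W_n` be the event that `X_ω` has a unique
irreducible component `C` of positive entropy and that `C` has period `p`.
Then there is `c > 0` such that for `1 − c < α ≤ 1`, `ℙ(W_n) → 1`, with
exponential convergence in `n`. -/
theorem random_SFT_unique_component {A : Type*} [Fintype A] [DecidableEq A]
    [TopologicalSpace A] [DiscreteTopology A]
    (X : Set (ℤ → A)) (hSFT : IsSFT X) (hirr : IsIrredSubshift X)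
    (lam : ℝ) (hlam : 1 < lam)
    (hent : Tendsto (fun n : ℕ => Real.log ((wordsOf X n).ncard) / (n : ℝ))
      atTop (𝓝 (Real.log lam)))
    (p : ℕ) (hp : IsGCDOf (periodSet X) p) :
    ∃ c : ℝ, 0 < c ∧ ∀ α : ℝ, 1 - c < α → α ≤ 1 →
      Tendsto
        (fun n : ℕ => bprob α
          {ω : (Fin n → A) → Bool |
            ∃ C : Set (ℤ → A), IsIrredComponent (XRes X ω) C ∧ 0 < subEntropy C ∧
              (∀ C' : Set (ℤ → A),
                IsIrredComponent (XRes X ω) C' → 0 < subEntropy C' → C' = C) ∧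
              IsGCDOf (periodSet C) p})
        atTop (𝓝 1) ∧
      ∃ K : ℝ, 0 < K ∧ ∃ ρ : ℝ, 0 < ρ ∧ ∀ᶠ n : ℕ in atTop,
        1 - bprob α
          {ω : (Fin n → A) → Bool |
            ∃ C : Set (ℤ → A), IsIrredComponent (XRes X ω) C ∧ 0 < subEntropy C ∧
              (∀ C' : Set (ℤ → A),
                IsIrredComponent (XRes X ω) C' → 0 < subEntropy C' → C' = C) ∧
              IsGCDOf (periodSet C) p}
          ≤ K * Real.exp (-ρ * n) := by
  obtain ⟨c, hc0, hc1, K, hK, ρ, hρ, h⟩ :=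
    exists_eventually_one_sub_bprob_le hSFT hirr hlam hent hp
  refine ⟨c, hc0, fun α hα hα1 => ⟨?_, K, hK, ρ, hρ, h α hα hα1⟩⟩
  have hlim : Tendsto (fun n : ℕ => 1 - K * Real.exp (-ρ * n)) atTop (𝓝 1) := by
    have h1 : Tendsto (fun n : ℕ => -ρ * (n : ℝ)) atTop atBot :=
      tendsto_natCast_atTop_atTop.const_mul_atTop_of_neg (by linarith)
    simpa using ((Real.tendsto_exp_atBot.comp h1).const_mul K).const_sub 1
  refine tendsto_of_tendsto_of_tendsto_of_le_of_le' hlim tendsto_const_nhds ?_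
    (Eventually.of_forall fun n => bprob_le_one (by linarith) hα1 _)
  filter_upwards [h α hα hα1] with n hn
  linarith
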